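/- Suppose v ∈ M[m] is a common eigenvector of all Gaudin transfer matrices: 𝒯_k(u) v = λ_k(u) v for scalar rational functions λ_k(u), k = 0,…,N, and let D_v(u,∂) = Σ_{k=0}^N (−1)^k λ_k(u) ∂^{N−k} be the associated scalar fundamental differential operator. Then: (i) if the diagonal entries K_1,…,K_N of K are pairwise distinct, the space of (local holomorphic) solutions of D_v(u,∂) f = 0 is spanned over ℂ by N quasi-exponentials e^{K_1 u} p_1(u), …, e^{K_N u} p_N(u), where each p_i ∈ ℂ[u] is a polynomial of degree exactly m_i; (ii) if K = 0 and v ∈ sing M[m], the solution space of D_v(u,∂) f = 0 is spanned over ℂ by N polynomials p_1(u),…,p_N(u) of degrees exactly m_1 + N − 1, m_2 + N − 2, …, m_N, respectively. -/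

import Mathlib

noncomputable section

namespace GaudinModel

/-- A vector-valued quasi-exponential: a finite sum of functions `e^{λu} p(u)` with `p` a
vector-valued polynomial. -/
def IsQE {M : Type*} [AddCommGroup M] [Module ℂ M] (f : ℂ → M) : Prop :=
  ∃ (k d : ℕ) (lam : Fin k → ℂ) (v : Fin k → Fin d → M),
    ∀ u : ℂ, f u = ∑ i : Fin k, ∑ j : Fin d,
      (Complex.exp (lam i * u) * u ^ (j : ℕ)) • v i j

variable {N n : ℕ}

/-- Points away from the singular points `z_1, …, z_n`. -/
def GoodG {n : ℕ} (z : Fin n → ℂ) (u : ℂ) : Prop := ∀ j : Fin n, u ≠ z j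

section Setup

variable (V : Fin n → Type*) [∀ i, AddCommGroup (V i)] [∀ i, Module ℂ (V i)]
  (M : Type*) [NormedAddCommGroup M] [NormedSpace ℂ M]
  (E : ∀ i : Fin n, Fin N → Fin N → (V i →ₗ[ℂ] V i))
  (φ : M ≃ₗ[ℂ] PiTensorProduct ℂ V)

/-- The commutation relations of `gl_N`: `[e_{ab}, e_{cd}] = δ_{bc} e_{ad} − δ_{da} e_{cb}`,
for the operators `E i a b` (the action of `e_{ab}` on the `i`-th factor `V i`). -/
def GlRel : Prop :=
  ∀ (i : Fin n) (a b c d : Fin N),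
    E i a b ∘ₗ E i c d - E i c d ∘ₗ E i a b =
      (if b = c then (1 : ℂ) else 0) • E i a d - (if d = a then (1 : ℂ) else 0) • E i c b

/-- Each `V i` is the irreducible finite-dimensional `gl_N`-module with highest weight
`Λ i`: it is generated by a nonzero vector `v` with `e_{ab} v = 0` for `a < b` and
`e_{aa} v = Λ_a v`. -/
def IsHW (Λ : Fin n → Fin N → ℤ) : Prop :=
  ∀ i : Fin n, ∃ v : V i, v ≠ 0 ∧
    (∀ a b : Fin N, a < b → E i a b v = 0) ∧
    (∀ a : Fin N, E i a a v = (Λ i a : ℂ) • v) ∧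
    ∀ W : Submodule ℂ (V i), (∀ a b : Fin N, ∀ x ∈ W, E i a b x ∈ W) → v ∈ W →
      ∀ x : V i, x ∈ W

/-- `e_{ab}` acting in the `j`-th tensor factor of `M ≃ V 1 ⊗ ⋯ ⊗ V n`. -/
def EE (j : Fin n) (a b : Fin N) : Module.End ℂ M :=
  φ.symm.toLinearMap ∘ₗ
    (PiTensorProduct.map
      (Function.update (fun i : Fin n => (LinearMap.id : V i →ₗ[ℂ] V i)) j (E j a b))) ∘ₗ
    φ.toLinearMap

variable (z : Fin n → ℂ) (K : Matrix (Fin N) (Fin N) ℂ)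

/-- `X_{ab}(u,∂) = δ_{ab} ∂ − K_{ab} − ∑_j e_{ba}^{(j)}/(u − z_j)`,
acting on `M`-valued functions. -/
def Xg (a b : Fin N) (f : ℂ → M) : ℂ → M :=
  fun u => (if a = b then deriv f u else 0) - K a b • f u
    - ∑ j : Fin n, (u - z j)⁻¹ • (EE V M E φ j b a) (f u)

/-- The universal differential operator
`D_{K,M}(u,∂) = ∑_{σ ∈ S_N} sgn(σ) X_{1σ(1)}(u,∂) ⋯ X_{Nσ(N)}(u,∂)`. -/
def Dg (f : ℂ → M) : ℂ → M :=
  fun u => ∑ σ : Equiv.Perm (Fin N),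
    ((Equiv.Perm.sign σ : ℤˣ) : ℤ) •
      (((List.ofFn fun a : Fin N => Xg V M E φ z K a (σ a)).foldr (· ∘ ·) id) f u)

/-- The weight subspace `M[m]`. -/
def Wt (m : Fin N → ℤ) : Submodule ℂ M :=
  ⨅ a : Fin N, LinearMap.ker
    ((∑ j : Fin n, EE V M E φ j a a) - (m a : ℂ) • (1 : Module.End ℂ M))

/-- The subspace `sing M[m]` of `gl_N`-singular vectors of weight `m`. -/
def SingWt (m : Fin N → ℤ) : Submodule ℂ M :=
  Wt V M E φ m ⊓ ⨅ a : Fin N, ⨅ b : Fin N, ⨅ _ : a < b,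
    LinearMap.ker (∑ j : Fin n, EE V M E φ j a b)

end Setup

end GaudinModel

namespace GaudinModel

/-- The scalar fundamental differential operator
`D_v(u,∂) = ∑_{k=0}^N (−1)^k λ_k(u) ∂^{N−k}` associated with eigenvalues `λ_k`. -/
def Dfund (N : ℕ) (lam : ℕ → ℂ → ℂ) (f : ℂ → ℂ) : ℂ → ℂ :=
  fun u => ∑ k ∈ Finset.range (N + 1), (-1 : ℂ) ^ k * lam k u * iteratedDeriv (N - k) f u


end GaudinModel

namespace GaudinModel

/-! ### Row determinants with noncommuting entries -/

section Alt
variable {A : Type*} [Ring A] {L : Type*} {N : ℕ}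

def Rd (Y : ℕ → L → Fin N → A) (r : Fin N → L) : A :=
  ∑ σ : Equiv.Perm (Fin N), ((Equiv.Perm.sign σ : ℤˣ) : ℤ) •
    (List.ofFn fun k : Fin N => Y k (r k) (σ k)).prod

lemma ofFn_prod_four : ∀ {n : ℕ} (g1 g2 g3 g4 : Fin n → A) (i : ℕ) (hi : i + 1 < n)
    (_ : ∀ k : Fin n, k.val ≠ i → k.val ≠ i + 1 → g1 k = g2 k ∧ g1 k = g3 k ∧ g1 k = g4 k)
    (_ : g1 ⟨i, by omega⟩ * g1 ⟨i + 1, hi⟩ + g2 ⟨i, by omega⟩ * g2 ⟨i + 1, hi⟩ =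
      g3 ⟨i, by omega⟩ * g3 ⟨i + 1, hi⟩ + g4 ⟨i, by omega⟩ * g4 ⟨i + 1, hi⟩),
    (List.ofFn g1).prod + (List.ofFn g2).prod = (List.ofFn g3).prod + (List.ofFn g4).prod
  | 0, _, _, _, _, i, hi, _, _ => absurd hi (by omega)
  | 1, _, _, _, _, i, hi, _, _ => absurd hi (by omega)
  | n + 2, g1, g2, g3, g4, 0, hi, hk, h => by
    simp only [List.ofFn_succ, List.prod_cons, ← mul_assoc]
    have e2 : (fun i : Fin n => g2 i.succ.succ) = fun i => g1 i.succ.succ := by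
      funext i; exact ((hk i.succ.succ (by simp) (by simp)).1).symm
    have e3 : (fun i : Fin n => g3 i.succ.succ) = fun i => g1 i.succ.succ := by
      funext i; exact ((hk i.succ.succ (by simp) (by simp)).2.1).symm
    have e4 : (fun i : Fin n => g4 i.succ.succ) = fun i => g1 i.succ.succ := by
      funext i; exact ((hk i.succ.succ (by simp) (by simp)).2.2).symm
    rw [e2, e3, e4, ← add_mul, ← add_mul]
    congr 1
  | n + 2, g1, g2, g3, g4, i + 1, hi, hk, h => by
    rw [List.ofFn_succ (f := g1), List.ofFn_succ (f := g2), List.ofFn_succ (f := g3),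
      List.ofFn_succ (f := g4)]
    simp only [List.prod_cons]
    have h0 := hk 0 (by simp) (by simp)
    rw [← h0.1, ← h0.2.1, ← h0.2.2, ← mul_add, ← mul_add]
    congr 1
    refine ofFn_prod_four _ _ _ _ i (by omega) ?_ ?_
    · intro k h1 h2
      exact hk k.succ (by simpa using h1) (by simpa using h2)
    · exact h

/-- The exchange relation. -/
def Exch (N : ℕ) (Y : ℕ → L → Fin N → A) : Prop :=
  ∀ (k : ℕ) (ρ ρ' : L) (b d : Fin N), k + 1 < N →
    Y k ρ b * Y (k + 1) ρ' d + Y k ρ' b * Y (k + 1) ρ d =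
    Y k ρ d * Y (k + 1) ρ' b + Y k ρ' d * Y (k + 1) ρ b

lemma Rd_adj {Y : ℕ → L → Fin N → A} (hY : Exch N Y) (r : Fin N → L) (i : ℕ) (hi : i + 1 < N) :
    Rd Y (r ∘ Equiv.swap (⟨i, by omega⟩ : Fin N) ⟨i + 1, hi⟩) = - Rd Y r := by
  rw [eq_neg_iff_add_eq_zero, Rd, Rd, ← Finset.sum_add_distrib]
  set τ : Equiv.Perm (Fin N) := Equiv.swap (⟨i, by omega⟩ : Fin N) ⟨i + 1, hi⟩ with hτ
  have hne : (⟨i, by omega⟩ : Fin N) ≠ ⟨i + 1, hi⟩ := by simp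
  refine Finset.sum_involution (fun σ _ => σ * τ) ?_ ?_ ?_ ?_
  · intro σ _
    have hs : ((Equiv.Perm.sign (σ * τ) : ℤˣ) : ℤ) = - ((Equiv.Perm.sign σ : ℤˣ) : ℤ) := by
      rw [Equiv.Perm.sign_mul, hτ, Equiv.Perm.sign_swap hne]; simp
    rw [hs, ← smul_add, ← smul_add, neg_smul, ← sub_eq_add_neg, ← smul_sub, sub_eq_zero.2, smul_zero]
    refine ofFn_prod_four _ _ _ _ i hi ?_ ?_
    · intro k h1 h2
      have : τ k = k := Equiv.swap_apply_of_ne_of_ne (by intro h; apply h1; rw [h])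
        (by intro h; apply h2; rw [h])
      simp [this]
    · have t1 : τ ⟨i, by omega⟩ = ⟨i + 1, hi⟩ := Equiv.swap_apply_left _ _
      have t2 : τ ⟨i + 1, hi⟩ = ⟨i, by omega⟩ := Equiv.swap_apply_right _ _
      simp only [Function.comp, Equiv.Perm.mul_apply, t1, t2]
      exact hY i _ _ _ _ hi
  · intro σ _ _ h
    have : τ = 1 := by simpa using h
    exact hne (Equiv.swap_eq_one_iff.1 this)
  · intros; exact Finset.mem_univ _
  · intro σ _
    simp [mul_assoc, hτ]

lemma Rd_perm : ∀ {N : ℕ} {Y : ℕ → L → Fin N → A} (_ : Exch N Y) (r : Fin N → L)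
    (π : Equiv.Perm (Fin N)), Rd Y (r ∘ π) = ((Equiv.Perm.sign π : ℤˣ) : ℤ) • Rd Y r := by
  intro N
  cases N with
  | zero =>
    intro Y hY r π
    have : π = 1 := Subsingleton.elim _ _
    subst this; simp
  | succ n =>
    intro Y hY r π
    have hπ : π ∈ Submonoid.closure
        (Set.range fun i : Fin n => Equiv.swap i.castSucc i.succ) := by
      rw [Equiv.Perm.mclosure_swap_castSucc_succ]; trivial
    induction hπ using Submonoid.closure_induction generalizing r with
    | mem x hx =>
      obtain ⟨i, rfl⟩ := hx
      have := Rd_adj hY r i.val (by omega)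
      have hne : i.castSucc ≠ i.succ := (Fin.castSucc_lt_succ (i := i)).ne
      simp only [Equiv.Perm.sign_swap hne, Units.val_neg, Units.val_one, neg_smul, one_smul]
      exact this
    | one => simp
    | mul x y _ _ hx hy =>
      rw [Equiv.Perm.coe_mul, ← Function.comp_assoc, hy, hx, smul_smul, Equiv.Perm.sign_mul]
      congr 1
      push_cast
      ring

lemma Rd_rep [Algebra ℂ A] {Y : ℕ → L → Fin N → A} (hY : Exch N Y) (r : Fin N → L)
    {p q : Fin N} (hpq : p ≠ q) (h : r p = r q) : Rd Y r = 0 := by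
  have h1 := Rd_perm hY r (Equiv.swap p q)
  have h2 : r ∘ Equiv.swap p q = r := by
    funext k
    simp only [Function.comp]
    rcases eq_or_ne k p with rfl | hp
    · simp [h]
    rcases eq_or_ne k q with rfl | hq
    · simp [h]
    rw [Equiv.swap_apply_of_ne_of_ne hp hq]
  rw [h2, Equiv.Perm.sign_swap hpq] at h1
  have h3 : (2 : ℂ) • Rd Y r = 0 := by
    rw [two_smul]; nth_rewrite 1 [h1]; simp
  exact (smul_eq_zero.1 h3).resolve_left two_ne_zero

/-- Cofactor along position zero. -/
def Cof {n : ℕ} (Y : ℕ → L → Fin (n + 1) → A) (r : Fin n → L) (i : Fin (n + 1)) : A :=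
  ∑ σ : Equiv.Perm (Fin (n + 1)), if σ 0 = i then ((Equiv.Perm.sign σ : ℤˣ) : ℤ) •
    (List.ofFn fun k : Fin n => Y (k + 1) (r k) (σ k.succ)).prod else 0

lemma Rd_cof {n : ℕ} (Y : ℕ → L → Fin (n + 1) → A) (l : L) (r : Fin n → L) :
    Rd Y (Fin.cons l r : Fin (n + 1) → L) = ∑ i, Y 0 l i * Cof Y r i := by
  simp only [Rd, Cof, Finset.mul_sum]
  rw [Finset.sum_comm]
  refine Finset.sum_congr rfl fun σ _ => ?_
  rw [Finset.sum_eq_single (σ 0)]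
  · rw [if_pos rfl, mul_smul_comm, List.ofFn_succ]
    simp [-zsmul_eq_mul]
  · intro b _ hb; rw [if_neg (Ne.symm hb), mul_zero]
  · simp

end Alt

lemma ofFn_filtr {R T : Type*} [Semiring R] [AddCommMonoid T] [Module R T] (P : ℕ → T → Prop) :
    ∀ {n : ℕ} (O : Fin n → Module.End R T)
    (_ : ∀ (k : Fin n) (x : T), P (n - 1 - k) x → P (n - k) (O k x)) (x : T), P 0 x →
    P n ((List.ofFn O).prod x)
  | 0, O, _, x, hx => by simpa using hx
  | n + 1, O, h, x, hx => by
    rw [List.ofFn_succ, List.prod_cons, Module.End.mul_apply]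
    have := ofFn_filtr P (fun i : Fin n => O i.succ) (fun k y hy => by
      have := h k.succ y (by
        have e : n + 1 - 1 - (k.succ : Fin (n+1)).val = n - 1 - k.val := by simp; omega
        rw [e]; exact hy)
      have e : n + 1 - (k.succ : Fin (n+1)).val = n - k.val := by simp
      rw [e] at this; exact this) x hx
    simpa using h 0 _ (by simpa using this)

end GaudinModel

set_option linter.all false
set_option linter.unusedSectionVars false
set_option linter.unusedSimpArgs false
namespace GaudinModel
open Polynomial

/-! ### The polynomial model of the Gaudin operators -/

section Ops
variable {S : Type*} [Fintype S] [DecidableEq S] {N : ℕ}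

/-- `e_{ab}` acting at the site `s`. -/
def ee {R : Type*} [AddCommGroup R] [Module ℂ R] (s : S) (a b : Fin N) :
    Module.End ℂ ((S → Fin N) → R) where
  toFun y σ := if σ s = a then y (Function.update σ s b) else 0
  map_add' x y := by funext σ; dsimp; split_ifs <;> simp
  map_smul' c x := by funext σ; dsimp; split_ifs <;> simp

lemma ee_apply {R : Type*} [AddCommGroup R] [Module ℂ R] (s : S) (a b : Fin N)
    (y : (S → Fin N) → R) (σ : S → Fin N) :
    ee s a b y σ = if σ s = a then y (Function.update σ s b) else 0 := rfl

lemma ee_mul_same {R : Type*} [AddCommGroup R] [Module ℂ R] (s : S) (a b c d : Fin N) :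
    ee (R := R) s a b * ee s c d = if b = c then ee s a d else 0 := by
  refine LinearMap.ext fun y => funext fun σ => ?_
  simp only [Module.End.mul_apply, ee_apply]
  by_cases h : b = c <;> simp [h, ee_apply]

lemma ee_comm {R : Type*} [AddCommGroup R] [Module ℂ R] {s r : S} (h : s ≠ r)
    (a b c d : Fin N) :
    ee (R := R) s a b * ee r c d = ee r c d * ee s a b := by
  refine LinearMap.ext fun y => funext fun σ => ?_
  simp only [Module.End.mul_apply, ee_apply]
  rw [Function.update_of_ne h.symm, Function.update_of_ne h, Function.update_comm h]
  split_ifs <;> rfl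

/-- Multiplication by a polynomial. -/
def mulOp (p : ℂ[X]) : Module.End ℂ ((S → Fin N) → ℂ[X]) where
  toFun y σ := p * y σ
  map_add' x y := by funext σ; simp [mul_add]
  map_smul' c x := by funext σ; simp

lemma mulOp_apply (p : ℂ[X]) (y : (S → Fin N) → ℂ[X]) (σ : S → Fin N) :
    mulOp p y σ = p * y σ := rfl

lemma mulOp_eq_smul (p : ℂ[X]) (y : (S → Fin N) → ℂ[X]) : mulOp p y = p • y := rfl

/-- `∑_s q_s e_{ab}^{(s)}`. -/
def Bop (q : S → ℂ[X]) (a b : Fin N) : Module.End ℂ ((S → Fin N) → ℂ[X]) :=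
  ∑ s, mulOp (q s) * ee s a b

lemma Bop_apply (q : S → ℂ[X]) (a b : Fin N) (y : (S → Fin N) → ℂ[X]) (σ : S → Fin N) :
    Bop q a b y σ = ∑ s, q s * ee s a b y σ := by
  simp [Bop, LinearMap.sum_apply, Finset.sum_apply, mulOp_apply]

lemma mulOp_ee (p : ℂ[X]) (s : S) (a b : Fin N) : mulOp p * ee s a b = ee s a b * mulOp p := by
  refine LinearMap.ext fun y => funext fun σ => ?_
  simp only [Module.End.mul_apply, ee_apply, mulOp_apply]
  split_ifs <;> simp

lemma mulOp_mul (p q : ℂ[X]) :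
    (mulOp p * mulOp q : Module.End ℂ ((S → Fin N) → ℂ[X])) = mulOp (p * q) := by
  refine LinearMap.ext fun y => funext fun σ => ?_
  simp only [Module.End.mul_apply, mulOp_apply, mul_assoc]

lemma Bop_comm (q : S → ℂ[X]) (a b c d : Fin N) :
    Bop q a b * Bop q c d - Bop q c d * Bop q a b =
      (if b = c then Bop (fun s => q s ^ 2) a d else 0)
        - (if d = a then Bop (fun s => q s ^ 2) c b else 0) := by
  have key : ∀ s r : S, (mulOp (q s) * ee s a b) * (mulOp (q r) * ee r c d) -
      (mulOp (q r) * ee r c d) * (mulOp (q s) * ee s a b) =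
      mulOp (q s * q r) * (ee s a b * ee r c d - ee r c d * ee s a b) := by
    intro s r
    rw [mul_sub]
    congr 1
    · rw [← mulOp_mul]; simp only [mul_assoc]; rw [← mul_assoc (ee s a b), ← mulOp_ee]
      simp only [mul_assoc]
    · rw [mul_comm (q s), ← mulOp_mul]; simp only [mul_assoc]
      rw [← mul_assoc (ee r c d), ← mulOp_ee]
      simp only [mul_assoc]
  have : Bop q a b * Bop q c d - Bop q c d * Bop q a b =
      ∑ s, ∑ r, mulOp (q s * q r) * (ee s a b * ee r c d - ee r c d * ee s a b) := by
    simp only [Bop, Finset.sum_mul, Finset.mul_sum]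
    conv_lhs =>
      congr
      · rfl
      · rw [Finset.sum_comm]
    simp only [← Finset.sum_sub_distrib]
    conv_lhs => rw [Finset.sum_comm]
    refine Finset.sum_congr rfl fun s _ => Finset.sum_congr rfl fun r _ => key s r
  rw [this]
  have : ∀ s, ∑ r, mulOp (q s * q r) * (ee s a b * ee r c d - ee r c d * ee s a b) =
      mulOp (q s ^ 2) * ((if b = c then ee s a d else 0) - (if d = a then ee s c b else 0)) := by
    intro s
    rw [Finset.sum_eq_single s]
    · rw [ee_mul_same, ee_mul_same, pow_two]
    · intro r _ hr
      rw [ee_comm hr.symm, sub_self, mul_zero]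
    · simp
  rw [Finset.sum_congr rfl fun s _ => this s]
  simp only [mul_sub, Finset.sum_sub_distrib]
  congr 1
  · split_ifs
    · rfl
    · simp
  · split_ifs
    · rfl
    · simp

variable (z : S → ℂ) (K : Fin N → ℂ)

def wz : ℂ[X] := ∏ s, (X - C (z s))
def ws (s : S) : ℂ[X] := ∏ r ∈ Finset.univ.erase s, (X - C (z r))

lemma wz_eq (s : S) : wz z = (X - C (z s)) * ws z s := by
  rw [wz, ws, Finset.mul_prod_erase _ (fun r => X - C (z r)) (Finset.mem_univ s)]

lemma ws_rel (s : S) : wz z * derivative (ws z s) - derivative (wz z) * ws z s = - ws z s ^ 2 := by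
  rw [wz_eq z s]
  simp
  ring

def nab (j : ℕ) (a : Fin N) : Module.End ℂ ((S → Fin N) → ℂ[X]) where
  toFun y σ := wz z * derivative (y σ) - C (K a) * wz z * y σ - (j : ℂ[X]) * derivative (wz z) * y σ
  map_add' x y := by funext σ; simp; ring
  map_smul' c x := by
    funext σ
    simp only [Pi.smul_apply, smul_eq_C_mul, RingHom.id_apply, derivative_mul, derivative_C]
    ring

lemma nab_apply (j : ℕ) (a : Fin N) (y : (S → Fin N) → ℂ[X]) (σ : S → Fin N) :
    nab z K j a y σ =
      wz z * derivative (y σ) - C (K a) * wz z * y σ - (j : ℂ[X]) * derivative (wz z) * y σ := rfl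

/-- The operator `X_{ab}`, normalised to act on polynomials: `w^{j+1} X_{ab} (g / w^j)`. -/
def Xop (j : ℕ) (a b : Fin N) : Module.End ℂ ((S → Fin N) → ℂ[X]) :=
  (if a = b then nab z K j a else 0) - Bop (ws z) b a

lemma nab_Bop (j : ℕ) (a c d : Fin N) :
    nab z K (j + 1) a * Bop (ws z) c d =
      Bop (ws z) c d * nab z K j a - Bop (fun s => ws z s ^ 2) c d := by
  refine LinearMap.ext fun y => funext fun σ => ?_
  simp only [Module.End.mul_apply, LinearMap.sub_apply, Pi.sub_apply, nab_apply, Bop_apply]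
  simp only [derivative_sum, Finset.mul_sum, ← Finset.sum_sub_distrib]
  refine Finset.sum_congr rfl fun s _ => ?_
  simp only [ee_apply]
  split_ifs
  · rw [nab_apply, derivative_mul]
    have := ws_rel z s
    push_cast
    linear_combination (y (Function.update σ s d)) * this
  · simp

lemma nab_nab (j : ℕ) (a c : Fin N) :
    nab (S := S) z K (j + 1) a * nab z K j c = nab z K (j + 1) c * nab z K j a := by
  refine LinearMap.ext fun y => funext fun σ => ?_
  simp only [Module.End.mul_apply, nab_apply]
  simp only [derivative_sub, derivative_mul, derivative_C]
  push_cast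
  ring

lemma nab_mulOp (j : ℕ) (a : Fin N) :
    nab (S := S) z K (j + 1) a * mulOp (wz z) = mulOp (wz z) * nab z K j a := by
  refine LinearMap.ext fun y => funext fun σ => ?_
  simp only [Module.End.mul_apply, nab_apply, mulOp_apply, derivative_mul]
  push_cast
  ring

lemma Bop_mulOp (q : S → ℂ[X]) (p : ℂ[X]) (a b : Fin N) :
    Bop q a b * mulOp p = mulOp p * Bop q a b := by
  simp only [Bop, Finset.sum_mul, Finset.mul_sum]
  refine Finset.sum_congr rfl fun s _ => ?_
  rw [mul_assoc, ← mulOp_ee, ← mul_assoc, ← mul_assoc, mulOp_mul, mulOp_mul, mul_comm]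

lemma Xop_mulOp (j : ℕ) (a b : Fin N) :
    Xop (S := S) z K (j + 1) a b * mulOp (wz z) = mulOp (wz z) * Xop z K j a b := by
  rw [Xop, Xop, sub_mul, mul_sub, Bop_mulOp]
  split_ifs
  · rw [nab_mulOp]
  · simp

lemma Xop_exch (j : ℕ) (a b c d : Fin N) :
    Xop (S := S) z K (j + 1) a b * Xop z K j c d + Xop z K (j + 1) c b * Xop z K j a d =
    Xop z K (j + 1) a d * Xop z K j c b + Xop z K (j + 1) c d * Xop z K j a b := by
  have key : ∀ a b c d : Fin N, Xop (S := S) z K (j + 1) a b * Xop z K j c d =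
      (if a = b ∧ c = d then nab z K (j + 1) a * nab z K j c else 0)
      - (if a = b then Bop (ws z) d c * nab z K j a else 0)
      + (if a = b then Bop (fun s => ws z s ^ 2) d c else 0)
      - (if c = d then Bop (ws z) b a * nab z K j c else 0) + Bop (ws z) b a * Bop (ws z) d c := by
    intro a b c d
    rw [Xop, Xop]
    by_cases ab : a = b <;> by_cases cd : c = d <;>
    simp only [ab, cd, if_true, if_false, and_true, and_false, true_and, false_and] <;> simp only [sub_mul, mul_sub, nab_Bop, zero_mul, mul_zero] <;> abel
  rw [key, key, key, key]
  have h1 := Bop_comm (ws z) b a d c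
  have h2 := Bop_comm (ws z) b c d a
  rw [sub_eq_iff_eq_add] at h1 h2
  have h3 := nab_nab (S := S) z K j a c
  have h4 : ∀ (p q : Prop) [Decidable p] [Decidable q] (Q : Module.End ℂ ((S → Fin N) → ℂ[X])),
      (if p ∧ q then Q else 0) = if q ∧ p then Q else 0 :=
    fun p q _ _ Q => if_congr and_comm rfl rfl
  rw [h1, h2, h3, h4 (a = d), h4 (c = d)]
  abel

end Ops
end GaudinModel

set_option linter.all false
set_option linter.unusedSectionVars false
set_option linter.unusedSimpArgs false
namespace GaudinModel
open Polynomial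

section Poles
variable {S : Type*} [Fintype S] [DecidableEq S] {N : ℕ} (z : S → ℂ) (K : Fin N → ℂ)

/-- Rows: either a row of the matrix `X`, or a scalar row. -/
def Yop (k : ℕ) (l : Fin N ⊕ Fin N) (b : Fin N) : Module.End ℂ ((S → Fin N) → ℂ[X]) :=
  Sum.elim (fun a => Xop z K (N - 1 - k) a b) (fun i => if i = b then mulOp (wz z) else 0) l

lemma Yop_inl (k : ℕ) (a b : Fin N) :
    Yop (S := S) z K k (Sum.inl a) b = Xop z K (N - 1 - k) a b := rfl
lemma Yop_inr (k : ℕ) (i b : Fin N) :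
    Yop (S := S) z K k (Sum.inr i) b = if i = b then mulOp (wz z) else 0 := rfl

lemma Yop_exch : Exch N (Yop (S := S) z K) := by
  intro k ρ ρ' b d hk
  obtain ⟨j, hj, hj'⟩ : ∃ j, N - 1 - (k + 1) = j ∧ N - 1 - k = j + 1 := ⟨_, rfl, by omega⟩
  rcases ρ with a | i <;> rcases ρ' with c | i' <;>
    simp only [Yop_inl, Yop_inr, hj, hj']
  · exact Xop_exch z K j a b c d
  · split_ifs <;> simp only [mul_zero, zero_mul, Xop_mulOp] <;> abel
  · split_ifs <;> simp only [mul_zero, zero_mul, Xop_mulOp] <;> abel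
  · split_ifs <;> simp

/-- The universal operator, multiplied by `w^N`. -/
def Dhat : Module.End ℂ ((S → Fin N) → ℂ[X]) := Rd (Yop z K) Sum.inl

def Col (s : S) (c : Fin N) (j : ℕ) (g : (S → Fin N) → ℂ[X]) : Prop :=
  (∀ σ, σ s ≠ c → g σ = 0) ∧ ∀ σ, (X - C (z s)) ^ j ∣ g σ

lemma dvd_nab_core (t ω g : ℂ[X]) (ht : derivative t = 1) (j : ℕ) (h : t ^ j ∣ g) :
    t ^ (j + 1) ∣ t * ω * derivative g - (j : ℂ[X]) * derivative (t * ω) * g := by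
  obtain ⟨q, rfl⟩ := h
  refine ⟨ω * derivative q - j * derivative ω * q, ?_⟩
  cases j with
  | zero => simp; ring
  | succ i =>
    simp only [derivative_mul, derivative_pow, ht]
    simp
    ring

lemma dvd_nab_core' (t ω g : ℂ[X]) (ht : derivative t = 1) (i j : ℕ) (h : t ^ i ∣ g) :
    t ^ i ∣ t * ω * derivative g - (j : ℂ[X]) * derivative (t * ω) * g := by
  obtain ⟨q, rfl⟩ := h
  refine ⟨i * ω * q + t * ω * derivative q - j * derivative (t * ω) * q, ?_⟩
  cases i with
  | zero => simp
  | succ i =>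
    simp only [derivative_mul, derivative_pow, ht]
    simp
    ring

lemma dvd_wz (s : S) : (X - C (z s)) ∣ wz z := ⟨_, wz_eq z s⟩

lemma dvd_ws {s r : S} (h : r ≠ s) : (X - C (z s)) ∣ ws z r :=
  Finset.dvd_prod_of_mem (fun r => X - C (z r)) (by simp [h.symm])

lemma Col_nab (s : S) (c a : Fin N) (j : ℕ) (g : (S → Fin N) → ℂ[X]) (h : Col z s c j g) :
    Col z s c (j + 1) (nab z K j a g) := by
  refine ⟨fun σ hσ => by simp [nab_apply, h.1 σ hσ], fun σ => ?_⟩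
  rw [nab_apply]
  have h1 := dvd_nab_core (X - C (z s)) (ws z s) (g σ) (by simp) j (h.2 σ)
  rw [← wz_eq] at h1
  have h2 : (X - C (z s)) ^ (j + 1) ∣ C (K a) * wz z * g σ := by
    rw [pow_succ']
    exact mul_dvd_mul ((dvd_wz z s).mul_left _) (h.2 σ)
  convert h1.sub h2 using 1
  ring

lemma Col_Xop (s : S) (c a b : Fin N) (hac : a ≠ c) (j : ℕ) (g : (S → Fin N) → ℂ[X])
    (h : Col z s c j g) : Col z s c (j + 1) (Xop z K j a b g) := by
  have hB : Col z s c (j + 1) (Bop (ws z) b a g) := by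
    constructor
    · intro σ hσ
      rw [Bop_apply]
      refine Finset.sum_eq_zero fun r _ => ?_
      rw [ee_apply]
      split_ifs with hr
      · rw [h.1, mul_zero]
        rcases eq_or_ne r s with rfl | hrs
        · simpa using hac
        · rwa [Function.update_of_ne hrs.symm]
      · simp
    · intro σ
      rw [Bop_apply]
      refine Finset.dvd_sum fun r _ => ?_
      rw [ee_apply]
      split_ifs with hr
      · rcases eq_or_ne r s with rfl | hrs
        · rw [h.1 _ (by simpa using hac)]; simp
        · rw [pow_succ']
          exact mul_dvd_mul (dvd_ws z hrs) (h.2 _)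
      · simp
  have hn := Col_nab z K s c a j g h
  rw [Xop]
  split_ifs
  · exact ⟨fun σ hσ => by simp [hn.1 σ hσ, hB.1 σ hσ], fun σ => by
      simpa using (hn.2 σ).sub (hB.2 σ)⟩
  · exact ⟨fun σ hσ => by simp [hB.1 σ hσ], fun σ => by
      simpa using (hB.2 σ)⟩

lemma Col_Yop (s : S) (c b : Fin N) (l : Fin N ⊕ Fin N) (hl : l ≠ Sum.inl c) (k : ℕ)
    (g : (S → Fin N) → ℂ[X])
    (h : Col z s c (N - 1 - k) g) : Col z s c (N - 1 - k + 1) (Yop z K k l b g) := by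
  rcases l with a | i
  · exact Col_Xop z K s c a b (by simpa using hl) _ g h
  · rw [Yop_inr]
    split_ifs
    · refine ⟨fun σ hσ => by simp [mulOp_apply, h.1 σ hσ], fun σ => ?_⟩
      rw [mulOp_apply, pow_succ']
      exact mul_dvd_mul (dvd_wz z s) (h.2 _)
    · exact ⟨fun σ hσ => by simp, fun σ => by simp⟩

lemma Yop_dvd (s : S) (b : Fin N) (l : Fin N ⊕ Fin N) (k i : ℕ) (g : (S → Fin N) → ℂ[X])
    (h : ∀ σ, (X - C (z s)) ^ i ∣ g σ) (σ) : (X - C (z s)) ^ i ∣ Yop z K k l b g σ := by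
  rcases l with a | i'
  · have hB : (X - C (z s)) ^ i ∣ Bop (ws z) b a g σ := by
      rw [Bop_apply]
      refine Finset.dvd_sum fun r _ => ?_
      rw [ee_apply]
      split_ifs
      · exact (h _).mul_left _
      · simp
    rw [Yop_inl, Xop, LinearMap.sub_apply, Pi.sub_apply]
    refine dvd_sub ?_ hB
    split_ifs
    · rw [nab_apply]
      have h1 := dvd_nab_core' (X - C (z s)) (ws z s) (g σ) (by simp) i (N - 1 - k) (h σ)
      rw [← wz_eq] at h1
      have h2 : (X - C (z s)) ^ i ∣ C (K a) * wz z * g σ := (h σ).mul_left _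
      convert h1.sub h2 using 1
      ring
    · simp
  · rw [Yop_inr]
    split_ifs
    · exact (h σ).mul_left _
    · simp

lemma Rd_apply {L : Type*} (Y : ℕ → L → Fin N → Module.End ℂ ((S → Fin N) → ℂ[X]))
    (r : Fin N → L) (f : (S → Fin N) → ℂ[X]) (σ : S → Fin N) :
    Rd Y r f σ = ∑ π : Equiv.Perm (Fin N), ((Equiv.Perm.sign π : ℤˣ) : ℤ) •
    ((List.ofFn fun k : Fin N => Y k (r k) (π k)).prod f σ) := by
  simp [Rd, LinearMap.sum_apply, Finset.sum_apply]

lemma pole_color {n : ℕ} (K : Fin (n + 1) → ℂ) (s : S) (c : Fin (n + 1))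
    (r : Fin (n + 1) → Fin (n + 1) ⊕ Fin (n + 1)) (hr : ∀ k, k ≠ 0 → r k ≠ Sum.inl c)
    (f : (S → Fin (n + 1)) → ℂ[X]) (hf : ∀ σ, σ s ≠ c → f σ = 0) (σ) :
    (X - C (z s)) ^ n ∣ Rd (Yop z K) r f σ := by
  rw [Rd_apply]
  refine Finset.dvd_sum fun π _ => ?_
  rw [zsmul_eq_mul]; refine Dvd.dvd.mul_left ?_ _
  have := ofFn_filtr (R := ℂ) (fun j x => (j ≤ n → Col z s c j x) ∧
    (∀ σ, (X - C (z s)) ^ (min j n) ∣ x σ))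
    (fun k : Fin (n + 1) => Yop z K k (r k) (π k)) ?_ f ⟨fun _ => ⟨hf, by simp⟩, by simp⟩
  · simpa using this.2 σ
  · intro k x hx
    rcases eq_or_ne k 0 with rfl | hk
    · refine ⟨fun h => absurd h (by simp), ?_⟩
      have h2 := hx.2
      simp only [Fin.val_zero, Nat.sub_zero, Nat.add_sub_cancel, min_self] at h2
      have := Yop_dvd z K s (π 0) (r 0) 0 n x h2
      simpa using this
    · have h1 := hx.1 (by omega)
      have hk' : k.val ≠ 0 := fun h => hk (Fin.ext h)
      have h2 := Col_Yop z K s c (π k) (r k) (hr k hk) k x h1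
      have e : n + 1 - 1 - k.val + 1 = n + 1 - k.val := by omega
      rw [e] at h2
      refine ⟨fun _ => h2, fun σ => ?_⟩
      rw [min_eq_left (by omega)]
      exact h2.2 σ

lemma pole {n : ℕ} (K : Fin (n + 1) → ℂ) (s : S)
    (r : Fin (n + 1) → Fin (n + 1) ⊕ Fin (n + 1)) (hr : Function.Injective r)
    (f : (S → Fin (n + 1)) → ℂ[X]) (σ) :
    (X - C (z s)) ^ n ∣ Rd (Yop z K) r f σ := by
  have hdec : f = ∑ c : Fin (n + 1), fun σ => if σ s = c then f σ else 0 := by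
    funext σ
    simp [Finset.sum_apply]
  rw [hdec, map_sum, Finset.sum_apply]
  refine Finset.dvd_sum fun c _ => ?_
  set g : (S → Fin (n + 1)) → ℂ[X] := fun σ => if σ s = c then f σ else 0 with hg
  have hg0 : ∀ σ, σ s ≠ c → g σ = 0 := fun σ h => by simp [hg, h]
  by_cases hp : ∃ p, r p = Sum.inl c
  · obtain ⟨p, hp⟩ := hp
    have h1 : Rd (Yop (S := S) z K) r = ((Equiv.Perm.sign (Equiv.swap 0 p) : ℤˣ) : ℤ) •
        Rd (Yop z K) (r ∘ Equiv.swap 0 p) := by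
      rw [← Rd_perm (Yop_exch z K)]
      congr 1
      funext k
      simp
    rw [h1, LinearMap.smul_apply, Pi.smul_apply]
    rw [zsmul_eq_mul]; refine Dvd.dvd.mul_left ?_ _
    refine pole_color z K s c _ ?_ g hg0 σ
    intro k hk h
    have : Equiv.swap 0 p k = p := hr (by simpa [hp] using h)
    rw [Equiv.swap_apply_eq_iff] at this
    simp at this
    exact hk this
  · push Not at hp
    exact pole_color z K s c _ (fun k _ => hp k) g hg0 σ

lemma wz_pow_dvd (hz : Function.Injective z) (n : ℕ) (p : ℂ[X])
    (h : ∀ s, (X - C (z s)) ^ n ∣ p) : wz z ^ n ∣ p := by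
  rw [wz, ← Finset.prod_pow]
  refine Finset.prod_dvd_of_coprime ?_ fun s _ => h s
  intro s _ r _ hsr
  exact (pairwise_coprime_X_sub_C hz hsr).pow

lemma wz_ne_zero : wz z ≠ 0 := by
  rw [wz, Finset.prod_ne_zero_iff]
  intro s _
  exact X_sub_C_ne_zero _

end Poles
end GaudinModel

set_option linter.all false
set_option linter.unusedSectionVars false
set_option linter.unusedSimpArgs false
namespace GaudinModel
open Polynomial

section Local
variable {S : Type*} [Fintype S] [DecidableEq S] {N : ℕ} (z : S → ℂ) (K : Fin N → ℂ)

lemma Xop_mulOp_pow (m j : ℕ) (a b : Fin N) (g : (S → Fin N) → ℂ[X]) :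
    Xop z K (j + m) a b (wz z ^ m • g) = wz z ^ m • Xop z K j a b g := by
  induction m generalizing g with
  | zero => simp
  | succ m ih =>
    have := LinearMap.congr_fun (Xop_mulOp z K (j + m) a b) (wz z ^ m • g)
    simp only [Module.End.mul_apply, mulOp_eq_smul] at this
    rw [ih, smul_smul, smul_smul, ← pow_succ'] at this
    exact this

lemma exists_chi {m : ℕ} (K : Fin (m + 2) → ℂ) (hz : Function.Injective z)
    (f y : (S → Fin (m + 2)) → ℂ[X]) (hy : Dhat z K f = wz z ^ (m + 1) • y) (a : Fin (m + 2)) :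
    ∃ χ : Fin (m + 2) → (S → Fin (m + 2)) → ℂ[X], ∀ j,
      ∑ i, Xop z K 1 j i (χ i) = if j = a then wz z • y else 0 := by
  set r : Fin (m + 1) → Fin (m + 2) ⊕ Fin (m + 2) :=
    fun k => Sum.inl (Equiv.swap 0 a k.succ) with hr
  have hC : ∀ i σ, wz z ^ m ∣ Cof (Yop z K) r i f σ := by
    intro i σ
    have h1 := Rd_cof (Yop (S := S) z K) (Sum.inr i) r
    rw [Finset.sum_eq_single i (by intro b _ hb; rw [Yop_inr, if_neg hb.symm, zero_mul]) (by simp),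
      Yop_inr, if_pos rfl] at h1
    have h2 : wz z ^ (m + 1) ∣ Rd (Yop z K) (Fin.cons (Sum.inr i) r : Fin (m + 2) → _) f σ := by
      refine wz_pow_dvd z hz _ _ fun s => pole z K s _ ?_ f σ
      rw [Fin.cons_injective_iff]
      refine ⟨by simp [hr], ?_⟩
      intro k k' h
      simpa [hr] using h
    rw [h1, Module.End.mul_apply, mulOp_apply, pow_succ'] at h2
    exact (mul_dvd_mul_iff_left (wz_ne_zero z)).1 h2
  choose χ hχ using hC
  have hχ' : ∀ i, Cof (Yop z K) r i f = wz z ^ m • χ i := fun i => funext fun σ => hχ i σ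
  have hrow : ∀ j, wz z ^ m • ∑ i, Xop z K 1 j i (χ i) =
      Rd (Yop z K) (Fin.cons (Sum.inl j) r : Fin (m + 2) → _) f := by
    intro j
    rw [Rd_cof, LinearMap.sum_apply, Finset.smul_sum]
    refine Finset.sum_congr rfl fun i _ => ?_
    have e : m + 2 - 1 - 0 = 1 + m := by omega
    rw [Module.End.mul_apply, hχ', Yop_inl, e, Xop_mulOp_pow]
  set ε : ℤ := ((Equiv.Perm.sign (Equiv.swap 0 a) : ℤˣ) : ℤ) with hε
  have hε2 : ε * ε = 1 := by rw [hε, ← Units.val_mul, Int.units_mul_self]; simp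
  refine ⟨fun i => ε • χ i, fun j => ?_⟩
  have hcancel : ∀ u v : (S → Fin (m + 2)) → ℂ[X], wz z ^ m • u = wz z ^ m • v → u = v := by
    intro u v h
    funext σ
    exact mul_left_cancel₀ (pow_ne_zero m (wz_ne_zero z)) (congrFun h σ)
  simp only [map_zsmul, ← Finset.smul_sum]
  apply hcancel
  rw [smul_comm, hrow]
  split_ifs with hj
  · subst hj
    have : (Fin.cons (Sum.inl j) r : Fin (m + 2) → Fin (m + 2) ⊕ Fin (m + 2)) =
        Sum.inl ∘ Equiv.swap 0 j := by
      funext k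
      refine Fin.cases ?_ (fun k => ?_) k
      · simp
      · simp [hr]
    rw [this, Rd_perm (Yop_exch z K), LinearMap.smul_apply, smul_smul, hε2, one_smul, ← Dhat, hy,
      smul_smul, pow_succ]
  · set q := Equiv.swap 0 a j with hq
    have hq0 : q ≠ 0 := by
      intro h
      rw [hq, Equiv.swap_apply_eq_iff] at h
      simp at h; exact hj h
    obtain ⟨k, hk⟩ := Fin.exists_succ_eq.2 hq0
    have := Rd_rep (Yop_exch (S := S) z K)
      (Fin.cons (Sum.inl j) r : Fin (m + 2) → Fin (m + 2) ⊕ Fin (m + 2))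
      (p := 0) (q := k.succ) (Fin.succ_ne_zero k).symm
      (by show Sum.inl j = Sum.inl (Equiv.swap 0 a k.succ); rw [hk, hq]; simp)
    rw [this]; simp

/-- Abstract Taylor expansion at a simple zero of `t`. -/
lemma taylor_three (e : ℂ) (t ω p q B Y : ℂ[X]) (ht : derivative t = 1) (ht0 : t.eval e = 0)
    (hY : Y.eval e = 0)
    (h : ω * (t * derivative p - p - q) - t * B = t * ω * Y) (hω : ω.eval e ≠ 0) :
    q.eval e = - p.eval e ∧ ω.eval e * (derivative q).eval e = - B.eval e ∧
    (derivative ω).eval e * (derivative q).eval e + (derivative B).eval e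
      + ω.eval e * (derivative Y).eval e =
      (ω.eval e / 2) * ((derivative (derivative p)).eval e - (derivative (derivative q)).eval e) := by
  have h0 := congrArg (eval e) h
  have h1 := congrArg (eval e) (congrArg derivative h)
  have h2 := congrArg (eval e) (congrArg derivative (congrArg derivative h))
  simp only [derivative_mul, derivative_sub, derivative_add, ht, derivative_one, eval_mul,
    eval_sub, eval_add, eval_one, ht0, hY, eval_zero] at h0 h1 h2
  have a0 : q.eval e = - p.eval e := by
    have : ω.eval e * (q.eval e + p.eval e) = 0 := by linear_combination -h0
    have := (mul_eq_zero.1 this).resolve_left hω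
    linear_combination this
  rw [a0] at h1 h2
  refine ⟨a0, by linear_combination -h1, by linear_combination (-1/2) * h2⟩

def PP (r : S) : Module.End ℂ (Fin N → (S → Fin N) → ℂ) where
  toFun χ j σ := χ (σ r) (Function.update σ r j)
  map_add' x y := rfl
  map_smul' c x := rfl

def KK : Module.End ℂ (Fin N → (S → Fin N) → ℂ) where
  toFun χ j σ := K j * χ j σ
  map_add' x y := by funext j σ; simp [mul_add]
  map_smul' c x := by funext j σ; simp; ring

lemma PP_apply (r : S) (χ : Fin N → (S → Fin N) → ℂ) (j σ) :
    PP r χ j σ = χ (σ r) (Function.update σ r j) := rfl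
lemma KK_apply (χ : Fin N → (S → Fin N) → ℂ) (j σ) :
    KK (S := S) K χ j σ = K j * χ j σ := rfl

lemma PP_sq (r : S) : PP (N := N) r * PP r = 1 := by
  refine LinearMap.ext fun χ => funext fun j => funext fun σ => ?_
  simp [Module.End.mul_apply, PP_apply]

lemma PP_braid {r s : S} (h : r ≠ s) : PP (N := N) r * PP s * PP r = PP s * PP r * PP s := by
  refine LinearMap.ext fun χ => funext fun j => funext fun σ => ?_
  simp only [Module.End.mul_apply, PP_apply, Function.update_self, Function.update_of_ne h,
    Function.update_of_ne h.symm]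
  congr 1
  funext k
  by_cases h1 : k = r <;> by_cases h2 : k = s
  · subst h1; exact absurd h2 h
  · subst h1; simp [h, h.symm]
  · subst h2; simp [h, h.symm]
  · simp [h1, h2]

lemma PP_conj (s r r' : S) (hr : r ≠ s) (hr' : r' ≠ s) (h : r ≠ r') :
    PP (N := N) r * (PP s * PP r' * PP s) = (PP s * PP r' * PP s) * PP r := by
  refine LinearMap.ext fun χ => funext fun j => funext fun σ => ?_
  simp only [Module.End.mul_apply, PP_apply, Function.update_self, Function.update_of_ne h,
    Function.update_of_ne h.symm, Function.update_of_ne hr, Function.update_of_ne hr.symm,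
    Function.update_of_ne hr', Function.update_of_ne hr'.symm]
  congr 1
  funext k
  by_cases h1 : k = r
  · subst h1; simp [h, h.symm, hr, hr.symm, hr', hr'.symm]
  by_cases h2 : k = r'
  · subst h2; simp [h, h.symm, hr, hr.symm, hr', hr'.symm]
  by_cases h3 : k = s
  · subst h3; simp [h, h.symm, hr, hr.symm, hr', hr'.symm]
  simp [h1, h2, h3]

lemma KK_conj (s : S) : KK (S := S) K * (PP s * KK K * PP s) = (PP s * KK K * PP s) * KK K := by
  refine LinearMap.ext fun χ => funext fun j => funext fun σ => ?_
  simp only [Module.End.mul_apply, PP_apply, KK_apply, Function.update_self]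
  ring

lemma KK_PP_conj (s r : S) (h : r ≠ s) :
    KK (S := S) K * (PP s * PP r * PP s) = (PP s * PP r * PP s) * KK K := by
  refine LinearMap.ext fun χ => funext fun j => funext fun σ => ?_
  simp only [Module.End.mul_apply, PP_apply, KK_apply, Function.update_self,
    Function.update_of_ne h, Function.update_of_ne h.symm]

lemma PP_KK_conj (s r : S) (h : r ≠ s) :
    PP r * (PP s * KK (S := S) K * PP s) = (PP s * KK K * PP s) * PP r := by
  refine LinearMap.ext fun χ => funext fun j => funext fun σ => ?_
  simp only [Module.End.mul_apply, PP_apply, KK_apply, Function.update_self,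
    Function.update_of_ne h, Function.update_of_ne h.symm]
  congr 2
  funext k
  by_cases h1 : k = r <;> by_cases h2 : k = s
  · subst h1; exact absurd h2 h
  · subst h1; simp [h, h.symm]
  · subst h2; simp [h, h.symm]
  · simp [h1, h2]

/-- The key vanishing statement. -/
lemma local_key (s : S) (ρ : S → ℂ) (χ : Fin N → (S → Fin N) → ℂ) (hχ : PP s χ = - χ) :
    let b : Module.End ℂ (Fin N → (S → Fin N) → ℂ) :=
      KK K + ∑ r ∈ Finset.univ.erase s, ρ r • (1 + PP r)
    (1 + PP s) ((∑ r ∈ Finset.univ.erase s, ρ r ^ 2 • (1 + PP r)) χ + b (PP s (b χ))) = 0 := by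
  intro b
  obtain ⟨A, hA⟩ : ∃ A : Module.End ℂ (Fin N → (S → Fin N) → ℂ), A =
      KK K + (∑ r ∈ Finset.univ.erase s, ρ r) • 1 := ⟨_, rfl⟩
  have hb : b = A + ∑ r ∈ Finset.univ.erase s, ρ r • PP r := by
    simp only [b, hA, smul_add, Finset.sum_add_distrib, Finset.sum_smul, add_assoc]
  have hsq := PP_sq (N := N) s
  have hmem : ∀ r ∈ Finset.univ.erase s, r ≠ s := fun r hr => (Finset.mem_erase.1 hr).1
  -- conjugates
  have hA1 : A * (PP s * A * PP s) = (PP s * A * PP s) * A := by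
    simp only [hA, mul_add, add_mul, mul_smul_comm, smul_mul_assoc, mul_one, one_mul, hsq, smul_smul, smul_add]
    rw [KK_conj]
    abel
  have hA2 : ∀ r ∈ Finset.univ.erase s, A * (PP s * PP r * PP s) = (PP s * PP r * PP s) * A := by
    intro r hr
    simp only [hA, mul_add, add_mul, mul_smul_comm, smul_mul_assoc, mul_one, one_mul]
    rw [KK_PP_conj K s r (hmem r hr)]
  have hA3 : ∀ r ∈ Finset.univ.erase s, PP r * (PP s * A * PP s) = (PP s * A * PP s) * PP r := by
    intro r hr
    simp only [hA, mul_add, add_mul, mul_smul_comm, smul_mul_assoc, mul_one, one_mul, hsq]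
    rw [PP_KK_conj K s r (hmem r hr)]
  have hcomm : b * (PP s * b * PP s) - (PP s * b * PP s) * b =
      ∑ r ∈ Finset.univ.erase s, ρ r ^ 2 • (PP s * PP r - PP r * PP s) := by
    have e1 : PP s * b * PP s = PP s * A * PP s +
        ∑ r ∈ Finset.univ.erase s, ρ r • (PP s * PP r * PP s) := by
      rw [hb, mul_add, add_mul, Finset.mul_sum, Finset.sum_mul]
      simp only [mul_smul_comm, smul_mul_assoc]
    have e2 : A * (∑ r ∈ Finset.univ.erase s, ρ r • (PP s * PP r * PP s)) =
        (∑ r ∈ Finset.univ.erase s, ρ r • (PP s * PP r * PP s)) * A := by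
      rw [Finset.mul_sum, Finset.sum_mul]
      refine Finset.sum_congr rfl fun r hr => ?_
      rw [mul_smul_comm, smul_mul_assoc, hA2 r hr]
    have e3 : (∑ r ∈ Finset.univ.erase s, ρ r • PP r) * (PP s * A * PP s) =
        (PP s * A * PP s) * (∑ r ∈ Finset.univ.erase s, ρ r • PP r) := by
      rw [Finset.mul_sum, Finset.sum_mul]
      refine Finset.sum_congr rfl fun r hr => ?_
      rw [mul_smul_comm, smul_mul_assoc, hA3 r hr]
    rw [e1, hb, mul_add, add_mul, add_mul, add_mul, mul_add, mul_add, hA1, e2, e3]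
    have e4 : ∀ a b c d e : Module.End ℂ (Fin N → (S → Fin N) → ℂ),
        a + b + (c + d) - (a + b + (c + e)) = d - e := by intros; abel
    rw [e4]
    simp only [Finset.sum_mul, Finset.mul_sum]
    conv_lhs =>
      congr
      · rw [Finset.sum_comm]
      · rfl
    simp only [← Finset.sum_sub_distrib]
    refine Finset.sum_congr rfl fun r hr => ?_
    rw [Finset.sum_eq_single r]
    · have hbr := PP_braid (N := N) (hmem r hr)
      have hr2 := PP_sq (N := N) r
      have f1 : PP r * (PP s * PP r * PP s) = PP (N := N) s * PP r := by
        rw [← hbr, ← mul_assoc, ← mul_assoc, hr2, one_mul]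
      have f2 : (PP s * PP r * PP s) * PP r = PP (N := N) r * PP s := by
        rw [← hbr, mul_assoc, hr2, mul_one]
      simp only [smul_mul_assoc, mul_smul_comm, f1, f2, smul_smul, smul_sub, pow_two]
    · intro r' hr' hne
      have := PP_conj (N := N) s r r' (hmem r hr) (hmem r' hr') hne.symm
      have h2 := PP_conj (N := N) s r' r (hmem r' hr') (hmem r hr) hne
      simp only [smul_mul_assoc, mul_smul_comm, smul_smul, this, h2, mul_comm (ρ r)]
      simp [mul_comm (ρ r)]
    · intro h; exact absurd hr h
  have h1 := LinearMap.congr_fun hcomm χ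
  have hPb : PP s (b χ) = - (PP (N := N) s * b * PP (N := N) s : Module.End ℂ (Fin N → (S → Fin N) → ℂ)) χ := by
    simp only [Module.End.mul_apply, hχ, map_neg, neg_neg]
  have hss : ∀ x : Fin N → (S → Fin N) → ℂ, PP s (PP s x) = x := fun x =>
    LinearMap.congr_fun hsq x
  have h2 : PP s (b (PP s (b χ))) = (PP (N := N) s * b * PP (N := N) s : Module.End ℂ (Fin N → (S → Fin N) → ℂ)) (b χ) := by
    simp only [Module.End.mul_apply]
  rw [map_add, LinearMap.add_apply, LinearMap.add_apply, Module.End.one_apply,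
    Module.End.one_apply, h2, hPb, map_neg]
  simp only [LinearMap.sub_apply] at h1
  have h3 : (∑ r ∈ Finset.univ.erase s, ρ r ^ 2 • (1 + PP r)) χ +
      PP s ((∑ r ∈ Finset.univ.erase s, ρ r ^ 2 • (1 + PP r)) χ) =
      (∑ r ∈ Finset.univ.erase s, ρ r ^ 2 • (PP s * PP r - PP r * PP s) :
        Module.End ℂ (Fin N → (S → Fin N) → ℂ)) χ := by
    simp only [LinearMap.sum_apply, map_sum, ← Finset.sum_add_distrib]
    refine Finset.sum_congr rfl fun r hr => ?_
    simp only [LinearMap.smul_apply, map_smul, LinearMap.add_apply, Module.End.one_apply,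
      LinearMap.sub_apply, Module.End.mul_apply, map_add, hχ, map_neg, ← smul_add]
    congr 1
    abel
  rw [h3, ← h1]
  simp only [Module.End.mul_apply]
  abel

end Local
end GaudinModel

set_option linter.all false
set_option linter.unusedSectionVars false
set_option linter.unusedSimpArgs false
namespace GaudinModel
open Polynomial

section Local
variable {S : Type*} [Fintype S] [DecidableEq S] {N : ℕ} (z : S → ℂ) (K : Fin N → ℂ)

def wrs (s r : S) : ℂ[X] := ∏ q ∈ (Finset.univ.erase s).erase r, (X - C (z q))

lemma ws_eq_wrs {s r : S} (h : r ≠ s) : ws z s = (X - C (z r)) * wrs z s r := by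
  rw [ws, wrs, Finset.mul_prod_erase _ (fun r => X - C (z r)) (by simp [h])]

lemma ws_eq_wrs' {s r : S} (h : r ≠ s) : ws z r = (X - C (z s)) * wrs z s r := by
  rw [ws_eq_wrs z h.symm, wrs, wrs, Finset.erase_right_comm]

lemma derivative_ws (s : S) : derivative (ws z s) = ∑ r ∈ Finset.univ.erase s, wrs z s r := by
  rw [ws, derivative_prod_finset]
  refine Finset.sum_congr rfl fun r _ => ?_
  simp [wrs]

lemma derivative_wz : derivative (wz z) = ∑ s, ws z s := by
  rw [wz, derivative_prod_finset]
  refine Finset.sum_congr rfl fun r _ => ?_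
  simp [ws]

lemma ws_eval_ne (hz : Function.Injective z) (s : S) : (ws z s).eval (z s) ≠ 0 := by
  rw [ws, eval_prod, Finset.prod_ne_zero_iff]
  intro r hr
  simp only [eval_sub, eval_X, eval_C]
  rw [sub_ne_zero]
  intro h
  exact (Finset.mem_erase.1 hr).1 (hz h).symm

lemma sum_Xop (χ : Fin N → (S → Fin N) → ℂ[X]) (j : Fin N) (σ : S → Fin N) :
    (∑ i, Xop z K 1 j i (χ i)) σ = wz z * derivative (χ j σ) - C (K j) * wz z * χ j σ
      - derivative (wz z) * χ j σ - ∑ r, ws z r * χ (σ r) (Function.update σ r j) := by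
  rw [Finset.sum_apply]
  simp only [Xop, LinearMap.sub_apply, Pi.sub_apply, Finset.sum_sub_distrib]
  congr 1
  · rw [Finset.sum_eq_single j]
    · simp [nab_apply]
    · intro b _ hb; rw [if_neg hb.symm]; simp
    · simp
  · simp only [Bop_apply, ee_apply]
    rw [Finset.sum_comm]
    refine Finset.sum_congr rfl fun r _ => ?_
    rw [Finset.sum_eq_single (σ r)]
    · simp
    · intro b _ hb; rw [if_neg hb.symm, mul_zero]
    · simp

lemma local_A3 (hz : Function.Injective z) (y : (S → Fin N) → ℂ[X]) (s : S)
    (hy : ∀ σ, (y σ).eval (z s) = 0)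
    (hχ : ∀ a : Fin N, ∃ χ : Fin N → (S → Fin N) → ℂ[X], ∀ j,
      ∑ i, Xop z K 1 j i (χ i) = if j = a then wz z • y else 0) (σ : S → Fin N) :
    (derivative (y σ)).eval (z s) = 0 := by
  set e := z s with he
  set a := σ s with ha
  obtain ⟨χ, hχ⟩ := hχ a
  set ω := ws z s with hω
  have hω0 : ω.eval e ≠ 0 := ws_eval_ne z hz s
  set B : Fin N → (S → Fin N) → ℂ[X] := fun j σ => C (K j) * ω * χ j σ +
    ∑ r ∈ Finset.univ.erase s, wrs z s r * (χ j σ + χ (σ r) (Function.update σ r j)) with hB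
  set Y : Fin N → (S → Fin N) → ℂ[X] := fun j σ => if j = a then y σ else 0 with hY
  have hpoly : ∀ j σ, ω * ((X - C e) * derivative (χ j σ) - χ j σ
      - χ (σ s) (Function.update σ s j)) - (X - C e) * B j σ = (X - C e) * ω * Y j σ := by
    intro j σ
    have h := congrFun (hχ j) σ
    rw [sum_Xop] at h
    rw [← Finset.add_sum_erase _ _ (Finset.mem_univ s)] at h
    have h1 : ∑ r ∈ Finset.univ.erase s, ws z r * χ (σ r) (Function.update σ r j) =
        (X - C e) * ∑ r ∈ Finset.univ.erase s, wrs z s r * χ (σ r) (Function.update σ r j) := by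
      rw [Finset.mul_sum]
      refine Finset.sum_congr rfl fun r hr => ?_
      rw [ws_eq_wrs' z (Finset.mem_erase.1 hr).1, mul_assoc]
    have h2 : derivative (wz z) = ω + (X - C e) * ∑ r ∈ Finset.univ.erase s, wrs z s r := by
      rw [wz_eq z s, derivative_mul, derivative_ws, ← he]
      simp only [hω, derivative_sub, derivative_X, derivative_C, sub_zero, one_mul]
    have h3 : (if j = a then wz z • y else 0) σ = (X - C e) * ω * Y j σ := by
      rw [hY, hω, he, ← wz_eq]
      by_cases hja : j = a <;> simp [hja]
    rw [h1, h2, h3, wz_eq z s] at h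
    rw [← h, hB]
    simp only [mul_add, Finset.sum_add_distrib, ← Finset.sum_mul]
    ring
  have hT := fun j σ => taylor_three e (X - C e) ω (χ j σ) (χ (σ s) (Function.update σ s j))
    (B j σ) (Y j σ) (by simp) (by simp) (by simp only [hY]; split_ifs <;> simp [hy]) (hpoly j σ) hω0
  set ρ : S → ℂ := fun r => (e - z r)⁻¹ with hρ
  have hne : ∀ r ∈ Finset.univ.erase s, e - z r ≠ 0 := by
    intro r hr h
    exact (Finset.mem_erase.1 hr).1 (hz (sub_eq_zero.1 h)).symm
  have hw0 : ∀ r ∈ Finset.univ.erase s, (wrs z s r).eval e = ω.eval e * ρ r := by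
    intro r hr
    have := congrArg (eval e) (ws_eq_wrs z (Finset.mem_erase.1 hr).1)
    simp only [eval_mul, eval_sub, eval_X, eval_C] at this
    rw [hω, this, hρ]
    field_simp [hne r hr]
  have hw1 : ∀ r ∈ Finset.univ.erase s, (derivative (wrs z s r)).eval e =
      (derivative ω).eval e * ρ r - ω.eval e * ρ r ^ 2 := by
    intro r hr
    have := congrArg (eval e) (congrArg derivative (ws_eq_wrs z (Finset.mem_erase.1 hr).1))
    simp only [derivative_mul, derivative_sub, derivative_X, derivative_C, eval_mul, eval_add,
      eval_sub, eval_X, eval_C, eval_one, eval_zero] at this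
    rw [hω, this, hw0 r hr, hρ]
    have := hne r hr
    field_simp
    ring
  set χ0 : Fin N → (S → Fin N) → ℂ := fun j σ => (χ j σ).eval e with hχ0
  set χ1 : Fin N → (S → Fin N) → ℂ := fun j σ => (derivative (χ j σ)).eval e with hχ1
  set χ2 : Fin N → (S → Fin N) → ℂ := fun j σ => (derivative (derivative (χ j σ))).eval e with hχ2
  set Y1 : Fin N → (S → Fin N) → ℂ := fun j σ => (derivative (Y j σ)).eval e with hY1
  set b : Module.End ℂ (Fin N → (S → Fin N) → ℂ) :=
      KK K + ∑ r ∈ Finset.univ.erase s, ρ r • (1 + PP r) with hb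
  set Q : Module.End ℂ (Fin N → (S → Fin N) → ℂ) :=
      ∑ r ∈ Finset.univ.erase s, ρ r ^ 2 • (1 + PP r) with hQ
  have hbap : ∀ x j σ, b x j σ = K j * x j σ +
      ∑ r ∈ Finset.univ.erase s, ρ r * (x j σ + x (σ r) (Function.update σ r j)) := by
    intro x j σ
    simp only [hb, LinearMap.add_apply, LinearMap.sum_apply, Finset.sum_apply, Pi.add_apply,
      LinearMap.smul_apply, Pi.smul_apply, smul_eq_mul, Module.End.one_apply, KK_apply, PP_apply]
  have hQap : ∀ x j σ, Q x j σ =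
      ∑ r ∈ Finset.univ.erase s, ρ r ^ 2 * (x j σ + x (σ r) (Function.update σ r j)) := by
    intro x j σ
    simp only [hQ, LinearMap.add_apply, LinearMap.sum_apply, Finset.sum_apply, Pi.add_apply,
      LinearMap.smul_apply, Pi.smul_apply, smul_eq_mul, Module.End.one_apply, PP_apply]
  have hB0 : ∀ j σ, (B j σ).eval e = ω.eval e * b χ0 j σ := by
    intro j σ
    rw [hbap, hB]
    simp only [eval_add, eval_mul, eval_C, eval_finset_sum, hχ0, mul_add (ω.eval e), Finset.mul_sum]
    congr 1
    · ring
    · refine Finset.sum_congr rfl fun r hr => ?_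
      rw [hw0 r hr]; ring
  have hB1 : ∀ j σ, (derivative (B j σ)).eval e = (derivative ω).eval e * b χ0 j σ
      - ω.eval e * Q χ0 j σ + ω.eval e * b χ1 j σ := by
    intro j σ
    rw [hbap, hbap, hQap, hB]
    simp only [derivative_add, derivative_mul, derivative_C, derivative_sum,
      eval_add, eval_mul, eval_C, eval_finset_sum, hχ0, hχ1, mul_add (ω.eval e), 
      mul_add ((derivative ω).eval e), eval_zero]
    have : ∑ r ∈ Finset.univ.erase s, (eval e (derivative (wrs z s r)) *
        (eval e (χ j σ) + eval e (χ (σ r) (Function.update σ r j))) + eval e (wrs z s r) *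
        (eval e (derivative (χ j σ)) + eval e (derivative (χ (σ r) (Function.update σ r j))))) =
      ∑ r ∈ Finset.univ.erase s, (((derivative ω).eval e * ρ r - ω.eval e * ρ r ^ 2) *
        (eval e (χ j σ) + eval e (χ (σ r) (Function.update σ r j))) + (ω.eval e * ρ r) *
        (eval e (derivative (χ j σ)) + eval e (derivative (χ (σ r) (Function.update σ r j))))) :=
      Finset.sum_congr rfl fun r hr => by rw [hw0 r hr, hw1 r hr]
    rw [this]
    simp only [Finset.sum_add_distrib, Finset.mul_sum, sub_mul, Finset.sum_sub_distrib, add_mul, mul_add]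
    simp only [← mul_assoc]
    ring
  have h0 : PP s χ0 = - χ0 := by
    funext j σ
    exact (hT j σ).1
  have h1 : PP s χ1 = - b χ0 := by
    funext j σ
    have := (hT j σ).2.1
    rw [hB0] at this
    apply mul_left_cancel₀ hω0
    rw [PP_apply]
    simp only [Pi.neg_apply]
    linear_combination this
  have hss : ∀ x : Fin N → (S → Fin N) → ℂ, PP s (PP s x) = x := fun x =>
    LinearMap.congr_fun (PP_sq s) x
  have h1' : χ1 = - PP s (b χ0) := by
    rw [← hss χ1, h1, map_neg]
  have h2 : - Q χ0 + b χ1 + Y1 = (1 / 2 : ℂ) • (χ2 - PP s χ2) := by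
    funext j σ
    have := (hT j σ).2.2
    rw [hB1] at this
    have h3 := congrFun (congrFun h1 j) σ
    rw [PP_apply, hχ1] at h3
    simp only at h3
    rw [h3] at this
    apply mul_left_cancel₀ hω0
    simp only [Pi.neg_apply, Pi.add_apply, Pi.smul_apply, Pi.sub_apply, smul_eq_mul, PP_apply]  at this ⊢
    simp only [hχ2, hY1]
    linear_combination this
  have h3 := congrArg (1 + PP s : Module.End ℂ (Fin N → (S → Fin N) → ℂ)) h2
  have hk := local_key K s ρ χ0 h0
  simp only at hk
  rw [← hb, ← hQ] at hk
  rw [h1', map_neg] at h3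
  have h4 : -Q χ0 + -b (PP s (b χ0)) + Y1 = - (Q χ0 + b (PP s (b χ0))) + Y1 := by abel
  rw [h4, map_add, map_neg, hk, map_smul] at h3
  simp only [LinearMap.add_apply, Module.End.one_apply, map_sub, hss] at h3
  have h5 := congrFun (congrFun h3 a) σ
  simp only [Pi.add_apply, Pi.smul_apply, Pi.sub_apply, PP_apply, hY1, hY, ← ha, if_true,
    Pi.neg_apply, Pi.zero_apply, smul_eq_mul] at h5
  rw [ha, Function.update_eq_self] at h5
  linear_combination (1/2) * h5
 
/-- Main local statement. -/
lemma local_main {N : ℕ} (hN : 2 ≤ N) (K : Fin N → ℂ) (hz : Function.Injective z)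
    (f : (S → Fin N) → ℂ[X]) : ∃ y : (S → Fin N) → ℂ[X], Dhat z K f = wz z ^ (N - 1) • y ∧
      ((∀ s σ, (y σ).eval (z s) = 0) → ∀ σ, wz z ^ 2 ∣ y σ) := by
  obtain ⟨m, rfl⟩ : ∃ m, N = m + 2 := ⟨N - 2, by omega⟩
  have h1 : ∀ σ, wz z ^ (m + 1) ∣ Dhat z K f σ := fun σ =>
    wz_pow_dvd z hz _ _ fun s => pole z K s _ Sum.inl_injective f σ
  choose y hy using h1
  have hy' : Dhat z K f = wz z ^ (m + 1) • y := funext hy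
  refine ⟨y, hy', fun h0 σ => wz_pow_dvd z hz _ _ fun s => ?_⟩
  have h2 := local_A3 z K hz y s (h0 s) (exists_chi z K hz f y hy') σ
  obtain ⟨q, hq⟩ := dvd_iff_isRoot.2 (h0 s σ)
  rw [hq] at h2 ⊢
  simp at h2
  rw [pow_two]
  exact mul_dvd_mul_left _ (dvd_iff_isRoot.2 h2)

end Local
end GaudinModel

set_option linter.all false
set_option linter.unusedSectionVars false
set_option linter.unusedSimpArgs false
namespace GaudinModel
open Polynomial

section Count
variable {S : Type*} [Fintype S] [DecidableEq S] {N : ℕ}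

/-- Polynomial vectors supported on `C` of degree at most `d`, by coefficients. -/
def emb (C : Finset (S → Fin N)) (d : ℕ) :
    ({σ // σ ∈ C} → Fin (d + 1) → ℂ) →ₗ[ℂ] ((S → Fin N) → ℂ[X]) where
  toFun x σ := if h : σ ∈ C then ∑ i : Fin (d + 1), monomial (i : ℕ) (x ⟨σ, h⟩ i) else 0
  map_add' x y := by
    funext σ
    by_cases h : σ ∈ C <;> simp [h, Finset.sum_add_distrib]
  map_smul' c x := by
    funext σ
    by_cases h : σ ∈ C <;> simp [h, Finset.smul_sum, smul_monomial]

lemma emb_supp (C : Finset (S → Fin N)) (d : ℕ) (x) (σ) (h : σ ∉ C) : emb C d x σ = 0 := by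
  simp [emb, h]

lemma emb_coeff (C : Finset (S → Fin N)) (d : ℕ) (x) (σ) (h : σ ∈ C) (i : Fin (d + 1)) :
    (emb C d x σ).coeff i = x ⟨σ, h⟩ i := by
  simp only [emb, LinearMap.coe_mk, AddHom.coe_mk, h, dif_pos, finset_sum_coeff, coeff_monomial]
  simp [Fin.val_inj]

lemma emb_deg (C : Finset (S → Fin N)) (d : ℕ) (x) (σ) (i : ℕ) (hi : d < i) :
    (emb C d x σ).coeff i = 0 := by
  by_cases h : σ ∈ C
  · simp only [emb, LinearMap.coe_mk, AddHom.coe_mk, h, dif_pos, finset_sum_coeff, coeff_monomial]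
    refine Finset.sum_eq_zero fun j _ => if_neg ?_
    have := j.2
    omega
  · simp [emb_supp C d x σ h]

lemma emb_inj (C : Finset (S → Fin N)) (d : ℕ) : Function.Injective (emb C d) := by
  intro x y h
  funext σ i
  rw [← emb_coeff C d x σ σ.2 i, ← emb_coeff C d y σ σ.2 i, h]

lemma wz_monic (z : S → ℂ) : (wz z).Monic := monic_prod_of_monic _ _ fun s _ => monic_X_sub_C _

lemma wz_natDegree (z : S → ℂ) : (wz z).natDegree = Fintype.card S := by
  rw [wz, natDegree_prod_of_monic _ _ fun s _ => monic_X_sub_C _]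
  simp

lemma count_distinct (hN : 2 ≤ N) (K : Fin N → ℂ) (z : S → ℂ) (hz : Function.Injective z)
    (C : Finset (S → Fin N)) (r d : ℕ) (hd : r + Fintype.card S ≤ d)
    (hC : ∀ f : (S → Fin N) → ℂ[X], (∀ σ ∉ C, f σ = 0) → ∀ σ ∉ C, Dhat z K f σ = 0)
    (hdeg : ∀ (f : (S → Fin N) → ℂ[X]) (e : ℕ), (∀ σ i, e < i → (f σ).coeff i = 0) →
      ∀ σ i, e + N * Fintype.card S < i + r → (Dhat z K f σ).coeff i = 0) :
    r * C.card ≤ Module.finrank ℂ (LinearMap.ker (Dhat z K ∘ₗ emb C d)) := by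
  have hw := wz_ne_zero z
  choose y hy hy2 using fun f => local_main z hN K hz f
  set B := Fintype.card S with hB
  have hyu : ∀ f (g : (S → Fin N) → ℂ[X]), Dhat z K f = wz z ^ (N - 1) • g → g = y f := by
    intro f g hg
    rw [hy] at hg
    funext σ
    have := congrFun hg σ
    simp only [Pi.smul_apply, smul_eq_mul] at this
    exact (mul_left_cancel₀ (pow_ne_zero _ hw) this).symm
  let Y : ((S → Fin N) → ℂ[X]) →ₗ[ℂ] ((S → Fin N) → ℂ[X]) :=
    { toFun := y
      map_add' := fun f g => by
        refine (hyu _ _ ?_).symm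
        rw [map_add, hy, hy, smul_add]
      map_smul' := fun c f => by
        refine (hyu _ _ ?_).symm
        rw [map_smul, hy, RingHom.id_apply, smul_comm] }
  let Φ : ({σ // σ ∈ C} → Fin (d + 1) → ℂ) →ₗ[ℂ]
      ({σ // σ ∈ C} → (S ⊕ Fin (d + 1 - r - B)) → ℂ) :=
    LinearMap.pi fun σ => LinearMap.pi fun t => Sum.elim
      (fun s => (Polynomial.leval (z s)) ∘ₗ (LinearMap.proj σ.1) ∘ₗ Y ∘ₗ emb C d)
      (fun i => (Polynomial.lcoeff ℂ ((N + 1) * B + i)) ∘ₗ (LinearMap.proj σ.1) ∘ₗ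
        (Dhat z K) ∘ₗ emb C d) t
  have hker : LinearMap.ker Φ ≤ LinearMap.ker (Dhat z K ∘ₗ emb C d) := by
    intro x hx
    rw [LinearMap.mem_ker] at hx ⊢
    set f := emb C d x with hf
    have h1 : ∀ s σ, (y f σ).eval (z s) = 0 := by
      intro s σ
      by_cases h : σ ∈ C
      · exact congrFun (congrFun hx ⟨σ, h⟩) (Sum.inl s)
      · have h2 := hC f (emb_supp C d x) σ h
        rw [hy] at h2
        simp only [Pi.smul_apply, smul_eq_mul] at h2
        rw [(mul_eq_zero.1 h2).resolve_left (pow_ne_zero _ hw), eval_zero]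
    have h2 : ∀ (σ) (h : σ ∈ C) (i : Fin (d + 1 - r - B)),
        (Dhat z K f σ).coeff ((N + 1) * B + i) = 0 := fun σ h i =>
      congrFun (congrFun hx ⟨σ, h⟩) (Sum.inr i)
    have h3 := hy2 f h1
    funext σ
    change Dhat z K f σ = 0
    by_cases h : σ ∈ C
    swap
    · exact hC f (emb_supp C d x) σ h
    obtain ⟨q, hq⟩ := h3 σ
    have h4 : Dhat z K f σ = wz z ^ (N + 1) * q := by
      rw [hy, Pi.smul_apply, smul_eq_mul, hq, ← mul_assoc, ← pow_add]
      congr 2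
      omega
    by_contra hne
    have hq0 : q ≠ 0 := by rintro rfl; simp [h4] at hne
    have hmon : (wz z ^ (N + 1)).Monic := (wz_monic z).pow _
    have hnd : (Dhat z K f σ).natDegree = (N + 1) * B + q.natDegree := by
      rw [h4, hmon.natDegree_mul' hq0, (wz_monic z).natDegree_pow, wz_natDegree]
    have hlc : (Dhat z K f σ).coeff ((N + 1) * B + q.natDegree) ≠ 0 := by
      rw [← hnd]; exact leadingCoeff_ne_zero.2 hne
    by_cases hlt : q.natDegree < d + 1 - r - B
    · exact hlc (h2 σ h ⟨_, hlt⟩)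
    · refine hlc (hdeg f d (emb_deg C d x) σ _ ?_)
      have : (N + 1) * B = N * B + B := by ring
      omega
  have h5 := Submodule.finrank_mono hker
  have h6 := LinearMap.finrank_range_add_finrank_ker Φ
  have h7 := Submodule.finrank_le (LinearMap.range Φ)
  have h8 : Module.finrank ℂ ({σ // σ ∈ C} → Fin (d + 1) → ℂ) = C.card * (d + 1) := by
    rw [Module.finrank_pi_fintype]; simp
  have h9 : Module.finrank ℂ ({σ // σ ∈ C} → (S ⊕ Fin (d + 1 - r - B)) → ℂ) =
      C.card * (B + (d + 1 - r - B)) := by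
    rw [Module.finrank_pi_fintype]; simp [hB]
  rw [h8] at h6
  rw [h9] at h7
  have h10 : C.card * (d + 1) = r * C.card + C.card * (B + (d + 1 - r - B)) := by
    have : d + 1 = r + (B + (d + 1 - r - B)) := by omega
    conv_lhs => rw [this]
    ring
  omega

end Count

section Limit
variable {S : Type*} [Fintype S] [DecidableEq S] {N : ℕ}

/-- Coefficientwise continuity of a family of polynomials. -/
def PC (F : ℂ → ℂ[X]) : Prop := ∀ k, Continuous fun e => (F e).coeff k

lemma PC.const (p : ℂ[X]) : PC fun _ => p := fun k => continuous_const
lemma PC.add {F G : ℂ → ℂ[X]} (hF : PC F) (hG : PC G) : PC fun e => F e + G e := fun k => by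
  simp only [coeff_add]; exact (hF k).add (hG k)
lemma PC.sub {F G : ℂ → ℂ[X]} (hF : PC F) (hG : PC G) : PC fun e => F e - G e := fun k => by
  simp only [coeff_sub]; exact (hF k).sub (hG k)
lemma PC.mul {F G : ℂ → ℂ[X]} (hF : PC F) (hG : PC G) : PC fun e => F e * G e := fun k => by
  simp only [coeff_mul]
  exact continuous_finset_sum _ fun x _ => (hF _).mul (hG _)
lemma PC.sum {ι : Type*} (s : Finset ι) {F : ι → ℂ → ℂ[X]} (hF : ∀ i, PC (F i)) :
    PC fun e => ∑ i ∈ s, F i e := fun k => by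
  simp only [finset_sum_coeff]
  exact continuous_finset_sum _ fun i _ => hF i k
lemma PC.prod {ι : Type*} (s : Finset ι) {F : ι → ℂ → ℂ[X]} (hF : ∀ i, PC (F i)) :
    PC fun e => ∏ i ∈ s, F i e := by
  classical
  induction s using Finset.induction_on with
  | empty => simpa using PC.const 1
  | insert a s ha ih =>
    simp only [Finset.prod_insert ha]
    exact (hF a).mul ih
lemma PC.deriv {F : ℂ → ℂ[X]} (hF : PC F) : PC fun e => derivative (F e) := fun k => by
  simp only [coeff_derivative]
  exact (hF _).mul continuous_const

variable {z : ℂ → S → ℂ}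

lemma PC_lin (hz : ∀ s, Continuous fun e => z e s) (s : S) : PC fun e => X - C (z e s) := by
  refine (PC.const X).sub fun k => ?_
  simp only [coeff_C]
  split_ifs
  · exact hz s
  · exact continuous_const

lemma PC_Xop (hz : ∀ s, Continuous fun e => z e s) (K : Fin N → ℂ) (j : ℕ) (a b : Fin N)
    (f : ℂ → (S → Fin N) → ℂ[X]) (hf : ∀ σ, PC fun e => f e σ) (σ) :
    PC fun e => Xop (z e) K j a b (f e) σ := by
  have hw : PC fun e => wz (z e) := PC.prod _ fun s => PC_lin hz s
  have hws : ∀ s, PC fun e => ws (z e) s := fun s => PC.prod _ fun s => PC_lin hz s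
  have hB : PC fun e => Bop (ws (z e)) b a (f e) σ := by
    simp only [Bop_apply, ee_apply]
    refine PC.sum _ fun s => (hws s).mul ?_
    split_ifs
    · exact hf _
    · exact PC.const 0
  by_cases h : a = b
  · simp only [Xop, h, if_true, LinearMap.sub_apply, Pi.sub_apply, nab_apply] at hB ⊢
    exact ((((hw.mul (hf σ).deriv).sub (((PC.const _).mul hw).mul (hf σ))).sub
      (((PC.const _).mul hw.deriv).mul (hf σ)))).sub hB
  · simp only [Xop, h, if_false, LinearMap.sub_apply, Pi.sub_apply, LinearMap.zero_apply,
      Pi.zero_apply]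
    exact (PC.const 0).sub hB

lemma ofFn_prod_family {T : Type*} [AddCommGroup T] [Module ℂ T] (P : (ℂ → T) → Prop) : ∀ {n : ℕ}
    (O : Fin n → ℂ → Module.End ℂ T)
    (h : ∀ k x, P x → P (fun e => O k e (x e))) (x : ℂ → T) (hx : P x),
    P (fun e => (List.ofFn fun k => O k e).prod (x e)) := by
  intro n
  induction n with
  | zero => intro O h x hx; simpa using hx
  | succ n ih =>
    intro O h x hx
    simp only [List.ofFn_succ, List.prod_cons, Module.End.mul_apply]
    exact h 0 _ (ih (fun k => O k.succ) (fun k => h k.succ) x hx)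

lemma PC_Dhat (hz : ∀ s, Continuous fun e => z e s) (K : Fin N → ℂ)
    (f : (S → Fin N) → ℂ[X]) (σ) :
    PC fun e => Dhat (z e) K f σ := by
  simp only [Dhat, Rd_apply, zsmul_eq_mul]
  refine PC.sum _ fun π => (PC.const _).mul ?_
  exact ofFn_prod_family (fun F : ℂ → (S → Fin N) → ℂ[X] => ∀ σ, PC fun e => F e σ)
    (fun k e => Yop (z e) K k (Sum.inl k) (π k))
    (fun k x hx σ => PC_Xop hz K _ _ _ x hx σ) (fun _ => f) (fun σ => PC.const _) σ

lemma count_all (hN : 2 ≤ N) (K : Fin N → ℂ) (z : S → ℂ)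
    (C : Finset (S → Fin N)) (r d : ℕ) (hd : r + Fintype.card S ≤ d)
    (hC : ∀ (z : S → ℂ) (f : (S → Fin N) → ℂ[X]), (∀ σ ∉ C, f σ = 0) → ∀ σ ∉ C, Dhat z K f σ = 0)
    (hdeg : ∀ (z : S → ℂ) (f : (S → Fin N) → ℂ[X]) (e : ℕ), (∀ σ i, e < i → (f σ).coeff i = 0) →
      ∀ σ i, e + N * Fintype.card S < i + r → (Dhat z K f σ).coeff i = 0) :
    r * C.card ≤ Module.finrank ℂ (LinearMap.ker (Dhat z K ∘ₗ emb C d)) := by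
  set B := Fintype.card S with hB
  let Lc : ((S → Fin N) → ℂ[X]) →ₗ[ℂ] ((S → Fin N) → Fin (d + N * B + 1) → ℂ) :=
    LinearMap.pi fun σ => LinearMap.pi fun i => Polynomial.lcoeff ℂ i ∘ₗ LinearMap.proj σ
  let L : (S → ℂ) → ({σ // σ ∈ C} → Fin (d + 1) → ℂ) →ₗ[ℂ]
    ((S → Fin N) → Fin (d + N * B + 1) → ℂ) := fun z => Lc ∘ₗ Dhat z K ∘ₗ emb C d
  have hker : ∀ z, LinearMap.ker (L z) = LinearMap.ker (Dhat z K ∘ₗ emb C d) := by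
    intro z
    ext x
    simp only [LinearMap.mem_ker]
    constructor
    · intro h
      funext σ
      refine Polynomial.ext fun i => ?_
      by_cases hi : i < d + N * B + 1
      · exact congrFun (congrFun h σ) ⟨i, hi⟩
      · exact hdeg z _ d (emb_deg C d x) σ i (by omega)
    · intro h
      change Lc ((Dhat z K ∘ₗ emb C d) x) = 0
      rw [h, map_zero]
  let q : S ≃ Fin B := Fintype.equivFin S
  let zz : ℂ → S → ℂ := fun e s => z s + e * (q s : ℕ)
  have hinj : ∀ᶠ e in nhdsWithin (0:ℂ) {0}ᶜ, Function.Injective (zz e) := by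
    have h1 : ∀ p : S × S, p.1 ≠ p.2 → ∀ᶠ e in nhdsWithin (0:ℂ) {0}ᶜ, zz e p.1 ≠ zz e p.2 := by
      intro p hp
      have hq : ((q p.1 : ℕ) : ℂ) - (q p.2 : ℕ) ≠ 0 := by
        rw [sub_ne_zero]
        intro h
        exact hp (q.injective (Fin.ext (by exact_mod_cast h)))
      by_cases hzz : z p.1 = z p.2
      · filter_upwards [self_mem_nhdsWithin] with e he h
        have h2 : e * (((q p.1 : ℕ) : ℂ) - (q p.2 : ℕ)) = 0 := by
          simp only [zz, hzz] at h
          linear_combination h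
        exact (mul_ne_zero he hq) h2
      · have hc : Continuous fun e => zz e p.1 - zz e p.2 := by fun_prop
        have : ∀ᶠ e in nhds (0:ℂ), zz e p.1 - zz e p.2 ≠ 0 := by
          refine hc.continuousAt.eventually_ne ?_
          simpa [zz, sub_eq_zero] using hzz
        filter_upwards [nhdsWithin_le_nhds this] with e he h
        exact he (sub_eq_zero.2 h)
    have h2 : ∀ᶠ e in nhdsWithin (0:ℂ) {0}ᶜ, ∀ p : S × S, p.1 ≠ p.2 → zz e p.1 ≠ zz e p.2 := by
      rw [Filter.eventually_all]
      intro p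
      by_cases hp : p.1 = p.2
      · exact Filter.Eventually.of_forall fun e h => absurd hp h
      · filter_upwards [h1 p hp] with e he _ using he
    filter_upwards [h2] with e he s t hst
    by_contra hne
    exact he (s, t) hne hst
  let Lclm : ℂ → ({σ // σ ∈ C} → Fin (d + 1) → ℂ) →L[ℂ]
    ((S → Fin N) → Fin (d + N * B + 1) → ℂ) := fun e => LinearMap.toContinuousLinearMap (L (zz e))
  have hcont : Continuous Lclm := by
    rw [continuous_clm_apply]
    intro x
    refine continuous_pi fun σ => continuous_pi fun i => ?_
    exact PC_Dhat (z := zz) (fun s => by fun_prop) K (emb C d x) σ i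
  have h00 : zz 0 = z := by funext s; simp [zz]
  by_contra hlt
  push Not at hlt
  have hrn : ∀ z, Module.finrank ℂ (LinearMap.range (L z)) + 
      Module.finrank ℂ (LinearMap.ker (Dhat z K ∘ₗ emb C d)) = C.card * (d + 1) := by
    intro z
    rw [← hker, LinearMap.finrank_range_add_finrank_ker, Module.finrank_pi_fintype]
    simp
  set ρ := Module.finrank ℂ (LinearMap.range (L z)) with hρ
  have hopen := (isOpen_setOfPred_nat_le_rank (𝕜 := ℂ)
    (E := ({σ // σ ∈ C} → Fin (d + 1) → ℂ)) (F := ((S → Fin N) → Fin (d + N * B + 1) → ℂ))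
    ρ).preimage hcont
  have hrk : ∀ z, LinearMap.rank (L z) = (Module.finrank ℂ (LinearMap.range (L z)) : Cardinal) := by
    intro z
    rw [LinearMap.rank, Module.finrank_eq_rank]
  have hmem : (ρ : Cardinal) ≤ LinearMap.rank (L (zz 0)) := by
    rw [hrk, h00]
  have hev := nhdsWithin_le_nhds (s := {0}ᶜ) (hopen.mem_nhds (x := (0 : ℂ)) hmem)
  obtain ⟨e, he1, he2⟩ := (hinj.and hev).exists
  have he3 : (ρ : Cardinal) ≤ LinearMap.rank (L (zz e)) := he2
  rw [hrk] at he3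
  have he4 : ρ ≤ Module.finrank ℂ (LinearMap.range (L (zz e))) := by exact_mod_cast he3
  have he5 := count_distinct hN K (zz e) he1 C r d hd (hC _) (hdeg _)
  have := hrn z
  have := hrn (zz e)
  omega

end Limit
end GaudinModel

set_option linter.all false
set_option linter.unusedSectionVars false
set_option linter.unusedSimpArgs false
namespace GaudinModel
open Polynomial

section Rel

lemma ofFn_rel {T T' : Type*} [AddCommGroup T] [Module ℂ T] [AddCommGroup T'] [Module ℂ T']
    (R : ℕ → T → T' → Prop) : ∀ {n : ℕ} (O : Fin n → Module.End ℂ T) (Ψ : Fin n → Module.End ℂ T')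
    (_ : ∀ (k : Fin n) x y, R (n - 1 - k) x y → R (n - k) (O k x) (Ψ k y)) (x : T) (y : T'),
    R 0 x y → R n ((List.ofFn O).prod x) ((List.ofFn Ψ).prod y) := by
  intro n
  induction n with
  | zero => intro O Ψ h x y hx; simpa using hx
  | succ n ih =>
    intro O Ψ h x y hx
    simp only [List.ofFn_succ, List.prod_cons, Module.End.mul_apply]
    have h0 := h 0
    simp only [Fin.val_zero, Nat.add_sub_cancel, Nat.sub_zero] at h0
    refine h0 _ _ (ih (fun k => O k.succ) (fun k => Ψ k.succ) (fun k x y hxy => ?_) x y hx)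
    have := h k.succ x y
    simp only [Fin.val_succ] at this
    rw [show n + 1 - 1 - (k + 1) = n - 1 - k by omega, show n + 1 - (k + 1) = n - k by omega] at this
    exact this hxy

lemma ofFn_eig {T' : Type*} [AddCommGroup T'] [Module ℂ T'] : ∀ {n : ℕ}
    (Ψ : Fin n → Module.End ℂ T') (c : Fin n → ℂ) (φ : T') (_ : ∀ k, Ψ k φ = c k • φ),
    (List.ofFn Ψ).prod φ = (∏ k, c k) • φ := by
  intro n
  induction n with
  | zero => intro Ψ c φ h; simp
  | succ n ih =>
    intro Ψ c φ h
    simp only [List.ofFn_succ, List.prod_cons, Module.End.mul_apply]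
    rw [ih _ (fun k => c k.succ) φ (fun k => h k.succ), map_smul, h 0, smul_smul,
      Fin.prod_univ_succ, mul_comm]

/-- If the last non-eigen factor kills `φ`, so does the product. -/
lemma ofFn_kill {T' : Type*} [AddCommGroup T'] [Module ℂ T'] : ∀ {n : ℕ}
    (Ψ : Fin n → Module.End ℂ T') (c : Fin n → ℂ) (φ : T') (i : Fin n)
    (_ : ∀ k, i < k → Ψ k φ = c k • φ) (_ : Ψ i φ = 0),
    (List.ofFn Ψ).prod φ = 0 := by
  intro n
  induction n with
  | zero => intro Ψ c φ i; exact i.elim0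
  | succ n ih =>
    intro Ψ c φ i h h0
    simp only [List.ofFn_succ, List.prod_cons, Module.End.mul_apply]
    refine Fin.cases ?_ ?_ i (motive := fun i => (∀ k, i < k → Ψ k φ = c k • φ) → Ψ i φ = 0 → _) h h0
    · intro h h0
      rw [ofFn_eig _ (fun k => c k.succ) φ (fun k => h _ (Fin.succ_pos k)), map_smul, h0, smul_zero]
    · intro i h h0
      rw [ih (fun k => Ψ k.succ) (fun k => c k.succ) φ i (fun k hk => h _ (Fin.succ_lt_succ_iff.2 hk)) h0,
        map_zero]

end Rel

section Top

/-- integer-indexed coefficient -/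
def zc (p : ℂ[X]) (k : ℤ) : ℂ := if 0 ≤ k then p.coeff k.toNat else 0

lemma zc_nat (p : ℂ[X]) (k : ℕ) : zc p k = p.coeff k := by simp [zc]
lemma zc_zero (k : ℤ) : zc 0 k = 0 := by simp [zc]
lemma zc_add (p q : ℂ[X]) (k : ℤ) : zc (p + q) k = zc p k + zc q k := by
  simp only [zc]; split_ifs <;> simp
lemma zc_sub (p q : ℂ[X]) (k : ℤ) : zc (p - q) k = zc p k - zc q k := by
  simp only [zc]; split_ifs <;> simp
lemma zc_Cmul (c : ℂ) (p : ℂ[X]) (k : ℤ) : zc (C c * p) k = c * zc p k := by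
  simp only [zc]; split_ifs <;> simp
lemma zc_sum {ι : Type*} (s : Finset ι) (p : ι → ℂ[X]) (k : ℤ) :
    zc (∑ i ∈ s, p i) k = ∑ i ∈ s, zc (p i) k := by
  simp only [zc]; split_ifs <;> simp [finset_sum_coeff]
lemma zc_X (p : ℂ[X]) (k : ℤ) : zc (X * p) k = zc p (k - 1) := by
  simp only [zc]
  rcases lt_trichotomy k 0 with h | rfl | h
  · rw [if_neg (by omega), if_neg (by omega)]
  · simp
  · rw [if_pos (by omega), if_pos (by omega)]
    obtain ⟨i, rfl⟩ : ∃ i : ℕ, k = i + 1 := ⟨(k - 1).toNat, by omega⟩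
    rw [show ((i : ℤ) + 1).toNat = i + 1 by omega, show ((i : ℤ) + 1 - 1).toNat = i by omega,
      coeff_X_mul]
lemma zc_der (p : ℂ[X]) (k : ℤ) : zc (derivative p) k = (k + 1) * zc p (k + 1) := by
  simp only [zc]
  rcases lt_trichotomy k (-1) with h | rfl | h
  · rw [if_neg (by omega), if_neg (by omega)]; simp
  · simp
  · rw [if_pos (by omega), if_pos (by omega)]
    obtain ⟨i, rfl⟩ : ∃ i : ℕ, k = i := ⟨k.toNat, by omega⟩
    rw [show ((i : ℤ) + 1).toNat = i + 1 by omega, Int.toNat_natCast, coeff_derivative]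
    push_cast; ring

def TopP (p : ℂ[X]) (k : ℤ) (a : ℂ) : Prop := (∀ i, k < i → zc p i = 0) ∧ zc p k = a

lemma TopP.sub {p q : ℂ[X]} {k : ℤ} {a b : ℂ} (hp : TopP p k a) (hq : TopP q k b) :
    TopP (p - q) k (a - b) :=
  ⟨fun i hi => by rw [zc_sub, hp.1 i hi, hq.1 i hi, sub_zero], by rw [zc_sub, hp.2, hq.2]⟩
lemma TopP.Cmul {p : ℂ[X]} {k : ℤ} {a : ℂ} (c : ℂ) (hp : TopP p k a) :
    TopP (C c * p) k (c * a) :=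
  ⟨fun i hi => by rw [zc_Cmul, hp.1 i hi, mul_zero], by rw [zc_Cmul, hp.2]⟩
lemma TopP.sum {ι : Type*} (s : Finset ι) {p : ι → ℂ[X]} {k : ℤ} {a : ι → ℂ}
    (hp : ∀ i ∈ s, TopP (p i) k (a i)) : TopP (∑ i ∈ s, p i) k (∑ i ∈ s, a i) :=
  ⟨fun i hi => by rw [zc_sum]; exact Finset.sum_eq_zero fun j hj => (hp j hj).1 i hi,
   by rw [zc_sum]; exact Finset.sum_congr rfl fun j hj => (hp j hj).2⟩
lemma TopP.zero (k : ℤ) : TopP 0 k 0 := ⟨fun i _ => zc_zero i, zc_zero k⟩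
lemma TopP.weak {p : ℂ[X]} {k : ℤ} {a : ℂ} (hp : TopP p k a) {l : ℤ} (h : k < l) : TopP p l 0 :=
  ⟨fun i hi => hp.1 i (by omega), hp.1 l h⟩
lemma TopP.der {p : ℂ[X]} {k : ℤ} {a : ℂ} (hp : TopP p k a) :
    TopP (derivative p) (k - 1) (k * a) := by
  refine ⟨fun i hi => by rw [zc_der, hp.1 _ (by omega), mul_zero], ?_⟩
  rw [zc_der, sub_add_cancel, hp.2]; push_cast; ring
lemma TopP.lin {p : ℂ[X]} {k : ℤ} {a : ℂ} (c : ℂ) (hp : TopP p k a) :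
    TopP ((X - C c) * p) (k + 1) a := by
  refine ⟨fun i hi => ?_, ?_⟩
  · rw [sub_mul, zc_sub, zc_X, zc_Cmul, hp.1 _ (by omega), hp.1 _ (by omega)]; simp
  · rw [sub_mul, zc_sub, zc_X, zc_Cmul, add_sub_cancel_right, hp.2, hp.1 _ (by omega)]; simp
lemma TopP.prod {S : Type*} (z : S → ℂ) (T : Finset S) {p : ℂ[X]} {k : ℤ} {a : ℂ}
    (hp : TopP p k a) : TopP ((∏ s ∈ T, (X - C (z s))) * p) (k + T.card) a := by
  classical
  induction T using Finset.induction_on with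
  | empty => simpa using hp
  | insert s T hs ih =>
    rw [Finset.prod_insert hs, Finset.card_insert_of_notMem hs, mul_assoc]
    have := ih.lin (z s)
    push_cast
    rwa [← add_assoc]

variable {S : Type*} [Fintype S] [DecidableEq S] {N : ℕ} (z : S → ℂ) (K : Fin N → ℂ)

def Etot (a b : Fin N) : Module.End ℂ ((S → Fin N) → ℂ) := ∑ s, ee s a b

lemma Etot_apply (a b : Fin N) (φ : (S → Fin N) → ℂ) (σ) : Etot a b φ σ = ∑ s, ee s a b φ σ := by
  simp [Etot, LinearMap.sum_apply, Finset.sum_apply]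

def HasTop (f : (S → Fin N) → ℂ[X]) (k : ℤ) (φ : (S → Fin N) → ℂ) : Prop :=
  ∀ σ, TopP (f σ) k (φ σ)

lemma TopP.wz {p : ℂ[X]} {k : ℤ} {a : ℂ} (hp : TopP p k a) :
    TopP (wz z * p) (k + Fintype.card S) a := TopP.prod z Finset.univ hp

lemma TopP.ws {p : ℂ[X]} {k : ℤ} {a : ℂ} (s : S) (hp : TopP p k a) :
    TopP (ws z s * p) (k + Fintype.card S - 1) a := by
  have := TopP.prod z (Finset.univ.erase s) hp
  have hc : 0 < Fintype.card S := Fintype.card_pos_iff.2 ⟨s⟩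
  rw [Finset.card_erase_of_mem (Finset.mem_univ s), Finset.card_univ, Nat.cast_sub hc,
    Nat.cast_one, ← add_sub_assoc] at this
  exact this

lemma TopP.wz' {p : ℂ[X]} {k : ℤ} {a : ℂ} (hp : TopP p k a) :
    TopP (derivative (GaudinModel.wz z) * p) (k + Fintype.card S - 1) (Fintype.card S * a) := by
  rw [derivative_wz, Finset.sum_mul]
  have := TopP.sum Finset.univ (fun s _ => hp.ws z s)
  simpa using this

lemma HasTop.Bop {f : (S → Fin N) → ℂ[X]} {k : ℤ} {φ : (S → Fin N) → ℂ} (hf : HasTop f k φ)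
    (a b : Fin N) : HasTop (Bop (GaudinModel.ws z) a b f) (k + Fintype.card S - 1) (Etot a b φ) := by
  intro σ
  rw [Bop_apply, Etot_apply]
  refine TopP.sum _ fun s _ => TopP.ws z s ?_
  rw [ee_apply, ee_apply]
  split_ifs
  · exact hf _
  · exact TopP.zero _

lemma HasTop.XopA {f : (S → Fin N) → ℂ[X]} {k : ℤ} {φ : (S → Fin N) → ℂ} (hf : HasTop f k φ)
    (j : ℕ) (a b : Fin N) :
    HasTop (Xop z K j a b f) (k + Fintype.card S)
      (((if a = b then - K a else 0) • (1 : Module.End ℂ ((S → Fin N) → ℂ))) φ) := by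
  intro σ
  have hB := (hf.Bop z b a σ).weak (l := k + Fintype.card S) (by omega)
  by_cases h : a = b
  · subst h
    simp only [Xop, if_true, LinearMap.sub_apply, Pi.sub_apply, nab_apply]
    have h1 := (((hf σ).der).wz z).weak (l := k + Fintype.card S) (by omega)
    have h2 := ((hf σ).wz z).Cmul (K a)
    have h3 := (((hf σ).wz' z).Cmul j).weak (l := k + Fintype.card S) (by omega)
    have := ((h1.sub h2).sub h3).sub hB
    simpa [mul_assoc] using this
  · simp only [Xop, h, if_false, LinearMap.sub_apply, Pi.sub_apply]
    simpa using (TopP.zero _).sub hB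

lemma HasTop.XopB {f : (S → Fin N) → ℂ[X]} {k : ℤ} {φ : (S → Fin N) → ℂ} (hf : HasTop f k φ)
    (j : ℕ) (a b : Fin N) (hab : a = b → K a = 0) :
    HasTop (Xop z K j a b f) (k + Fintype.card S - 1)
      (((if a = b then (k : ℂ) - j * Fintype.card S else 0) •
        (1 : Module.End ℂ ((S → Fin N) → ℂ)) - Etot b a : Module.End ℂ ((S → Fin N) → ℂ)) φ) := by
  intro σ
  have hB := (hf.Bop z b a σ)
  by_cases h : a = b
  · subst h
    have hK := hab rfl
    simp only [Xop, if_true, LinearMap.sub_apply, Pi.sub_apply, nab_apply, hK]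
    have h1 := (((hf σ).der).wz z)
    have h3 := (((hf σ).wz' z).Cmul j)
    rw [show k - 1 + (Fintype.card S : ℤ) = k + Fintype.card S - 1 by ring] at h1
    have := (h1.sub h3).sub hB
    simpa [mul_assoc, sub_mul] using this
  · simp only [Xop, h, if_false, LinearMap.sub_apply, Pi.sub_apply]
    simpa using (TopP.zero _).sub hB

end Top
end GaudinModel

set_option linter.all false
set_option linter.unusedSectionVars false
set_option linter.unusedSimpArgs false
namespace GaudinModel
open Polynomial

section Sym
variable {S : Type*} [Fintype S] [DecidableEq S] {N : ℕ} (z : S → ℂ) (K : Fin N → ℂ)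

/-- The sum of `δ` over the last `i` rows. -/
def Sd {A : Type*} [AddCommGroup A] (δ : Fin N → A) (i : ℕ) : A :=
  ∑ r : Fin N, if N ≤ r + i then δ r else 0

lemma Sd_zero {A : Type*} [AddCommGroup A] (δ : Fin N → A) : Sd δ 0 = 0 := by
  refine Finset.sum_eq_zero fun r _ => if_neg ?_
  have := r.2; omega

lemma Sd_all {A : Type*} [AddCommGroup A] (δ : Fin N → A) : Sd δ N = ∑ r, δ r := by
  refine Finset.sum_congr rfl fun r _ => if_pos ?_
  omega

lemma Sd_step {A : Type*} [AddCommGroup A] (δ : Fin N → A) (k : Fin N) :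
    Sd δ (N - k) = Sd δ (N - 1 - k) + δ k := by
  have : δ k = ∑ r, if r = k then δ r else 0 := by simp
  rw [this, Sd, Sd, ← Finset.sum_add_distrib]
  refine Finset.sum_congr rfl fun r _ => ?_
  have h1 := r.2
  have h2 := k.2
  rcases lt_trichotomy r.1 k.1 with h | h | h
  · rw [if_neg (by omega), if_neg (by omega), if_neg (by intro h'; rw [h'] at h; omega), add_zero]
  · rw [if_pos (by omega), if_neg (by omega), if_pos (Fin.ext h), zero_add]
  · rw [if_pos (by omega), if_pos (by omega), if_neg (by intro h'; rw [h'] at h; omega), add_zero]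

lemma Dhat_apply (f : (S → Fin N) → ℂ[X]) (σ : S → Fin N) :
    Dhat z K f σ = ∑ π : Equiv.Perm (Fin N), ((Equiv.Perm.sign π : ℤˣ) : ℤ) •
    ((List.ofFn fun k : Fin N => Xop z K (N - 1 - k) k (π k)).prod f σ) :=
  Rd_apply _ _ _ _

def Psi (k : ℤ) (δ : Fin N → ℤ) (π : Equiv.Perm (Fin N)) (r : Fin N) :
    Module.End ℂ ((S → Fin N) → ℂ) :=
  if δ r = 1 then
    (if r = π r then ((k - Sd δ (N - 1 - r) : ℤ) : ℂ) else 0) •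
      (1 : Module.End ℂ ((S → Fin N) → ℂ)) - Etot (π r) r
  else (if r = π r then - K r else 0) • (1 : Module.End ℂ ((S → Fin N) → ℂ))

lemma top_general (δ : Fin N → ℤ) (hδ : ∀ r, δ r = 0 ∨ δ r = 1) (π : Equiv.Perm (Fin N))
    (hδπ : ∀ r, δ r = 1 → r = π r → K r = 0) (f : (S → Fin N) → ℂ[X]) (k : ℤ)
    (φ : (S → Fin N) → ℂ) (hf : HasTop f k φ) :
    HasTop ((List.ofFn fun r : Fin N => Xop z K (N - 1 - r) r (π r)).prod f)
      (k + N * Fintype.card S - ∑ r, δ r)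
      ((List.ofFn (Psi K k δ π)).prod φ) := by
  have := ofFn_rel (fun i (x : (S → Fin N) → ℂ[X]) (ψ : (S → Fin N) → ℂ) =>
    HasTop x (k + i * Fintype.card S - Sd δ i) ψ)
    (fun r : Fin N => Xop z K (N - 1 - r) r (π r)) (Psi K k δ π) ?_ f φ
    (by simpa [Sd_zero] using hf)
  · simpa [Sd_all] using this
  · intro r x ψ hx
    have hr := r.2
    have hc : ((N - r : ℕ) : ℤ) = ((N - 1 - r : ℕ) : ℤ) + 1 := by omega
    rcases hδ r with h | h
    · have h1 := hx.XopA z K (N - 1 - r) r (π r)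
      rw [Sd_step, hc, h]
      simp only [Psi, h]
      rw [if_neg (by norm_num)]
      convert h1 using 1
      ring
    · have h1 := hx.XopB z K (N - 1 - r) r (π r) (hδπ r h)
      rw [Sd_step, hc, h]
      simp only [Psi, h, if_true]
      convert h1 using 1
      · ring
      · congr 3
        split_ifs
        · push_cast; ring
        · rfl

lemma TopP.zsmul {p : ℂ[X]} {k : ℤ} {a : ℂ} (c : ℤ) (hp : TopP p k a) :
    TopP (c • p) k (c * a) := by
  have := hp.Cmul (c : ℂ)
  rwa [zsmul_eq_mul, show (c : ℂ[X]) = C (c : ℂ) by simp]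

lemma two_le_drop (π : Equiv.Perm (Fin N)) (hπ : π ≠ 1) (δ : Fin N → ℤ) (h0 : ∀ r, 0 ≤ δ r)
    (h1 : ∀ r, π r ≠ r → δ r = 1) : 2 ≤ ∑ r, δ r := by
  obtain ⟨r, hr⟩ : ∃ r, π r ≠ r := by
    by_contra h
    push Not at h
    exact hπ (Equiv.ext h)
  have hr2 : π (π r) ≠ π r := fun h => hr (π.injective h)
  have := Finset.sum_le_sum_of_subset_of_nonneg (Finset.subset_univ {r, π r})
    (fun i _ _ => h0 i)
  rw [Finset.sum_pair hr.symm, h1 r hr, h1 _ hr2] at this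
  linarith

lemma top_i (a : Fin N) (ha : K a = 0) (f : (S → Fin N) → ℂ[X]) (k : ℤ)
    (φ : (S → Fin N) → ℂ) (hf : HasTop f k φ) :
    HasTop (Dhat z K f) (k + N * Fintype.card S - 1)
      ((List.ofFn (Psi K k (fun r => if r = a then 1 else 0) 1)).prod φ) := by
  intro σ
  rw [Dhat_apply]
  have : (List.ofFn (Psi K k (fun r => if r = a then 1 else 0) 1)).prod φ σ =
    ∑ π : Equiv.Perm (Fin N), if π = 1 then
      (List.ofFn (Psi K k (fun r => if r = a then 1 else 0) 1)).prod φ σ else 0 := by simp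
  rw [this]
  refine TopP.sum _ fun π _ => ?_
  split_ifs with hπ
  · subst hπ
    have := top_general z K (fun r => if r = a then 1 else 0) (fun r => by split_ifs <;> simp) 1
      (fun r h _ => by
        have : r = a := by by_contra h'; simp [h'] at h
        rw [this, ha]) f k φ hf σ
    simpa using this
  · have h2 := two_le_drop π hπ (fun r => if π r ≠ r then 1 else 0)
      (fun r => by positivity) (fun r h => by simp [h])
    have := top_general z K (fun r => if π r ≠ r then 1 else 0) (fun r => by split_ifs <;> simp) π
      (fun r h h' => by simp [← h'] at h) f k φ hf σ
    have := (this.zsmul (Equiv.Perm.sign π : ℤˣ)).weak (l := k + N * Fintype.card S - 1) (by omega)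
    exact this

lemma top_i_eig (a : Fin N) (ha : K a = 0) (f : (S → Fin N) → ℂ[X]) (k : ℤ)
    (φ : (S → Fin N) → ℂ) (hf : HasTop f k φ) (μ : ℂ) (hμ : Etot a a φ = μ • φ) :
    HasTop (Dhat z K f) (k + N * Fintype.card S - 1)
      ((((k : ℂ) - μ) * ∏ b ∈ Finset.univ.erase a, (- K b)) • φ) := by
  have := top_i z K a ha f k φ hf
  rw [ofFn_eig _ (fun r => if r = a then (k : ℂ) - μ else - K r)] at this
  · rw [← Finset.mul_prod_erase _ _ (Finset.mem_univ a), if_pos rfl] at this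
    rw [Finset.prod_congr rfl (g := fun b => - K b)] at this
    · exact this
    · intro b hb
      rw [if_neg (Finset.ne_of_mem_erase hb)]
  · intro r
    by_cases h : r = a
    · subst h
      have hS : Sd (fun r' : Fin N => if r' = r then (1 : ℤ) else 0) (N - 1 - r) = 0 := by
        refine Finset.sum_eq_zero fun q _ => ?_
        by_cases h2 : q = r
        · rw [if_neg]
          rw [h2]; have := r.2; omega
        · simp [h2]
      simp only [Psi, if_true, Equiv.Perm.one_apply, hS, LinearMap.sub_apply, hμ, sub_smul,
        LinearMap.smul_apply, Module.End.one_apply, sub_zero]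
    · simp [Psi, h]

lemma top_ii (hK : ∀ r, K r = 0) (f : (S → Fin N) → ℂ[X]) (k : ℤ)
    (φ : (S → Fin N) → ℂ) (hf : HasTop f k φ) :
    HasTop (Dhat z K f) (k + N * Fintype.card S - N)
      (∑ π : Equiv.Perm (Fin N), (((Equiv.Perm.sign π : ℤˣ) : ℤ) : ℂ) •
        (List.ofFn (Psi K k (fun r => 1) π)).prod φ) := by
  intro σ
  rw [Dhat_apply, Finset.sum_apply]
  refine TopP.sum _ fun π _ => ?_
  have := (top_general z K (fun r => 1) (fun r => Or.inr rfl) π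
      (fun r h h' => hK r) f k φ hf σ).zsmul (Equiv.Perm.sign π : ℤˣ)
  simpa using this

lemma Sd_one (i : ℕ) (hi : i ≤ N) : Sd (fun _ : Fin N => (1 : ℤ)) i = i := by
  induction i with
  | zero => exact Sd_zero _
  | succ i ih =>
    have := Sd_step (fun _ : Fin N => (1 : ℤ)) ⟨N - 1 - i, by omega⟩
    simp only at this
    rw [show N - (N - 1 - i) = i + 1 by omega, show N - 1 - (N - 1 - i) = i by omega,
      ih (by omega)] at this
    rw [this]; push_cast; ring

lemma top_ii_sing (hK : ∀ r, K r = 0) (f : (S → Fin N) → ℂ[X]) (k : ℤ)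
    (φ : (S → Fin N) → ℂ) (hf : HasTop f k φ) (m : Fin N → ℂ)
    (hm : ∀ a, Etot a a φ = m a • φ) (hs : ∀ a b, a < b → Etot a b φ = 0) :
    HasTop (Dhat z K f) (k + N * Fintype.card S - N)
      ((∏ r : Fin N, ((k : ℂ) - (N - 1 - r : ℕ) - m r)) • φ) := by
  have h := top_ii z K hK f k φ hf
  rw [Finset.sum_eq_single 1] at h
  · rw [ofFn_eig _ (fun r : Fin N => (k : ℂ) - (N - 1 - r : ℕ) - m r)] at h
    · simpa using h
    · intro r
      have hr := r.2
      simp only [Psi, if_true, Equiv.Perm.one_apply, LinearMap.sub_apply, hm, sub_smul,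
        LinearMap.smul_apply, Module.End.one_apply]
      rw [Sd_one _ (by omega)]
      push_cast
      rw [sub_smul]
  · intro π _ hπ
    have hne : (Finset.univ.filter fun r => π r ≠ r).Nonempty := by
      by_contra h
      rw [Finset.not_nonempty_iff_eq_empty, Finset.filter_eq_empty_iff] at h
      refine hπ (Equiv.ext fun r => ?_)
      simpa using h (Finset.mem_univ r)
    obtain ⟨r, hr1, hr2⟩ := Finset.exists_max_image _ id hne
    simp only [Finset.mem_filter, Finset.mem_univ, true_and, id] at hr1 hr2
    have hfix : ∀ q, r < q → π q = q := by
      intro q hq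
      by_contra h'
      exact absurd (hr2 q h') (not_le.2 hq)
    have hlt : π r < r := by
      rcases lt_or_ge (π r) r with h' | h'
      · exact h'
      · have h2 : r < π r := lt_of_le_of_ne h' (Ne.symm hr1)
        exact absurd (π.injective (hfix _ h2)) hr1
    rw [ofFn_kill _ (fun r : Fin N => (k : ℂ) - (N - 1 - r : ℕ) - m r) φ r, smul_zero]
    · intro q hq
      have hq' := q.2
      simp only [Psi, if_true, hfix q hq, LinearMap.sub_apply, hm, sub_smul,
        LinearMap.smul_apply, Module.End.one_apply]
      rw [Sd_one _ (by omega)]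
      push_cast
      rw [sub_smul]
    · simp only [Psi, if_true, LinearMap.sub_apply, if_neg (Ne.symm hr1), zero_smul,
        LinearMap.zero_apply, hs _ _ hlt, sub_zero]
  · intro h; exact absurd (Finset.mem_univ _) h

lemma hasTop_of_deg (f : (S → Fin N) → ℂ[X]) (e : ℕ) (h : ∀ σ i, e < i → (f σ).coeff i = 0) :
    HasTop f e (fun σ => (f σ).coeff e) := by
  intro σ
  refine ⟨fun i hi => ?_, zc_nat _ _⟩
  obtain ⟨j, rfl⟩ : ∃ j : ℕ, i = j := ⟨i.toNat, by omega⟩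
  rw [zc_nat]
  exact h σ j (by omega)

lemma deg_i (a : Fin N) (ha : K a = 0) (f : (S → Fin N) → ℂ[X]) (e : ℕ)
    (h : ∀ σ i, e < i → (f σ).coeff i = 0) (σ) (i : ℕ) (hi : e + N * Fintype.card S < i + 1) :
    (Dhat z K f σ).coeff i = 0 := by
  have := (top_i z K a ha f e _ (hasTop_of_deg f e h) σ).1 i (by push_cast; omega)
  rwa [zc_nat] at this

lemma deg_ii (hK : ∀ r, K r = 0) (f : (S → Fin N) → ℂ[X]) (e : ℕ)
    (h : ∀ σ i, e < i → (f σ).coeff i = 0) (σ) (i : ℕ) (hi : e + N * Fintype.card S < i + N) :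
    (Dhat z K f σ).coeff i = 0 := by
  have := (top_ii z K hK f e _ (hasTop_of_deg f e h) σ).1 i (by push_cast; omega)
  rwa [zc_nat] at this

/-! ### content -/

def cnt (σ : S → Fin N) (a : Fin N) : ℕ := (Finset.univ.filter fun s => σ s = a).card

lemma Etot_diag (a : Fin N) (φ : (S → Fin N) → ℂ) (σ) : Etot a a φ σ = cnt σ a * φ σ := by
  rw [Etot_apply, cnt, Finset.card_filter]
  push_cast
  rw [Finset.sum_mul]
  refine Finset.sum_congr rfl fun s _ => ?_
  rw [ee_apply]
  split_ifs with h
  · rw [← h, Function.update_eq_self, one_mul]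
  · simp

def zcnt (σ : S → Fin N) : Fin N → ℤ := fun a => cnt σ a

lemma zcnt_eq (σ : S → Fin N) : zcnt σ = ∑ s, Pi.single (σ s) (1 : ℤ) := by
  funext a
  rw [zcnt, cnt, Finset.card_filter, Finset.sum_apply]
  push_cast
  refine Finset.sum_congr rfl fun s _ => ?_
  rw [Pi.single_apply]
  simp [eq_comm]

lemma zcnt_update (σ : S → Fin N) (s : S) (a : Fin N) :
    zcnt (Function.update σ s a) = zcnt σ - Pi.single (σ s) 1 + Pi.single a 1 := by
  rw [zcnt_eq, zcnt_eq, ← Finset.add_sum_erase _ _ (Finset.mem_univ s),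
    ← Finset.add_sum_erase Finset.univ (fun r => (Pi.single (σ r) (1 : ℤ) : Fin N → ℤ))
      (Finset.mem_univ s)]
  rw [Finset.sum_congr rfl (g := fun r => (Pi.single (σ r) (1 : ℤ) : Fin N → ℤ))]
  · rw [Function.update_self]; abel
  · intro r hr
    rw [Function.update_of_ne (Finset.ne_of_mem_erase hr)]

lemma Xop_content (j : ℕ) (a b : Fin N) (f : (S → Fin N) → ℂ[X]) (μ : Fin N → ℤ)
    (hf : ∀ σ, zcnt σ ≠ μ → f σ = 0) (σ) (hσ : zcnt σ ≠ μ + (Pi.single b 1 - Pi.single a 1)) :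
    Xop z K j a b f σ = 0 := by
  have hB : Bop (ws z) b a f σ = 0 := by
    rw [Bop_apply]
    refine Finset.sum_eq_zero fun s _ => ?_
    rw [ee_apply]
    split_ifs with h
    · rw [hf, mul_zero]
      intro h'
      rw [zcnt_update, h] at h'
      apply hσ
      rw [← h']; abel
    · simp
  by_cases h : a = b
  · subst h
    simp only [sub_self, add_zero] at hσ
    simp [Xop, nab_apply, hB, hf σ hσ]
  · simp [Xop, hB, h]

def Cm (m : Fin N → ℕ) : Finset (S → Fin N) := Finset.univ.filter fun σ => ∀ a, cnt σ a = m a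

lemma mem_Cm (m : Fin N → ℕ) (σ : S → Fin N) : σ ∈ Cm m ↔ zcnt σ = fun a => (m a : ℤ) := by
  simp only [Cm, Finset.mem_filter, Finset.mem_univ, true_and, funext_iff, zcnt, Nat.cast_inj]

lemma Dhat_content (m : Fin N → ℕ) (f : (S → Fin N) → ℂ[X]) (hf : ∀ σ ∉ Cm m, f σ = 0)
    (σ) (hσ : σ ∉ Cm m) : Dhat z K f σ = 0 := by
  rw [Dhat_apply]
  refine Finset.sum_eq_zero fun π _ => ?_
  have := ofFn_filtr (fun i (x : (S → Fin N) → ℂ[X]) => ∀ σ,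
      zcnt σ ≠ (fun a => (m a : ℤ)) + Sd (fun r : Fin N => (Pi.single (π r) 1 - Pi.single r 1 : Fin N → ℤ)) i
      → x σ = 0) (fun r : Fin N => Xop z K (N - 1 - r) r (π r)) ?_ f ?_ σ ?_
  · rw [this, smul_zero]
  · intro r x hx σ hσ
    rw [Sd_step, ← add_assoc] at hσ
    exact Xop_content z K _ _ _ x _ hx σ hσ
  · intro σ hσ
    rw [Sd_zero, add_zero] at hσ
    exact hf σ (by rwa [mem_Cm])
  · rw [Sd_all, Finset.sum_sub_distrib, Equiv.sum_comp π (fun r => (Pi.single r 1 : Fin N → ℤ)),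
      sub_self, add_zero]
    rwa [mem_Cm] at hσ

lemma supp_of_weight (m : Fin N → ℕ) (φ : (S → Fin N) → ℂ) (hm : ∀ a, Etot a a φ = (m a : ℂ) • φ)
    (σ) (hσ : σ ∉ Cm m) : φ σ = 0 := by
  by_contra hne
  apply hσ
  simp only [Cm, Finset.mem_filter, Finset.mem_univ, true_and]
  intro a
  have := congrFun (hm a) σ
  rw [Etot_diag] at this
  have := mul_right_cancel₀ hne this
  exact_mod_cast this

lemma weight_of_supp (m : Fin N → ℕ) (φ : (S → Fin N) → ℂ) (h : ∀ σ ∉ Cm m, φ σ = 0) (a : Fin N) :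
    Etot a a φ = (m a : ℂ) • φ := by
  funext σ
  rw [Etot_diag]
  by_cases hσ : σ ∈ Cm m
  · simp only [Cm, Finset.mem_filter, Finset.mem_univ, true_and] at hσ
    simp [hσ a]
  · simp [h σ hσ]

/-! ### low symbol -/

lemma low_symbol (u0 : ℂ) (p : ℕ) (hp : N ≤ p) (f f1 : (S → Fin N) → ℂ[X])
    (hf : ∀ σ, f σ = (X - C u0) ^ p * f1 σ) :
    ∃ g : (S → Fin N) → ℂ[X], (∀ σ, Dhat z K f σ = (X - C u0) ^ (p - N) * g σ) ∧
      ∀ σ, (g σ).eval u0 = (∏ r : Fin N, ((p - (N - 1 - r) : ℕ) * (wz z).eval u0 : ℂ)) * (f1 σ).eval u0 := by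
  set R : ℕ → ((S → Fin N) → ℂ[X]) → ((S → Fin N) → ℂ) → Prop := fun i x ψ =>
    ∃ x1 : (S → Fin N) → ℂ[X], (∀ σ, x σ = (X - C u0) ^ (p - i) * x1 σ) ∧
      ∀ σ, (x1 σ).eval u0 = ψ σ with hR
  have key : ∀ π : Equiv.Perm (Fin N), R N
      ((List.ofFn fun r : Fin N => Xop z K (N - 1 - r) r (π r)).prod f)
      ((List.ofFn fun r : Fin N => ((if r = π r then ((p - (N - 1 - r) : ℕ) * (wz z).eval u0 : ℂ) else 0) •
        (1 : Module.End ℂ ((S → Fin N) → ℂ)))).prod fun σ => (f1 σ).eval u0) := by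
    intro π
    refine ofFn_rel R _ _ ?_ f _ ⟨f1, fun σ => by simpa using hf σ, fun σ => rfl⟩
    rintro r x ψ ⟨x1, hx, hx1⟩
    have hr := r.2
    obtain ⟨q, hq1, hq2⟩ : ∃ q, p - (N - 1 - r) = q + 1 ∧ p - (N - r) = q :=
      ⟨p - (N - r), by omega, rfl⟩
    rw [hq1] at hx
    rw [hR]
    simp only [hq1, hq2]
    have hB : ∀ σ, Bop (ws z) (π r) r x σ = (X - C u0) ^ q * ((X - C u0) * Bop (ws z) (π r) r x1 σ) := by
      intro σ
      simp only [Bop_apply, Finset.mul_sum]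
      refine Finset.sum_congr rfl fun s _ => ?_
      simp only [ee_apply]
      split_ifs
      · rw [hx]; ring
      · simp
    by_cases h : r = π r
    · refine ⟨fun σ => ((q + 1 : ℕ) : ℂ[X]) * wz z * x1 σ + (X - C u0) * (wz z * derivative (x1 σ)
        - C (K r) * wz z * x1 σ - ((N - 1 - r : ℕ) : ℂ[X]) * derivative (wz z) * x1 σ
        - Bop (ws z) (π r) r x1 σ), fun σ => ?_, fun σ => ?_⟩
      · rw [Xop, if_pos h, LinearMap.sub_apply, Pi.sub_apply, hB, nab_apply, hx]
        simp only [derivative_mul, derivative_pow, derivative_sub, derivative_X, derivative_C,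
          Nat.add_sub_cancel, C_eq_natCast]
        push_cast
        ring
      · simp only [if_pos h, LinearMap.smul_apply, Module.End.one_apply, Pi.smul_apply, smul_eq_mul,
          ← hx1]
        simp
    · refine ⟨fun σ => - ((X - C u0) * Bop (ws z) (π r) r x1 σ), fun σ => ?_, fun σ => ?_⟩
      · rw [Xop, if_neg h, LinearMap.sub_apply, Pi.sub_apply, hB]
        simp
      · simp [h]
  choose g hg1 hg2 using key
  refine ⟨fun σ => ∑ π : Equiv.Perm (Fin N), ((Equiv.Perm.sign π : ℤˣ) : ℤ) • g π σ,
    fun σ => ?_, fun σ => ?_⟩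
  · rw [Dhat_apply, Finset.mul_sum]
    refine Finset.sum_congr rfl fun π _ => ?_
    rw [hg1, mul_smul_comm]
  · rw [eval_finset_sum, Finset.sum_eq_single 1]
    · rw [Equiv.Perm.sign_one, Units.val_one, one_smul, hg2,
        ofFn_eig _ (fun r : Fin N => ((p - (N - 1 - r) : ℕ) * (wz z).eval u0 : ℂ))]
      · rfl
      · intro r
        simp
    · intro π _ hπ
      obtain ⟨r, hr⟩ : ∃ r, π r ≠ r := by
        by_contra h
        push Not at h
        exact hπ (Equiv.ext h)
      rw [zsmul_eq_mul, eval_mul, hg2,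
        ofFn_eig _ (fun r : Fin N => if r = π r then ((p - (N - 1 - r) : ℕ) * (wz z).eval u0 : ℂ) else 0),
        Finset.prod_eq_zero (Finset.mem_univ r) (if_neg (Ne.symm hr))]
      · simp
      · intro r
        simp only [LinearMap.smul_apply, Module.End.one_apply]
    · intro h; exact absurd (Finset.mem_univ _) h

lemma low_exact (u0 : ℂ) (hu : (wz z).eval u0 ≠ 0) (f : (S → Fin N) → ℂ[X])
    (hf : ∀ σ, (X - C u0) ^ N ∣ f σ) (hne : f ≠ 0) :
    ∃ (q : ℕ) (f1 g : (S → Fin N) → ℂ[X]) (κ : ℂ), κ ≠ 0 ∧ (∀ σ, f1 σ ∣ f σ) ∧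
      (∀ σ, f σ = 0 → f1 σ = 0) ∧
      (∃ σ, (f1 σ).eval u0 ≠ 0) ∧ (∀ σ, Dhat z K f σ = (X - C u0) ^ q * g σ) ∧
      ∀ σ, (g σ).eval u0 = κ * (f1 σ).eval u0 := by
  have hex : ∃ p, ∃ σ, f σ ≠ 0 ∧ ¬ (X - C u0) ^ (p + 1) ∣ f σ := by
    obtain ⟨σ, hσ⟩ : ∃ σ, f σ ≠ 0 := by
      by_contra h; push Not at h; exact hne (funext h)
    refine ⟨rootMultiplicity u0 (f σ), σ, hσ, ?_⟩
    rw [← le_rootMultiplicity_iff hσ]; omega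
  classical
  obtain ⟨σ, hσ, hσ2⟩ := Nat.find_spec hex
  have hmin : ∀ τ, (X - C u0) ^ Nat.find hex ∣ f τ := by
    intro τ
    by_cases hτ : f τ = 0
    · rw [hτ]; exact dvd_zero _
    by_contra h
    rcases Nat.eq_zero_or_pos (Nat.find hex) with h0 | h0
    · rw [h0] at h; simp at h
    · refine Nat.find_min hex (m := Nat.find hex - 1) (by omega) ⟨τ, hτ, ?_⟩
      rwa [Nat.sub_add_cancel h0]
  set p := Nat.find hex
  have hpN : N ≤ p := by
    by_contra h
    exact hσ2 ((pow_dvd_pow _ (by omega)).trans (hf σ))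
  choose f1 hf1 using hmin
  obtain ⟨g, hg1, hg2⟩ := low_symbol z K u0 p hpN f f1 hf1
  refine ⟨p - N, f1, g, _, ?_, fun τ => ⟨_, (hf1 τ).trans (mul_comm _ _)⟩, fun τ hτ => ?_,
    ⟨σ, fun h3 => hσ2 ?_⟩, hg1, hg2⟩
  · rw [Finset.prod_ne_zero_iff]
    intro r _
    refine mul_ne_zero ?_ hu
    have := r.2
    have h5 : p - (N - 1 - r) ≠ 0 := by omega
    exact_mod_cast h5
  · have := hf1 τ
    rw [hτ] at this
    exact (mul_eq_zero.1 this.symm).resolve_left (pow_ne_zero _ (X_sub_C_ne_zero _))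
  · rw [hf1 σ, pow_succ]
    exact mul_dvd_mul_left _ (dvd_iff_isRoot.2 h3)

lemma low_inj (u0 : ℂ) (hu : (wz z).eval u0 ≠ 0) (f : (S → Fin N) → ℂ[X])
    (hf : ∀ σ, (X - C u0) ^ N ∣ f σ) (hD : Dhat z K f = 0) : f = 0 := by
  by_contra hne
  obtain ⟨q, f1, g, κ, hκ, _, _, ⟨σ, hσ⟩, h1, h2⟩ := low_exact z K u0 hu f hf hne
  have h3 : g σ = 0 := by
    have := h1 σ
    rw [hD, Pi.zero_apply] at this
    exact (mul_eq_zero.1 this.symm).resolve_left (pow_ne_zero _ (X_sub_C_ne_zero _))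
  have h4 := h2 σ
  rw [h3, eval_zero] at h4
  exact (mul_ne_zero hκ hσ) h4.symm

end Sym
end GaudinModel

set_option linter.all false
set_option linter.unusedSectionVars false
set_option linter.unusedSimpArgs false
namespace GaudinModel
open Polynomial

section Alg
variable {S : Type*} [Fintype S] [DecidableEq S] {N : ℕ} (z : S → ℂ) (K : Fin N → ℂ)

/-- The vector `g(u) v`. -/
def gv (v : (S → Fin N) → ℂ) : ℂ[X] →ₗ[ℂ] ((S → Fin N) → ℂ[X]) where
  toFun g σ := C (v σ) * g
  map_add' x y := by funext σ; simp [mul_add]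
  map_smul' c x := by funext σ; simp

lemma gv_apply (v : (S → Fin N) → ℂ) (g : ℂ[X]) (σ) : gv v g σ = C (v σ) * g := rfl

/-- exact top symbol -/
lemma top_exact (f : (S → Fin N) → ℂ[X]) (hne : f ≠ 0) :
    ∃ e : ℕ, HasTop f e (fun σ => (f σ).coeff e) ∧ ∃ σ, (f σ).coeff e ≠ 0 := by
  obtain ⟨σ0, hσ0⟩ : ∃ σ, f σ ≠ 0 := by
    by_contra h; push Not at h; exact hne (funext h)
  obtain ⟨σ, hσ, hmax⟩ := Finset.exists_max_image (Finset.univ.filter fun σ => f σ ≠ 0)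
    (fun σ => (f σ).natDegree) ⟨σ0, by simpa using hσ0⟩
  simp only [Finset.mem_filter, Finset.mem_univ, true_and] at hσ hmax
  refine ⟨(f σ).natDegree, hasTop_of_deg f _ fun τ i hi => ?_, σ, leadingCoeff_ne_zero.2 hσ⟩
  by_cases hτ : f τ = 0
  · simp [hτ]
  · exact coeff_eq_zero_of_natDegree_lt (lt_of_le_of_lt (hmax τ hτ) hi)

lemma deg_eq_i (hK : Function.Injective K) (m : Fin N → ℕ) (a : Fin N)
    (f : (S → Fin N) → ℂ[X]) (hf : ∀ σ ∉ Cm m, f σ = 0)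
    (hD : ∀ k : ℤ, ∀ φ : (S → Fin N) → ℂ, HasTop (Dhat z (fun b => K b - K a) f) k φ →
      (∀ σ, f σ = 0 → φ σ = 0) → φ = 0)
    (hne : f ≠ 0) : 
    HasTop f (m a) (fun σ => (f σ).coeff (m a)) ∧ ∃ σ, (f σ).coeff (m a) ≠ 0 := by
  obtain ⟨e, he, σ, hσ⟩ := top_exact f hne
  have hw := weight_of_supp m (fun σ => (f σ).coeff e) (fun σ hσ => by simp [hf σ hσ]) a
  have ht := top_i_eig z (fun b => K b - K a) a (sub_self _) f e _ he _ hw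
  have h0 := congrFun (hD _ _ ht (fun τ hτ => by simp [hτ])) σ
  simp only [Pi.smul_apply, smul_eq_mul, Pi.zero_apply] at h0
  have h1 := (mul_eq_zero.1 h0).resolve_right hσ
  have h2 : ∏ b ∈ Finset.univ.erase a, (-(K b - K a)) ≠ 0 := by
    rw [Finset.prod_ne_zero_iff]
    intro b hb
    rw [neg_ne_zero, sub_ne_zero]
    exact fun h => Finset.ne_of_mem_erase hb (hK h)
  have h3 := (mul_eq_zero.1 h1).resolve_right h2
  have h4 : e = m a := by
    have := sub_eq_zero.1 h3
    exact_mod_cast this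
  subst h4
  exact ⟨he, σ, hσ⟩

lemma alg_i (hN : 2 ≤ N) (hK : Function.Injective K) (m : Fin N → ℕ) (a : Fin N)
    (v : (S → Fin N) → ℂ) (hv : ∀ b, Etot b b v = (m b : ℂ) • v) (c0 : S → Fin N) (hc0 : v c0 ≠ 0)
    (hprop : ∀ (g : ℂ[X]) c, C (v c0) * Dhat z (fun b => K b - K a) (gv v g) c =
      C (v c) * Dhat z (fun b => K b - K a) (gv v g) c0) :
    ∃ g : ℂ[X], g ≠ 0 ∧ g.natDegree = m a ∧ Dhat z (fun b => K b - K a) (gv v g) = 0 := by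
  set K' : Fin N → ℂ := fun b => K b - K a with hK'
  set d := 1 + Fintype.card S with hd
  have hvs := supp_of_weight m v hv
  have hcount := count_all hN K' z (Cm m) 1 d le_rfl (fun z f => Dhat_content z K' m f)
    (fun z f e => deg_i z K' a (sub_self _) f e)
  rw [one_mul] at hcount
  set W := LinearMap.ker (Dhat z K' ∘ₗ emb (Cm m) d)
  let T : W →ₗ[ℂ] ({σ : S → Fin N // σ ∈ Cm m} → ℂ) :=
    (LinearMap.pi fun σ => Polynomial.lcoeff ℂ (m a) ∘ₗ LinearMap.proj σ.1 ∘ₗ emb (Cm m) d) ∘ₗ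
      W.subtype
  have hTap : ∀ (x : W) (σ : {σ : S → Fin N // σ ∈ Cm m}), T x σ = (emb (Cm m) d x.1 σ.1).coeff (m a) := fun x σ => rfl
  have hTinj : Function.Injective T := by
    rw [← LinearMap.ker_eq_bot, LinearMap.ker_eq_bot']
    intro x hx
    by_contra hne
    have h1 : emb (Cm m) d x.1 ≠ 0 := by
      intro h
      exact hne (Subtype.ext (emb_inj (Cm m) d (h.trans (map_zero _).symm)))
    obtain ⟨_, σ, hσ⟩ := deg_eq_i z K hK m a (emb (Cm m) d x.1) (emb_supp (Cm m) d x.1) (by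
      intro k φ hφ _
      have h2 : Dhat z K' (emb (Cm m) d x.1) = 0 := x.2
      rw [← hK', h2] at hφ
      funext σ
      rw [← (hφ σ).2, Pi.zero_apply, zc_zero]; rfl) h1
    by_cases hs : σ ∈ Cm m
    · exact hσ (by rw [← hTap x ⟨σ, hs⟩, hx]; rfl)
    · exact hσ (by rw [emb_supp (Cm m) d x.1 σ hs, coeff_zero])
  have hfin : Module.finrank ℂ ({σ : S → Fin N // σ ∈ Cm m} → ℂ) = (Cm m : Finset (S → Fin N)).card := by
    simp
  have hle := LinearMap.finrank_le_finrank_of_injective hTinj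
  have hTsurj : Function.Surjective T :=
    (LinearMap.injective_iff_surjective_of_finrank_eq_finrank (by omega)).1 hTinj
  obtain ⟨x, hx⟩ := hTsurj fun σ => v σ
  set f := emb (Cm m) d x.1 with hf
  have hfD : Dhat z K' f = 0 := x.2
  have hfs : ∀ σ ∉ Cm m, f σ = 0 := emb_supp (Cm m) d x.1
  have hfc : ∀ σ, (f σ).coeff (m a) = v σ := by
    intro σ
    by_cases hs : σ ∈ Cm m
    · rw [← hTap x ⟨σ, hs⟩, hx]
    · rw [hfs σ hs, hvs σ hs, coeff_zero]
  set g : ℂ[X] := C (v c0)⁻¹ * f c0 with hg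
  set y := f - gv v g with hy
  have hyc0 : y c0 = 0 := by
    rw [hy, Pi.sub_apply, gv_apply, hg, ← mul_assoc, ← C_mul, mul_inv_cancel₀ hc0, C_1, one_mul,
      sub_self]
  have hys : ∀ σ ∉ Cm m, y σ = 0 := by
    intro σ hσ
    rw [hy, Pi.sub_apply, gv_apply, hfs σ hσ, hvs σ hσ]; simp
  have hDy : Dhat z K' y = - Dhat z K' (gv v g) := by rw [hy, map_sub, hfD, zero_sub]
  have hyc : ∀ σ, (y σ).coeff (m a) = 0 := by
    intro σ
    rw [hy, Pi.sub_apply, gv_apply, hg, coeff_sub, coeff_C_mul, coeff_C_mul, hfc, hfc]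
    field_simp
    ring
  have hy0 : y = 0 := by
    by_contra hne
    suffices hD : ∀ k : ℤ, ∀ φ : (S → Fin N) → ℂ, HasTop (Dhat z (fun b => K b - K a) y) k φ →
        (∀ σ, y σ = 0 → φ σ = 0) → φ = 0 by
      obtain ⟨_, σ, hσ⟩ := deg_eq_i z K hK m a y hys hD hne
      exact hσ (hyc σ)
    · intro k φ hφ h0
      rw [← hK'] at hφ
      funext c
      have h1 := hprop g c
      have h2 : ∀ c, Dhat z K' (gv v g) c = - Dhat z K' y c := by
        intro c; rw [hDy]; simp
      rw [h2, h2] at h1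
      have h3 : C (v c0) * Dhat z K' y c = C (v c) * Dhat z K' y c0 := by
        linear_combination -h1
      have h4 := congrArg (fun p => zc p k) h3
      simp only [zc_Cmul, (hφ _).2, h0 c0 hyc0, mul_zero] at h4
      exact (mul_eq_zero.1 h4).resolve_left hc0
  have hfne : f ≠ 0 := by
    intro h
    have := hfc c0
    rw [h] at this
    exact hc0 (by simpa using this.symm)
  obtain ⟨htop, _⟩ := deg_eq_i z K hK m a f hfs (by
      intro k φ hφ _
      rw [← hK', hfD] at hφ
      funext σ
      rw [← (hφ σ).2, Pi.zero_apply, zc_zero]; rfl) hfne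
  have hgc : g.coeff (m a) ≠ 0 := by
    rw [hg, coeff_C_mul, hfc]; exact mul_ne_zero (inv_ne_zero hc0) hc0
  refine ⟨g, fun h => hgc (by simp [h]), ?_, ?_⟩
  · refine le_antisymm ?_ (le_natDegree_of_ne_zero hgc)
    rw [natDegree_le_iff_coeff_eq_zero]
    intro i hi
    have := (htop c0).1 i (by exact_mod_cast hi)
    rw [zc_nat] at this
    rw [hg, coeff_C_mul, this, mul_zero]
  · have : gv v g = f := by rw [hy, sub_eq_zero] at hy0; exact hy0.symm
    rw [this, hfD]

lemma dvd_of_taylor (u0 : ℂ) (p : ℂ[X]) (n : ℕ) (h : ∀ i < n, (taylor u0 p).coeff i = 0) :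
    (X - C u0) ^ n ∣ p := by
  have h1 : X ^ n ∣ taylor u0 p := X_pow_dvd_iff.2 h
  obtain ⟨q, hq⟩ := h1
  refine ⟨taylor (-u0) q, ?_⟩
  have := congrArg (taylor (-u0)) hq
  rw [taylor_taylor, neg_add_cancel, taylor_zero, taylor_mul, taylor_pow, taylor_X] at this
  simpa [sub_eq_add_neg] using this

lemma alg_ii (hN : 2 ≤ N) (hK : ∀ r, K r = 0) (m : Fin N → ℕ)
    (v : (S → Fin N) → ℂ) (hv : ∀ b, Etot b b v = (m b : ℂ) • v)
    (hs : ∀ a b, a < b → Etot a b v = 0) (c0 : S → Fin N) (hc0 : v c0 ≠ 0)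
    (hprop : ∀ (g : ℂ[X]) c, C (v c0) * Dhat z K (gv v g) c = C (v c) * Dhat z K (gv v g) c0) :
    ∃ p : Fin N → ℂ[X], (∀ i, p i ≠ 0 ∧ (p i).natDegree = m i + (N - 1 - i)) ∧
      (∀ i, Dhat z K (gv v (p i)) = 0) ∧
      ∀ (u : ℂ) (c : Fin N → ℂ), (wz z).eval u ≠ 0 →
        (X - C u) ^ N ∣ ∑ i, C (c i) * p i → c = 0 := by
  set d := N + Fintype.card S with hd
  have hcount := count_all hN K z Finset.univ N d le_rfl (fun z f _ σ h => absurd (Finset.mem_univ σ) h)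
    (fun z f e => deg_ii z K hK f e)
  set W := LinearMap.ker (Dhat z K ∘ₗ emb (Finset.univ : Finset (S → Fin N)) d)
  obtain ⟨u0, hu0⟩ : ∃ u0, (wz z).eval u0 ≠ 0 := by
    by_contra h
    push Not at h
    exact wz_ne_zero z (Polynomial.funext fun u => by simp [h u])
  let T : W →ₗ[ℂ] ((S → Fin N) → Fin N → ℂ) :=
    (LinearMap.pi fun σ => LinearMap.pi fun i : Fin N => Polynomial.lcoeff ℂ i ∘ₗ
      (taylor u0) ∘ₗ LinearMap.proj σ ∘ₗ emb Finset.univ d) ∘ₗ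
      W.subtype
  have hTap : ∀ (x : W) (σ : S → Fin N) (i : Fin N), T x σ i = (taylor u0 (emb Finset.univ d x.1 σ)).coeff i := fun x σ i => rfl
  have hTinj : Function.Injective T := by
    rw [← LinearMap.ker_eq_bot, LinearMap.ker_eq_bot']
    intro x hx
    refine Subtype.ext (emb_inj Finset.univ d ?_)
    rw [ZeroMemClass.coe_zero, map_zero]
    refine low_inj z K u0 hu0 _ (fun σ => dvd_of_taylor _ _ _ fun i hi => ?_) x.2
    rw [← hTap x σ ⟨i, hi⟩, hx]; rfl
  have hfin : Module.finrank ℂ ((S → Fin N) → Fin N → ℂ) =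
      N * (Finset.univ : Finset (S → Fin N)).card := by
    rw [Module.finrank_pi_fintype]; simp [mul_comm]
  have hle := LinearMap.finrank_le_finrank_of_injective hTinj
  have hTsurj : Function.Surjective T :=
    (LinearMap.injective_iff_surjective_of_finrank_eq_finrank (by omega)).1 hTinj
  let G : Submodule ℂ ℂ[X] := LinearMap.ker (Dhat z K ∘ₗ gv v)
  have hGmem : ∀ g, g ∈ G ↔ Dhat z K (gv v g) = 0 := fun g => Iff.rfl
  have hGlow : ∀ u, (wz z).eval u ≠ 0 → ∀ g ∈ G, (X - C u) ^ N ∣ g → g = 0 := by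
    intro u hu g hg hdv
    have := low_inj z K u hu (gv v g) (fun σ => Dvd.dvd.mul_left hdv _) hg
    have := congrFun this c0
    rw [gv_apply] at this
    exact (mul_eq_zero.1 this).resolve_left (by simpa using hc0)
  let J : G →ₗ[ℂ] (Fin N → ℂ) :=
    (LinearMap.pi fun i : Fin N => Polynomial.lcoeff ℂ i ∘ₗ (taylor u0)) ∘ₗ G.subtype
  have hJap : ∀ x i, J x i = (taylor u0 (x : ℂ[X])).coeff i := fun x i => rfl
  have hJinj : Function.Injective J := by
    rw [← LinearMap.ker_eq_bot, LinearMap.ker_eq_bot']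
    intro x hx
    refine Subtype.ext (hGlow u0 hu0 x x.2 (dvd_of_taylor _ _ _ fun i hi => ?_))
    rw [← hJap x ⟨i, hi⟩, hx]; rfl
  have hJsurj : Function.Surjective J := by
    intro c
    obtain ⟨x, hx⟩ := hTsurj fun σ i => c i * v σ
    set f := emb Finset.univ d x.1 with hf
    have hfD : Dhat z K f = 0 := x.2
    have hfc : ∀ σ (i : Fin N), (taylor u0 (f σ)).coeff i = c i * v σ := by
      intro σ i
      rw [← hTap x σ i, hx]
    set g : ℂ[X] := C (v c0)⁻¹ * f c0 with hg
    set y := f - gv v g with hy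
    have hyc0 : y c0 = 0 := by
      rw [hy, Pi.sub_apply, gv_apply, hg, ← mul_assoc, ← C_mul, mul_inv_cancel₀ hc0, C_1, one_mul,
        sub_self]
    have hDy : Dhat z K y = - Dhat z K (gv v g) := by rw [hy, map_sub, hfD, zero_sub]
    have hgc : ∀ i : Fin N, (taylor u0 g).coeff i = c i := by
      intro i
      rw [hg, taylor_mul, taylor_C, coeff_C_mul, hfc]
      field_simp
    have hyc : ∀ σ, (X - C u0) ^ N ∣ y σ := by
      intro σ
      refine dvd_of_taylor _ _ _ fun i hi => ?_
      rw [hy, Pi.sub_apply, gv_apply, map_sub, taylor_mul, taylor_C, coeff_sub, coeff_C_mul,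
        hfc σ ⟨i, hi⟩, hgc ⟨i, hi⟩]
      ring
    have hy0 : y = 0 := by
      by_contra hne
      obtain ⟨q, f1, h, κ, hκ, _, hz0, ⟨σ, hσ⟩, h1, h2⟩ := low_exact z K u0 hu0 y hyc hne
      have h3 := hprop g σ
      have h4 : ∀ c, Dhat z K (gv v g) c = - ((X - C u0) ^ q * h c) := by
        intro c; rw [← h1, hDy]; simp
      rw [h4, h4] at h3
      have h5 : C (v c0) * h σ = C (v σ) * h c0 := by
        apply mul_left_cancel₀ (pow_ne_zero q (X_sub_C_ne_zero u0))
        linear_combination -h3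
      have h6 := congrArg (eval u0) h5
      rw [eval_mul, eval_mul, eval_C, eval_C, h2, h2, hz0 c0 hyc0, eval_zero, mul_zero, mul_zero] at h6
      exact mul_ne_zero hc0 (mul_ne_zero hκ hσ) h6
    have hgG : g ∈ G := by
      rw [hGmem, ← neg_eq_zero, ← hDy, hy0, map_zero]
    exact ⟨⟨g, hgG⟩, funext fun i => hgc i⟩
  let Je : G ≃ₗ[ℂ] (Fin N → ℂ) := LinearEquiv.ofBijective J ⟨hJinj, hJsurj⟩
  haveI : FiniteDimensional ℂ G := Je.symm.finiteDimensional
  have hfG : Module.finrank ℂ G = N := by rw [Je.finrank_eq]; simp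
  -- degrees
  have hdeg : ∀ g ∈ G, g ≠ 0 → ∃ r : Fin N, g.natDegree = m r + (N - 1 - r) := by
    intro g hg hne
    have ht : HasTop (gv v g) (g.natDegree : ℕ) (g.leadingCoeff • v) := by
      intro σ
      refine ⟨fun i hi => ?_, ?_⟩
      · obtain ⟨j, rfl⟩ : ∃ j : ℕ, i = j := ⟨i.toNat, by omega⟩
        rw [gv_apply, zc_Cmul, zc_nat, coeff_eq_zero_of_natDegree_lt (by exact_mod_cast hi), mul_zero]
      · rw [gv_apply, zc_Cmul, zc_nat, Pi.smul_apply, smul_eq_mul, mul_comm]; rfl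
    have h1 := top_ii_sing z K hK (gv v g) _ _ ht (fun r => m r)
      (fun a => by rw [map_smul, hv, smul_comm]) (fun a b hab => by rw [map_smul, hs a b hab, smul_zero]) c0
    rw [(hGmem g).1 hg] at h1
    have h2 := h1.2
    rw [Pi.zero_apply, zc_zero, Pi.smul_apply, Pi.smul_apply, smul_eq_mul, smul_eq_mul] at h2
    have h3 := (mul_eq_zero.1 h2.symm).resolve_right (mul_ne_zero (leadingCoeff_ne_zero.2 hne) hc0)
    rw [Finset.prod_eq_zero_iff] at h3
    obtain ⟨r, _, hr⟩ := h3
    refine ⟨r, ?_⟩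
    have h4 : ((g.natDegree : ℕ) : ℂ) = ((m r + (N - 1 - r) : ℕ) : ℂ) := by
      push_cast at hr ⊢
      linear_combination hr
    exact_mod_cast h4
  let Q : G →ₗ[ℂ] (Fin N → ℂ) :=
    (LinearMap.pi fun r : Fin N => Polynomial.lcoeff ℂ (m r + (N - 1 - r))) ∘ₗ G.subtype
  have hQap : ∀ x (r : Fin N), Q x r = (x : ℂ[X]).coeff (m r + (N - 1 - r)) := fun x r => rfl
  have hQinj : Function.Injective Q := by
    rw [← LinearMap.ker_eq_bot, LinearMap.ker_eq_bot']
    intro x hx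
    by_contra hne
    have hne' : (x : ℂ[X]) ≠ 0 := fun h => hne (Subtype.ext h)
    obtain ⟨r, hr⟩ := hdeg x x.2 hne'
    have := congrFun hx r
    rw [hQap, ← hr] at this
    exact hne' (leadingCoeff_eq_zero.1 this)
  have hQsurj : Function.Surjective Q :=
    (LinearMap.injective_iff_surjective_of_finrank_eq_finrank (by rw [hfG]; simp)).1 hQinj
  choose p hp using fun a : Fin N => hQsurj (Pi.single a 1)
  have hpc : ∀ a (r : Fin N), (p a : ℂ[X]).coeff (m r + (N - 1 - r)) = (Pi.single a 1 : Fin N → ℂ) r :=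
    fun a r => by rw [← hQap, hp]
  have hpne : ∀ a, (p a : ℂ[X]) ≠ 0 := by
    intro a h
    have := hpc a a
    rw [h] at this
    simp at this
  refine ⟨fun a => p a, fun a => ⟨hpne a, ?_⟩, fun a => (p a).2, fun u c hu hdv => ?_⟩
  · obtain ⟨r, hr⟩ := hdeg (p a) (p a).2 (hpne a)
    have h1 := hpc a r
    rw [← hr] at h1
    have h2 : r = a := by
      by_contra h
      rw [Pi.single_eq_of_ne h] at h1
      exact hpne a (leadingCoeff_eq_zero.1 h1)
    rw [hr, h2]
  · have hmem : ∑ i, C (c i) * (p i : ℂ[X]) ∈ G := by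
      refine Submodule.sum_mem _ fun i _ => ?_
      rw [← smul_eq_C_mul]
      exact G.smul_mem _ (p i).2
    have h0 := hGlow u hu _ hmem hdv
    funext r
    have h1 := congrArg (fun q => q.coeff (m r + (N - 1 - r))) h0
    simp only [finset_sum_coeff, coeff_C_mul, hpc, coeff_zero] at h1
    simpa [Pi.single_apply] using h1

end Alg
end GaudinModel

set_option linter.all false
set_option linter.unusedSectionVars false
set_option linter.unusedSimpArgs false
namespace GaudinModel
open Polynomial

section Link

/-- `e^{-κu} ∂ e^{κu}` on polynomials. -/
def Lk (κ : ℂ) (g : ℂ[X]) : ℂ[X] := derivative g + C κ * g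

/-- `e^{κu} g(u)` -/
def qe (κ : ℂ) (g : ℂ[X]) : ℂ → ℂ := fun x => Complex.exp (κ * x) * g.eval x

lemma qe_hasDerivAt (κ : ℂ) (g : ℂ[X]) (u : ℂ) : HasDerivAt (qe κ g) (qe κ (Lk κ g) u) u := by
  have h1 : HasDerivAt (fun x => Complex.exp (κ * x)) (Complex.exp (κ * u) * κ) u := by
    have := ((hasDerivAt_id u).const_mul κ).cexp
    simpa using this
  have := h1.mul (g.hasDerivAt u)
  refine this.congr_deriv ?_
  simp only [qe, Lk, eval_add, eval_mul, eval_C]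
  ring

lemma qe_diff (κ : ℂ) (g : ℂ[X]) : Differentiable ℂ (qe κ g) :=
  fun u => (qe_hasDerivAt κ g u).differentiableAt

lemma qe_iter (κ : ℂ) (g : ℂ[X]) (k : ℕ) : iteratedDeriv k (qe κ g) = qe κ ((Lk κ)^[k] g) := by
  induction k with
  | zero => simp
  | succ k ih =>
    rw [iteratedDeriv_succ, ih, Function.iterate_succ_apply']
    funext u
    exact (qe_hasDerivAt κ _ u).deriv

lemma Lk_zero (g : ℂ[X]) (k : ℕ) : (Lk 0)^[k] g = derivative^[k] g := by
  have : Lk 0 = derivative := by funext g; simp [Lk]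
  rw [this]

variable {N n : ℕ} (V : Fin n → Type*) [∀ i, AddCommGroup (V i)] [∀ i, Module ℂ (V i)]
  (M : Type*) [NormedAddCommGroup M] [NormedSpace ℂ M] [FiniteDimensional ℂ M]
  (E : ∀ i : Fin n, Fin N → Fin N → (V i →ₗ[ℂ] V i))
  (φ : M ≃ₗ[ℂ] PiTensorProduct ℂ V)
  (z : Fin n → ℂ) (K : Fin N → ℂ)
  {S : Type*} [Fintype S] [DecidableEq S] (π : S → Fin n)
  (ι : M →ₗ[ℂ] ((S → Fin N) → ℂ)) (hinj : Function.Injective ι)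
  (hι : ∀ j a b x, ι (EE V M E φ j a b x) = ∑ s with π s = j, ee s a b (ι x))

/-- `F` is represented by the polynomial vector `e^{κu} f(u) / w(u)^j`. -/
def Repr (κ : ℂ) (F : ℂ → M) (f : (S → Fin N) → ℂ[X]) (j : ℕ) : Prop :=
  ∀ u, GoodG z u → ∀ σ, ι (F u) σ = Complex.exp (κ * u) * (f σ).eval u / (wz (z ∘ π)).eval u ^ j

lemma wz_good (u : ℂ) (hu : GoodG z u) : (wz (z ∘ π)).eval u ≠ 0 := by
  rw [wz, eval_prod, Finset.prod_ne_zero_iff]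
  intro s _
  simp only [eval_sub, eval_X, eval_C]
  exact sub_ne_zero.2 (hu (π s))

lemma good_open : IsOpen {u | GoodG z u} := by
  have : {u | GoodG z u} = ⋂ j, {z j}ᶜ := by
    ext u; simp [GoodG]
  rw [this]
  exact isOpen_iInter_of_finite fun j => isOpen_compl_singleton

lemma infinite_good : Set.Infinite {u | GoodG z u} := by
  have : {u | GoodG z u} = (Set.range z)ᶜ := by
    ext u; simp [GoodG, eq_comm]
  rw [this]
  exact (Set.finite_range z).infinite_compl

include hinj

lemma Repr_deriv (κ : ℂ) (F : ℂ → M) (f : (S → Fin N) → ℂ[X]) (j : ℕ)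
    (h : Repr M z π ι κ F f j) (u : ℂ) (hu : GoodG z u) (σ : S → Fin N) :
    ι (deriv F u) σ = Complex.exp (κ * u) * ((derivative (f σ)).eval u / (wz (z ∘ π)).eval u ^ j
      + κ * (f σ).eval u / (wz (z ∘ π)).eval u ^ j
      - j * (derivative (wz (z ∘ π))).eval u * (f σ).eval u / (wz (z ∘ π)).eval u ^ (j + 1)) := by
  obtain ⟨r, hr⟩ := ι.exists_leftInverse_of_injective (LinearMap.ker_eq_bot.2 hinj)
  have hw := wz_good z π u hu
  set w := wz (z ∘ π) with hwdef
  set G : ℂ → (S → Fin N) → ℂ := fun u σ => Complex.exp (κ * u) * (f σ).eval u / w.eval u ^ j with hG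
  set G' : (S → Fin N) → ℂ := fun σ => Complex.exp (κ * u) * ((derivative (f σ)).eval u / w.eval u ^ j
      + κ * (f σ).eval u / w.eval u ^ j
      - j * (derivative w).eval u * (f σ).eval u / w.eval u ^ (j + 1)) with hG'
  have hGd : HasDerivAt G G' u := by
    rw [hasDerivAt_pi]
    intro σ
    have h1 := (qe_hasDerivAt κ (f σ) u).div ((w.hasDerivAt u).pow j) (pow_ne_zero j hw)
    refine h1.congr_deriv ?_
    simp only [hG', qe, Lk, eval_add, eval_mul, eval_C, Pi.pow_apply]
    rcases j with _ | j
    · simp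
    · simp only [Nat.add_sub_cancel]
      field_simp
      push_cast
      try ring
  have hev : (fun x => ι (F x)) =ᶠ[nhds u] G := by
    filter_upwards [(good_open z).mem_nhds hu] with x hx
    funext σ
    exact h x hx σ
  have hFd : DifferentiableAt ℂ F u := by
    have h2 : F = fun x => (LinearMap.toContinuousLinearMap r) (ι (F x)) := by
      funext x
      exact (LinearMap.congr_fun hr (F x)).symm
    rw [h2]
    exact (LinearMap.toContinuousLinearMap r).differentiableAt.comp u
      (hGd.differentiableAt.congr_of_eventuallyEq hev)
  have h3 : HasDerivAt (fun x => ι (F x)) (ι (deriv F u)) u :=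
    (LinearMap.toContinuousLinearMap ι).hasFDerivAt.comp_hasDerivAt u hFd.hasDerivAt
  have h4 := h3.unique (hGd.congr_of_eventuallyEq hev)
  exact congrFun h4 σ

include hι

lemma Repr_X (κ : ℂ) (F : ℂ → M) (f : (S → Fin N) → ℂ[X]) (j : ℕ)
    (h : Repr M z π ι κ F f j) (a b : Fin N) :
    Repr M z π ι κ (Xg V M E φ z (Matrix.diagonal K) a b F)
      (Xop (z ∘ π) (fun c => K c - κ) j a b f) (j + 1) := by
  intro u hu σ
  have hd := Repr_deriv M z π ι hinj κ F f j h u hu σ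
  have hw := wz_good z π u hu
  have hsum : ι (∑ i : Fin n, (u - z i)⁻¹ • (EE V M E φ i b a) (F u)) σ =
      Complex.exp (κ * u) * (Bop (ws (z ∘ π)) b a f σ).eval u / (wz (z ∘ π)).eval u ^ (j + 1) := by
    rw [map_sum, Finset.sum_apply, Bop_apply, eval_finset_sum, Finset.mul_sum, Finset.sum_div]
    simp only [map_smul, hι, Pi.smul_apply, Finset.sum_apply, smul_eq_mul, Finset.mul_sum]
    rw [← Finset.sum_fiberwise (s := Finset.univ) (g := π)]
    refine Finset.sum_congr rfl fun i _ => Finset.sum_congr rfl fun s hs => ?_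
    have hs' : π s = i := by simpa using hs
    subst hs'
    have h1 : (wz (z ∘ π)).eval u = (u - z (π s)) * (ws (z ∘ π) s).eval u := by
      rw [wz_eq (z ∘ π) s]; simp
    have h2 : u - z (π s) ≠ 0 := sub_ne_zero.2 (hu _)
    have h3 : (ws (z ∘ π) s).eval u ≠ 0 := by
      intro h; rw [h1, h, mul_zero] at hw; exact hw rfl
    rw [ee_apply, ee_apply]
    split_ifs
    · rw [h u hu, h1, eval_mul]
      field_simp
      ring
    · simp
  rw [Xg, map_sub, map_sub, Pi.sub_apply, Pi.sub_apply, hsum, Xop, LinearMap.sub_apply, Pi.sub_apply,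
    eval_sub, mul_sub, sub_div, map_smul, Pi.smul_apply, h u hu]
  congr 1
  by_cases hab : a = b
  · subst hab
    rw [if_pos rfl, if_pos rfl, hd, Matrix.diagonal_apply_eq, nab_apply]
    simp only [eval_sub, eval_mul, eval_C, eval_natCast, smul_eq_mul]
    field_simp
    ring
  · rw [if_neg hab, if_neg hab, Matrix.diagonal_apply_ne _ hab]
    simp

lemma Repr_list (κ : ℂ) (m : ℕ) (A : Fin m → (ℂ → M) → (ℂ → M))
    (B : Fin m → Module.End ℂ ((S → Fin N) → ℂ[X]))
    (hAB : ∀ (k : Fin m) F f, Repr M z π ι κ F f (m - 1 - k) → Repr M z π ι κ (A k F) (B k f) (m - 1 - k + 1))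
    (F : ℂ → M) (f : (S → Fin N) → ℂ[X]) (h : Repr M z π ι κ F f 0) :
    Repr M z π ι κ ((List.ofFn A).foldr (· ∘ ·) id F) ((List.ofFn B).prod f) m := by
  induction m with
  | zero => simpa using h
  | succ m ih =>
    rw [List.ofFn_succ, List.ofFn_succ, List.foldr_cons, List.prod_cons]
    have := hAB 0 _ _ (by
      simpa using ih (fun i => A i.succ) (fun i => B i.succ) (fun k F f hF => by
        have := hAB k.succ F f
        have e : m + 1 - 1 - (k.succ : ℕ) = m - 1 - k := by
          rw [Fin.val_succ]; omega
        rw [e] at this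
        exact this hF))
    simpa using this

lemma Repr_D (κ : ℂ) (F : ℂ → M) (f : (S → Fin N) → ℂ[X])
    (h : Repr M z π ι κ F f 0) :
    Repr M z π ι κ (Dg V M E φ z (Matrix.diagonal K) F)
      (Dhat (z ∘ π) (fun c => K c - κ) f) N := by
  intro u hu σ
  rw [Dg, Dhat_apply, map_sum, Finset.sum_apply, eval_finset_sum, Finset.mul_sum, Finset.sum_div]
  refine Finset.sum_congr rfl fun τ _ => ?_
  have := Repr_list V M E φ z π ι hinj hι κ N (fun a => Xg V M E φ z (Matrix.diagonal K) a (τ a))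
    (fun k => Xop (z ∘ π) (fun c => K c - κ) (N - 1 - k) k (τ k))
    (fun k F f hF => Repr_X V M E φ z K π ι hinj hι κ F f _ hF k (τ k)) F f h u hu σ
  rw [map_zsmul, Pi.smul_apply, this, eval_smul]
  simp only [zsmul_eq_mul]
  ring

variable (𝒯 : ℕ → ℂ → Module.End ℂ M)
    (h𝒯 : ∀ f : ℂ → M, Differentiable ℂ f → ∀ u : ℂ, GoodG z u →
      Dg V M E φ z (Matrix.diagonal K) f u =
        ∑ k ∈ Finset.range (N + 1), ((-1 : ℤ) ^ k) • 𝒯 k u (iteratedDeriv (N - k) f u))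
    (v : M) (lam : ℕ → ℂ → ℂ)
    (heig : ∀ k ≤ N, ∀ u : ℂ, GoodG z u → 𝒯 k u v = lam k u • v)

include h𝒯 heig

lemma link (κ : ℂ) (g : ℂ[X]) (u : ℂ) (hu : GoodG z u) (σ : S → Fin N) :
    Dfund N lam (qe κ g) u * ι v σ * (wz (z ∘ π)).eval u ^ N =
      Complex.exp (κ * u) * (Dhat (z ∘ π) (fun c => K c - κ) (gv (ι v) g) σ).eval u := by
  have hw := wz_good z π u hu
  have h1 := Repr_D V M E φ z K π ι hinj hι κ (fun x => qe κ g x • v) (gv (ι v) g) (by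
    intro u hu σ
    rw [map_smul, Pi.smul_apply, gv_apply]
    simp [qe]
    ring) u hu σ
  rw [h𝒯 _ ((qe_diff κ g).smul_const v) u hu] at h1
  have h2 : ∑ k ∈ Finset.range (N + 1), ((-1 : ℤ) ^ k) •
      𝒯 k u (iteratedDeriv (N - k) (fun x => qe κ g x • v) u) = Dfund N lam (qe κ g) u • v := by
    rw [Dfund, Finset.sum_smul]
    refine Finset.sum_congr rfl fun k hk => ?_
    have hk' : k ≤ N := by simpa [Nat.lt_succ_iff] using hk
    have hc : ContDiffAt ℂ (N - k : ℕ) (qe κ g) u := (qe_diff κ g).contDiff.contDiffAt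
    rw [show (fun x => qe κ g x • v) = fun x => (qe κ g) x • v from rfl,
      iteratedDeriv_smul_const hc v, map_smul, heig k hk' u hu, ← Int.cast_smul_eq_zsmul ℂ,
      smul_smul, smul_smul]
    congr 1
    push_cast
    ring
  rw [h2, map_smul, Pi.smul_apply, smul_eq_mul, eq_div_iff (pow_ne_zero _ hw)] at h1
  exact h1

lemma link_prop (κ : ℂ) (g : ℂ[X]) (c0 c : S → Fin N) :
    C (ι v c0) * Dhat (z ∘ π) (fun c => K c - κ) (gv (ι v) g) c =
      C (ι v c) * Dhat (z ∘ π) (fun c => K c - κ) (gv (ι v) g) c0 := by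
  refine Polynomial.eq_of_infinite_eval_eq _ _
    ((infinite_good z).mono fun u hu => ?_)
  have h1 := link V M E φ z K π ι hinj hι 𝒯 h𝒯 v lam heig κ g u hu c
  have h0 := link V M E φ z K π ι hinj hι 𝒯 h𝒯 v lam heig κ g u hu c0
  have hw := wz_good z π u hu
  simp only [Set.mem_setOf_eq, eval_mul, eval_C]
  apply mul_left_cancel₀ (Complex.exp_ne_zero (κ * u))
  linear_combination (-(ι v c0)) * h1 + ι v c * h0

lemma link_zero (hv : v ≠ 0) (κ : ℂ) (g : ℂ[X])
    (hg : Dhat (z ∘ π) (fun c => K c - κ) (gv (ι v) g) = 0) (u : ℂ) (hu : GoodG z u) :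
    Dfund N lam (qe κ g) u = 0 := by
  have : ι v ≠ 0 := fun h => hv (hinj (h.trans (map_zero ι).symm))
  obtain ⟨c, hc⟩ := Function.ne_iff.1 this
  have h1 := link V M E φ z K π ι hinj hι 𝒯 h𝒯 v lam heig κ g u hu c
  have hw := wz_good z π u hu
  rw [hg, Pi.zero_apply, eval_zero, mul_zero] at h1
  exact (mul_eq_zero.1 ((mul_eq_zero.1 h1).resolve_right (pow_ne_zero _ hw))).resolve_right hc

lemma lam_zero (hv : v ≠ 0) (u : ℂ) (hu : GoodG z u) : lam 0 u = 1 := by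
  have : ι v ≠ 0 := fun h => hv (hinj (h.trans (map_zero ι).symm))
  obtain ⟨c, hc⟩ := Function.ne_iff.1 this
  have h1 := link V M E φ z K π ι hinj hι 𝒯 h𝒯 v lam heig 0 ((X - C u) ^ N) u hu c
  have hw := wz_good z π u hu
  obtain ⟨g, hg1, hg2⟩ := low_symbol (z ∘ π) (fun c => K c - 0) u N le_rfl (gv (ι v) ((X - C u) ^ N))
    (fun σ => C (ι v σ)) (fun σ => by rw [gv_apply, mul_comm])
  rw [hg1, Nat.sub_self, pow_zero, one_mul, hg2, Finset.prod_mul_distrib, Finset.prod_const,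
    Finset.card_univ, Fintype.card_fin, zero_mul, Complex.exp_zero, one_mul, eval_C] at h1
  have h2 : (∏ r : Fin N, ((N - (N - 1 - r) : ℕ) : ℂ)) = (N.factorial : ℂ) := by
    rw [← Finset.prod_range_add_one_eq_factorial, ← Fin.prod_univ_eq_prod_range (fun i => i + 1)]
    push_cast
    refine Finset.prod_congr rfl fun r _ => ?_
    have := r.2
    rw [show N - (N - 1 - (r : ℕ)) = r + 1 by omega]
    push_cast; rfl
  have h3 : Dfund N lam (qe 0 ((X - C u) ^ N)) u = lam 0 u * N.factorial := by
    rw [Dfund, Finset.sum_eq_single 0]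
    · rw [qe_iter, Lk_zero, Nat.sub_zero, iterate_derivative_X_sub_pow_self]
      simp [qe]
    · intro k hk hk0
      have hk' : k ≤ N := by simpa [Nat.lt_succ_iff] using hk
      rw [qe_iter, Lk_zero, iterate_derivative_X_sub_pow, Nat.sub_sub_self hk']
      simp [qe, hk0]
    · simp
  rw [h3, h2] at h1
  have hf : (N.factorial : ℂ) ≠ 0 := by exact_mod_cast N.factorial_ne_zero
  have : (lam 0 u - 1) * (N.factorial * (wz (z ∘ π)).eval u ^ N * ι v c) = 0 := by
    linear_combination h1
  rcases mul_eq_zero.1 this with h | h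
  · exact sub_eq_zero.1 h
  · exact absurd h (mul_ne_zero (mul_ne_zero hf (pow_ne_zero _ hw)) hc)

end Link
end GaudinModel

set_option linter.all false
set_option linter.unusedSectionVars false
set_option linter.unusedSimpArgs false
namespace GaudinModel
open Polynomial

section Span

lemma det_diff {N : ℕ} (A : ℂ → Matrix (Fin N) (Fin N) ℂ) (u : ℂ)
    (h : ∀ i j, DifferentiableAt ℂ (fun x => A x i j) u) :
    DifferentiableAt ℂ (fun x => (A x).det) u := by
  simp only [Matrix.det_apply']
  refine DifferentiableAt.fun_sum fun σ _ => ?_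
  refine (differentiableAt_const _).mul ?_
  exact DifferentiableAt.fun_finset_prod fun i _ => h _ _

lemma deriv_iter_diff (f : ℂ → ℂ) (u : ℂ) (h : AnalyticAt ℂ f u) (k : ℕ) :
    HasDerivAt (iteratedDeriv k f) (iteratedDeriv (k + 1) f u) u := by
  rw [iteratedDeriv_succ]
  have h1 : AnalyticAt ℂ (iteratedDeriv k f) u := by
    rw [iteratedDeriv_eq_iterate]
    exact h.iterated_deriv k
  exact h1.differentiableAt.hasDerivAt

lemma span_lemma {N : ℕ} (hN : 2 ≤ N) (lam : ℕ → ℂ → ℂ) (P : Fin N → ℂ → ℂ)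
    (hP : ∀ i, Differentiable ℂ (P i)) (U : Set ℂ) (hU : IsOpen U) (hUc : IsPreconnected U)
    (hPD : ∀ i, ∀ u ∈ U, Dfund N lam (P i) u = 0) (hlam : ∀ u ∈ U, lam 0 u = 1)
    (u1 : ℂ) (hu1 : u1 ∈ U)
    (hdet : (Matrix.of fun j i : Fin N => iteratedDeriv j (P i) u1).det ≠ 0)
    (f : ℂ → ℂ) (hf : DifferentiableOn ℂ f U) (hfD : ∀ u ∈ U, Dfund N lam f u = 0) :
    ∃ c : Fin N → ℂ, ∀ u ∈ U, f u = ∑ i, c i * P i u := by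
  have hfan := hf.analyticOnNhd hU
  have hPan : ∀ i u, AnalyticAt ℂ (P i) u := fun i u => (hP i).analyticAt u
  set W : ℂ → Matrix (Fin N) (Fin N) ℂ := fun u => Matrix.of fun j i => iteratedDeriv j (P i) u with hW
  set b : ℂ → Fin N → ℂ := fun u j => iteratedDeriv j f u with hb
  have hWd : ∀ u j i, HasDerivAt (fun x => W x j i) (iteratedDeriv (j + 1) (P i) u) u :=
    fun u j i => deriv_iter_diff _ u (hPan i u) j
  have hbd : ∀ u ∈ U, ∀ j, HasDerivAt (fun x => b x j) (iteratedDeriv (j + 1) f u) u :=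
    fun u hu j => deriv_iter_diff _ u (hfan u hu) j
  have hdd : ∀ u, DifferentiableAt ℂ (fun x => (W x).det) u :=
    fun u => det_diff W u fun j i => (hWd u j i).differentiableAt
  obtain ⟨ε, hε, hball⟩ : ∃ ε > 0, Metric.ball u1 ε ⊆ U ∩ {u | (W u).det ≠ 0} := by
    apply Metric.mem_nhds_iff.1
    exact Filter.inter_mem (hU.mem_nhds hu1) ((hdd u1).continuousAt.eventually_ne hdet)
  set B := Metric.ball u1 ε with hB
  have hBU : ∀ u ∈ B, u ∈ U := fun u hu => (hball hu).1
  have hBd : ∀ u ∈ B, (W u).det ≠ 0 := fun u hu => (hball hu).2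
  set c : Fin N → ℂ → ℂ := fun i u => (W u).cramer (b u) i / (W u).det with hc
  have hcd : ∀ i, ∀ u ∈ B, DifferentiableAt ℂ (c i) u := by
    intro i u hu
    refine DifferentiableAt.div ?_ (hdd u) (hBd u hu)
    simp only [Matrix.cramer_apply]
    refine det_diff _ u fun j k => ?_
    by_cases hk : k = i
    · subst hk
      simp only [Matrix.updateCol_self]
      exact (hbd u (hBU u hu) j).differentiableAt
    · simp only [Matrix.updateCol_ne hk]
      exact (hWd u j k).differentiableAt
  have hsol : ∀ u ∈ B, ∀ j : Fin N, ∑ i, W u j i * c i u = b u j := by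
    intro u hu j
    have h1 := congrFun (Matrix.mulVec_cramer (W u) (b u)) j
    rw [Matrix.mulVec, dotProduct, Pi.smul_apply, smul_eq_mul] at h1
    have h2 := hBd u hu
    simp only [hc, ← mul_div_assoc]
    rw [← Finset.sum_div, h1, mul_div_cancel_left₀ _ h2]
  have hode : ∀ g : ℂ → ℂ, ∀ u ∈ U, Dfund N lam g u = 0 → iteratedDeriv N g u =
      - ∑ k ∈ Finset.range N, (-1 : ℂ) ^ (k + 1) * lam (k + 1) u * iteratedDeriv (N - (k + 1)) g u := by
    intro g u hu h
    rw [Dfund, Finset.sum_range_succ'] at h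
    simp only [pow_zero, hlam u hu, mul_one, one_mul, Nat.sub_zero] at h
    linear_combination h
  have hsolN : ∀ u ∈ B, ∑ i, iteratedDeriv N (P i) u * c i u = iteratedDeriv N f u := by
    intro u hu
    rw [hode f u (hBU u hu) (hfD u (hBU u hu))]
    rw [Finset.sum_congr rfl fun i _ => by rw [hode (P i) u (hBU u hu) (hPD i u (hBU u hu))]]
    simp only [neg_mul, Finset.sum_neg_distrib, Finset.sum_mul]
    rw [Finset.sum_comm]
    congr 1
    refine Finset.sum_congr rfl fun k hk => ?_
    have hk' := Finset.mem_range.1 hk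
    have h1 := hsol u hu ⟨N - (k + 1), by omega⟩
    simp only [hb, hW, Matrix.of_apply] at h1
    rw [← h1, Finset.mul_sum]
    exact Finset.sum_congr rfl fun i _ => by ring
  have hsolS : ∀ u ∈ B, ∀ j : Fin N, ∑ i, iteratedDeriv (j + 1) (P i) u * c i u =
      iteratedDeriv (j + 1) f u := by
    intro u hu j
    by_cases hj : (j : ℕ) + 1 < N
    · exact hsol u hu ⟨j + 1, hj⟩
    · have : (j : ℕ) + 1 = N := by omega
      rw [this]
      exact hsolN u hu
  have hc0 : ∀ u ∈ B, ∀ i, deriv (c i) u = 0 := by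
    intro u hu
    have h1 : (W u).mulVec (fun i => deriv (c i) u) = 0 := by
      funext j
      have h2 : HasDerivAt (fun x => ∑ i, W x j i * c i x)
          (∑ i, (iteratedDeriv (j + 1) (P i) u * c i u + W u j i * deriv (c i) u)) u :=
        HasDerivAt.fun_sum fun i _ => (hWd u j i).mul (hcd i u hu).hasDerivAt
      have h3 : (fun x => ∑ i, W x j i * c i x) =ᶠ[nhds u] fun x => b x j := by
        filter_upwards [Metric.isOpen_ball.mem_nhds hu] with x hx
        exact hsol x hx j
      have h4 := h2.unique ((hbd u (hBU u hu) j).congr_of_eventuallyEq h3)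
      rw [Finset.sum_add_distrib, hsolS u hu j] at h4
      simpa [Matrix.mulVec, dotProduct] using h4
    by_contra hne
    push Not at hne
    obtain ⟨i, hi⟩ := hne
    exact hBd u hu (Matrix.exists_mulVec_eq_zero_iff.1 ⟨fun i => deriv (c i) u, fun h => hi (congrFun h i), h1⟩)
  have hcc : ∀ u ∈ B, ∀ i, c i u = c i u1 := by
    intro u hu i
    refine Metric.isOpen_ball.is_const_of_deriv_eq_zero (convex_ball u1 ε).isPreconnected
      (fun x hx => (hcd i x hx).differentiableWithinAt) (fun x hx => hc0 x hx i) hu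
      (Metric.mem_ball_self hε)
  refine ⟨fun i => c i u1, ?_⟩
  have hR : AnalyticOnNhd ℂ (fun u => ∑ i, c i u1 * P i u) U := by
    refine DifferentiableOn.analyticOnNhd ?_ hU
    exact fun x _ => (DifferentiableAt.fun_sum fun i _ =>
      ((hP i x).const_mul _)).differentiableWithinAt
  refine fun u hu => hfan.eqOn_of_preconnected_of_eventuallyEq hR hUc hu1 ?_ hu
  filter_upwards [Metric.ball_mem_nhds u1 hε] with x hx
  have h1 := hsol x hx ⟨0, by omega⟩
  simp only [hb, hW, Matrix.of_apply, iteratedDeriv_zero] at h1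
  rw [← h1]
  exact Finset.sum_congr rfl fun i _ => by rw [hcc x hx i, mul_comm]

lemma coeff_prod_le {ι : Type*} [DecidableEq ι] (s : Finset ι) (q : ι → ℂ[X]) (m : ι → ℕ)
    (h : ∀ i ∈ s, (q i).natDegree ≤ m i) :
    (∏ i ∈ s, q i).natDegree ≤ ∑ i ∈ s, m i ∧
    (∏ i ∈ s, q i).coeff (∑ i ∈ s, m i) = ∏ i ∈ s, (q i).coeff (m i) := by
  induction s using Finset.induction_on with
  | empty => simp
  | insert a s ha ih =>
    obtain ⟨h1, h2⟩ := ih fun i hi => h i (Finset.mem_insert_of_mem hi)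
    have h3 := h a (Finset.mem_insert_self _ _)
    simp only [Finset.prod_insert ha, Finset.sum_insert ha]
    refine ⟨natDegree_mul_le.trans (add_le_add h3 h1), ?_⟩
    rw [coeff_mul_add_eq_of_natDegree_le h3 h1, h2]

lemma Lk_iter_deg (κ : ℂ) (g : ℂ[X]) (m : ℕ) (hg : g.natDegree ≤ m) (k : ℕ) :
    ((Lk κ)^[k] g).natDegree ≤ m ∧ ((Lk κ)^[k] g).coeff m = κ ^ k * g.coeff m := by
  induction k with
  | zero => simpa using hg
  | succ k ih =>
    obtain ⟨h1, h2⟩ := ih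
    rw [Function.iterate_succ_apply']
    have h3 : (derivative ((Lk κ)^[k] g)).coeff m = 0 := by
      rw [coeff_derivative, coeff_eq_zero_of_natDegree_lt (by omega), zero_mul]
    constructor
    · refine (natDegree_add_le _ _).trans (max_le ?_ ?_)
      · exact (natDegree_derivative_le _).trans (by omega)
      · exact (natDegree_C_mul_le _ _).trans h1
    · rw [Lk, coeff_add, h3, coeff_C_mul, h2, pow_succ]
      ring

lemma wronsk_i {N : ℕ} (K : Fin N → ℂ) (hK : Function.Injective K) (m : Fin N → ℕ)
    (p : Fin N → ℂ[X]) (hp : ∀ i, p i ≠ 0 ∧ (p i).natDegree = m i) :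
    ∃ D : ℂ[X], D ≠ 0 ∧ ∀ u, D.eval u ≠ 0 →
      (Matrix.of fun j i : Fin N => iteratedDeriv j (qe (K i) (p i)) u).det ≠ 0 := by
  set Q : Matrix (Fin N) (Fin N) ℂ[X] := Matrix.of fun j i => (Lk (K i))^[j] (p i) with hQ
  refine ⟨Q.det, ?_, ?_⟩
  · have h1 : Q.det.coeff (∑ i, m i) = (∏ i, (p i).coeff (m i)) *
        (Matrix.vandermonde K).det := by
      rw [← Matrix.det_transpose (Matrix.vandermonde K), Matrix.det_apply', Matrix.det_apply',
        finset_sum_coeff, Finset.mul_sum]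
      refine Finset.sum_congr rfl fun σ _ => ?_
      have h2 := (coeff_prod_le Finset.univ (fun i => Q (σ i) i) m (fun i _ =>
        (Lk_iter_deg (K i) (p i) (m i) (hp i).2.le _).1)).2
      rw [← C_eq_intCast, coeff_C_mul, h2]
      simp only [Matrix.transpose_apply, Matrix.vandermonde_apply, hQ, Matrix.of_apply]
      rw [Finset.prod_congr rfl fun i _ => (Lk_iter_deg (K i) (p i) (m i) (hp i).2.le _).2,
        Finset.prod_mul_distrib]
      ring
    intro h0
    rw [h0, coeff_zero] at h1
    refine mul_ne_zero ?_ (Matrix.det_vandermonde_ne_zero_iff.2 hK) h1.symm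
    rw [Finset.prod_ne_zero_iff]
    intro i _
    rw [← (hp i).2]
    exact leadingCoeff_ne_zero.2 (hp i).1
  · intro u hu
    have h1 : (Matrix.of fun j i : Fin N => iteratedDeriv j (qe (K i) (p i)) u) =
        Matrix.of fun j i : Fin N => Complex.exp (K i * u) * (Q.map (eval u)) j i := by
      ext j i
      simp only [Matrix.of_apply, qe_iter, Matrix.map_apply, hQ]
      rfl
    have h2 := Matrix.det_mul_row (fun i => Complex.exp (K i * u)) (Q.map (eval u))
    rw [h1, h2]
    refine mul_ne_zero (Finset.prod_ne_zero_iff.2 fun i _ => Complex.exp_ne_zero _) ?_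
    have h3 : (Q.map (eval u)).det = Q.det.eval u := by
      have := (RingHom.map_det (evalRingHom u) Q).symm
      exact this
    rw [h3]
    exact hu

lemma wronsk_ii {N : ℕ} (p : Fin N → ℂ[X]) (u : ℂ)
    (h : ∀ c : Fin N → ℂ, (X - C u) ^ N ∣ ∑ i, C (c i) * p i → c = 0) :
    (Matrix.of fun j i : Fin N => iteratedDeriv j (qe 0 (p i)) u).det ≠ 0 := by
  intro h0
  obtain ⟨c, hc, h1⟩ := Matrix.exists_mulVec_eq_zero_iff.2 h0
  refine hc (h c (dvd_of_taylor _ _ _ fun k hk => ?_))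
  have h2 := congrFun h1 ⟨k, hk⟩
  simp only [Matrix.mulVec, dotProduct, Matrix.of_apply, qe_iter, Lk_zero, qe, zero_mul,
    Complex.exp_zero, one_mul, Pi.zero_apply] at h2
  have h3 : eval u (derivative^[k] (∑ i, C (c i) * p i)) = 0 := by
    rw [iterate_derivative_sum, eval_finset_sum, ← h2]
    refine Finset.sum_congr rfl fun i _ => ?_
    rw [iterate_derivative_C_mul, eval_C_mul, mul_comm]
  rw [taylor_coeff]
  have h4 := congrArg (eval u) (congrFun (factorial_smul_hasseDeriv (R := ℂ) k) (∑ i, C (c i) * p i))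
  rw [h3] at h4
  rw [LinearMap.smul_apply, eval_smul, nsmul_eq_mul] at h4
  exact (mul_eq_zero.1 h4).resolve_left (by exact_mod_cast k.factorial_ne_zero)

end Span
end GaudinModel

set_option linter.all false
set_option linter.unusedSectionVars false
set_option linter.unusedSimpArgs false
namespace GaudinModel

section HW
variable {N : ℕ} {V : Type*} [AddCommGroup V] [Module ℂ V] [FiniteDimensional ℂ V]
  (E : Fin N → Fin N → Module.End ℂ V)

/-- The relations of `gl_N`. -/
def IsRep {V : Type*} [AddCommGroup V] [Module ℂ V] (E : Fin N → Fin N → Module.End ℂ V) : Prop :=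
  ∀ a b c d, E a b * E c d - E c d * E a b =
    (if b = c then (1 : ℂ) else 0) • E a d - (if d = a then (1 : ℂ) else 0) • E c b

lemma IsRep.app {E : Fin N → Fin N → Module.End ℂ V} (h : IsRep E) (a b c d : Fin N) (x : V) :
    E a b (E c d x) = E c d (E a b x) + (if b = c then (1 : ℂ) else 0) • E a d x
      - (if d = a then (1 : ℂ) else 0) • E c b x := by
  have := LinearMap.congr_fun (h a b c d) x
  simp only [LinearMap.sub_apply, Module.End.mul_apply, LinearMap.smul_apply] at this
  rw [sub_eq_iff_eq_add] at this
  rw [this]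
  abel

/-- Words in lowering operators applied to `v`. -/
inductive Low (v : V) : V → Prop
  | base : Low v v
  | step (c d : Fin N) (h : d < c) (w : V) : Low v w → Low v (E c d w)

def LowS (v : V) : Submodule ℂ V := Submodule.span ℂ {x | Low E v x}

/-- Weight vectors. -/
def IsWt (μ : Fin N → ℂ) (x : V) : Prop := ∀ a, E a a x = μ a • x

def Pos (δ : Fin N → ℤ) : Prop := ∀ t : Fin N → ℤ, StrictAnti t → 0 < ∑ a, δ a * t a

variable {E} (hE : IsRep E) {v : V} (hv0 : v ≠ 0) (hs : ∀ a b, a < b → E a b v = 0)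
  (Λ : Fin N → ℤ) (hΛ : ∀ a b : Fin N, a ≤ b → Λ b ≤ Λ a) (hw : IsWt E (fun a => (Λ a : ℂ)) v)

include hE hs hw in
lemma LowS_inv (a b : Fin N) (x : V) (hx : x ∈ LowS E v) : E a b x ∈ LowS E v := by
  have hstep : ∀ (c d : Fin N), d < c → ∀ y ∈ LowS E v, E c d y ∈ LowS E v := by
    intro c d hcd y hy
    induction hy using Submodule.span_induction with
    | mem y hy => exact Submodule.subset_span (Low.step c d hcd y hy)
    | zero => rw [map_zero]; exact Submodule.zero_mem _
    | add y z _ _ h1 h2 => rw [map_add]; exact Submodule.add_mem _ h1 h2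
    | smul c y _ h => rw [map_smul]; exact Submodule.smul_mem _ _ h
  have hlow : ∀ y, Low E v y → ∀ a b, E a b y ∈ LowS E v := by
    intro y hy
    induction hy with
    | base =>
      intro a b
      have hvm : v ∈ LowS E v := Submodule.subset_span Low.base
      rcases lt_trichotomy a b with h | h | h
      · rw [hs a b h]; exact Submodule.zero_mem _
      · subst h; rw [hw a]; exact Submodule.smul_mem _ _ hvm
      · exact hstep a b h v hvm
    | step c d h w _ ih =>
      intro a b
      rw [hE.app]
      exact Submodule.sub_mem _ (Submodule.add_mem _ (hstep c d h _ (ih a b))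
        (Submodule.smul_mem _ _ (ih a d))) (Submodule.smul_mem _ _ (ih c b))
  induction hx using Submodule.span_induction with
  | mem y hy => exact hlow y hy a b
  | zero => rw [map_zero]; exact Submodule.zero_mem _
  | add y z _ _ h1 h2 => rw [map_add]; exact Submodule.add_mem _ h1 h2
  | smul c y _ h => rw [map_smul]; exact Submodule.smul_mem _ _ h

include hE in
lemma wt_shift (μ : Fin N → ℂ) (x : V) (hx : IsWt E μ x) (c d : Fin N) :
    IsWt E (fun a => μ a + (if a = c then 1 else 0) - (if a = d then 1 else 0)) (E c d x) := by
  intro a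
  rw [hE.app, hx a, map_smul, sub_smul, add_smul]
  congr 1
  · congr 1
    by_cases h : a = c
    · subst h; rfl
    · simp [h]
  · by_cases h : a = d
    · subst h; simp
    · simp [h, Ne.symm h]

include hE hw in
lemma Low_wt (x : V) (hx : Low E v x) : x = v ∨
    ∃ μ : Fin N → ℤ, IsWt E (fun a => (μ a : ℂ)) x ∧ Pos (fun a => Λ a - μ a) := by
  have gen : ∃ μ : Fin N → ℤ, IsWt E (fun a => (μ a : ℂ)) x ∧
      ((x = v ∧ μ = Λ) ∨ Pos (fun a => Λ a - μ a)) := by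
    induction hx with
    | base => exact ⟨Λ, hw, Or.inl ⟨rfl, rfl⟩⟩
    | step c d hcd w _ ih =>
      obtain ⟨μ, h1, h2⟩ := ih
      refine ⟨fun a => μ a + (if a = c then 1 else 0) - (if a = d then 1 else 0), ?_, Or.inr ?_⟩
      · have := wt_shift hE _ w h1 c d
        intro a
        rw [this a]
        push_cast
        rfl
      · intro t ht
        have h3 : 0 ≤ ∑ a, (Λ a - μ a) * t a := by
          rcases h2 with ⟨_, h2⟩ | h2
          · simp [h2]
          · exact (h2 t ht).le
        have h4 : ∑ a, (Λ a - (μ a + (if a = c then 1 else 0) - (if a = d then 1 else 0))) * t a =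
            ∑ a, (Λ a - μ a) * t a + (t d - t c) := by
          rw [← sub_eq_iff_eq_add', ← Finset.sum_sub_distrib]
          have : ∀ a, (Λ a - (μ a + (if a = c then 1 else 0) - (if a = d then 1 else 0))) * t a
              - (Λ a - μ a) * t a = (if a = d then t a else 0) - (if a = c then t a else 0) := by
            intro a
            split_ifs <;> ring
          rw [Finset.sum_congr rfl fun a _ => this a, Finset.sum_sub_distrib]
          simp
        rw [h4]
        have := ht hcd
        omega
  obtain ⟨μ, h1, h2⟩ := gen
  rcases h2 with h2 | h2
  · exact Or.inl h2.1
  · exact Or.inr ⟨μ, h1, h2⟩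

include hE in
lemma wt_comm (a b : Fin N) : Commute (E a a) (E b b) := by
  have := hE a a b b
  by_cases h : a = b
  · subst h; exact Commute.refl _
  · simp only [h, Ne.symm h, if_false, zero_smul, sub_zero] at this
    exact sub_eq_zero.1 this

include hE in
lemma wt_indep : iSupIndep fun χ : Fin N → ℂ => ⨅ a, (E a a).eigenspace (χ a) := by
  have := Module.End.independent_iInf_maxGenEigenspace_of_forall_mapsTo (fun a => E a a)
    (fun i j φ => Module.End.mapsTo_maxGenEigenspace_of_comm (wt_comm hE j i) φ)
  exact this.mono fun χ => iInf_mono fun a => Module.End.eigenspace_le_maxGenEigenspace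

lemma mem_wt (χ : Fin N → ℂ) (x : V) : x ∈ ⨅ a, (E a a).eigenspace (χ a) ↔ IsWt E χ x := by
  simp [Submodule.mem_iInf, Module.End.mem_eigenspace_iff, IsWt]

include hE in
/-- a weight vector in the sum of weight spaces other than its own vanishes -/
lemma wt_zero (μ : Fin N → ℂ) (x : V) (hx : IsWt E μ x) (A : Set V)
    (hA : ∀ y ∈ A, ∃ χ, χ ≠ μ ∧ IsWt E χ y) (hxA : x ∈ Submodule.span ℂ A) : x = 0 := by
  have h1 := wt_indep hE μ
  refine (Submodule.disjoint_def.1 h1) x ((mem_wt μ x).2 hx) ?_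
  refine (Submodule.span_le.2 ?_) hxA
  intro y hy
  obtain ⟨χ, h2, h3⟩ := hA y hy
  exact Submodule.mem_iSup_of_mem χ (Submodule.mem_iSup_of_mem h2 ((mem_wt χ y).2 h3))

include hE in
lemma exists_wt (Q : Submodule ℂ V) (hQ : Q ≠ ⊥) (hinv : ∀ a, ∀ x ∈ Q, E a a x ∈ Q) :
    ∃ x ∈ Q, x ≠ 0 ∧ ∃ μ, IsWt E μ x := by
  have key : ∀ s : Finset (Fin N), ∃ μ : Fin N → ℂ, ∃ R : Submodule ℂ V, R ≤ Q ∧ R ≠ ⊥ ∧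
      (∀ a, ∀ x ∈ R, E a a x ∈ R) ∧ ∀ a ∈ s, ∀ x ∈ R, E a a x = μ a • x := by
    intro s
    induction s using Finset.induction_on with
    | empty => exact ⟨0, Q, le_rfl, hQ, hinv, by simp⟩
    | insert b s hb ih =>
      obtain ⟨μ, R, h1, h2, h3, h4⟩ := ih
      haveI : Nontrivial R := Submodule.nontrivial_iff_ne_bot.2 h2
      obtain ⟨θ, hθ⟩ := Module.End.exists_eigenvalue ((E b b).restrict (h3 b))
      obtain ⟨y, hy⟩ := hθ.exists_hasEigenvector
      have hy1 : E b b y.1 = θ • y.1 := congrArg Subtype.val hy.apply_eq_smul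
      have hy2 : y.1 ≠ 0 := fun h => hy.2 (Subtype.ext h)
      refine ⟨Function.update μ b θ, R ⊓ (E b b).eigenspace θ, inf_le_left.trans h1, ?_, ?_, ?_⟩
      · intro h
        exact hy2 ((Submodule.mem_bot ℂ).1 (h ▸ ⟨y.2, Module.End.mem_eigenspace_iff.2 hy1⟩))
      · rintro a x ⟨hx1, hx2⟩
        refine ⟨h3 a x hx1, Module.End.mem_eigenspace_iff.2 ?_⟩
        have := LinearMap.congr_fun (wt_comm hE b a).eq x
        simp only [Module.End.mul_apply] at this
        rw [this, Module.End.mem_eigenspace_iff.1 hx2, map_smul]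
      · rintro a ha x ⟨hx1, hx2⟩
        by_cases hab : a = b
        · subst hab
          rw [Function.update_self]
          exact Module.End.mem_eigenspace_iff.1 hx2
        · rw [Function.update_of_ne hab]
          exact h4 a ((Finset.mem_insert.1 ha).resolve_left hab) x hx1
  obtain ⟨μ, R, h1, h2, _, h4⟩ := key Finset.univ
  obtain ⟨x, hx, hx0⟩ := Submodule.exists_mem_ne_zero_of_ne_bot h2
  exact ⟨x, h1 hx, hx0, μ, fun a => h4 a (Finset.mem_univ a) x hx⟩

include hE in
lemma exists_sing (Q : Submodule ℂ V) (hQ : Q ≠ ⊥) (hinv : ∀ a b, ∀ x ∈ Q, E a b x ∈ Q) :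
    ∃ x ∈ Q, x ≠ 0 ∧ (∃ μ, IsWt E μ x) ∧ ∀ a b, a < b → E a b x = 0 := by
  set t : Fin N → ℂ := fun a => -(a : ℕ) with ht
  set H : Module.End ℂ V := ∑ a, t a • E a a with hH
  have hHx : ∀ μ x, IsWt E μ x → H x = (∑ a, t a * μ a) • x := by
    intro μ x hx
    rw [hH, LinearMap.sum_apply, Finset.sum_smul]
    exact Finset.sum_congr rfl fun a _ => by rw [LinearMap.smul_apply, hx a, smul_smul]
  set Θ : Set ℂ := {θ | ∃ x ∈ Q, x ≠ 0 ∧ ∃ μ, IsWt E μ x ∧ θ = ∑ a, t a * μ a} with hΘ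
  have hfin : Θ.Finite := by
    refine H.finite_hasEigenvalue.subset ?_
    rintro θ ⟨x, _, hx0, μ, hμ, rfl⟩
    exact Module.End.hasEigenvalue_of_hasEigenvector ⟨Module.End.mem_eigenspace_iff.2 (hHx μ x hμ), hx0⟩
  have hne : Θ.Nonempty := by
    obtain ⟨x, h1, h2, μ, h3⟩ := exists_wt hE Q hQ (fun a => hinv a a)
    exact ⟨_, x, h1, h2, μ, h3, rfl⟩
  obtain ⟨θ, ⟨x, hxQ, hx0, μ, hμ, hθ⟩, hmax⟩ := Set.exists_max_image Θ Complex.re hfin hne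
  refine ⟨x, hxQ, hx0, ⟨μ, hμ⟩, fun a b hab => ?_⟩
  by_contra hne
  have h1 := hmax _ ⟨E a b x, hinv a b x hxQ, hne, _, wt_shift hE μ x hμ a b, rfl⟩
  have h2 : ∑ c, t c * (μ c + (if c = a then 1 else 0) - (if c = b then 1 else 0)) =
      θ + (t a - t b) := by
    rw [hθ]
    simp only [mul_sub, mul_add, Finset.sum_sub_distrib, Finset.sum_add_distrib]
    simp
    ring
  rw [h2, ht] at h1
  simp at h1
  have : (a : ℕ) < (b : ℕ) := hab
  omega

attribute [local instance] LieRing.ofAssociativeRing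

include hE in
lemma sing_dom (x : V) (hx0 : x ≠ 0) (μ : Fin N → ℂ) (hμ : IsWt E μ x)
    (hsx : ∀ a b, a < b → E a b x = 0) (a b : Fin N) (hab : a < b) : ∃ k : ℕ, μ a - μ b = k := by
  by_cases hh : E a a - E b b = 0
  · have h1 : (μ a - μ b) • x = 0 := by
      rw [sub_smul, ← hμ a, ← hμ b, ← LinearMap.sub_apply, hh, LinearMap.zero_apply]
    exact ⟨0, by simpa using (smul_eq_zero.1 h1).resolve_right hx0⟩
  · have hne := hab.ne
    have t : IsSl2Triple (E a a - E b b) (E a b) (E b a) := by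
      refine ⟨hh, ?_, ?_, ?_⟩
      · rw [Ring.lie_def, hE a b b a]; simp
      · have h1 := hE a a a b
        have h2 := hE b b a b
        simp only [hne, hne.symm, if_true, if_false, one_smul, zero_smul, sub_zero, zero_sub] at h1 h2
        rw [sub_lie, Ring.lie_def, Ring.lie_def, h1, h2, two_smul]; abel
      · have h1 := hE a a b a
        have h2 := hE b b b a
        simp only [hne, hne.symm, if_true, if_false, one_smul, zero_smul, sub_zero, zero_sub] at h1 h2
        rw [sub_lie, Ring.lie_def, Ring.lie_def, h1, h2, two_smul]; abel
    have P : t.HasPrimitiveVectorWith x (μ a - μ b) := by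
      refine ⟨hx0, ?_, ?_⟩
      · change (E a a - E b b) x = _
        rw [LinearMap.sub_apply, hμ a, hμ b, sub_smul]
      · exact hsx a b hab
    exact P.exists_nat

/-- The Casimir operator. -/
def Cas (E : Fin N → Fin N → Module.End ℂ V) : Module.End ℂ V := ∑ a, ∑ b, E a b * E b a

include hE in
lemma Cas_comm (c d : Fin N) : E c d * Cas E = Cas E * E c d := by
  rw [← sub_eq_zero, Cas]
  simp only [Finset.mul_sum, Finset.sum_mul, ← Finset.sum_sub_distrib]
  have : ∀ a b, E c d * (E a b * E b a) - E a b * E b a * E c d =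
      ((if d = a then (1 : ℂ) else 0) • E c b - (if b = c then (1 : ℂ) else 0) • E a d) * E b a +
      E a b * ((if d = b then (1 : ℂ) else 0) • E c a - (if a = c then (1 : ℂ) else 0) • E b d) := by
    intro a b
    rw [← hE c d a b, ← hE c d b a]
    noncomm_ring
  simp only [this]
  simp only [sub_mul, mul_sub, Finset.sum_add_distrib, Finset.sum_sub_distrib, smul_mul_assoc,
    mul_smul_comm, ite_smul, one_smul, zero_smul, ite_mul, mul_ite, zero_mul, mul_zero, Finset.sum_ite_eq, Finset.sum_ite_eq',
    Finset.mem_univ, if_true]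
  have h1 : ∑ a, ∑ b, (if d = a then E c b * E b a else 0) = ∑ b, E c b * E b d := by
    rw [Finset.sum_comm]; simp
  have h2 : ∑ a, ∑ b, (if a = c then E a b * E b d else 0) = ∑ b, E c b * E b d := by
    rw [Finset.sum_comm]; simp
  rw [h1, h2]
  abel

def casv (μ : Fin N → ℂ) : ℂ := ∑ a, ∑ b, (if a = b then μ a ^ 2 else if a < b then μ a - μ b else 0)

include hE in
lemma Cas_sing (x : V) (μ : Fin N → ℂ) (hμ : IsWt E μ x)
    (hsx : ∀ a b, a < b → E a b x = 0) : Cas E x = casv μ • x := by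
  rw [Cas, casv, LinearMap.sum_apply, Finset.sum_smul]
  refine Finset.sum_congr rfl fun a _ => ?_
  rw [LinearMap.sum_apply, Finset.sum_smul]
  refine Finset.sum_congr rfl fun b _ => ?_
  rw [Module.End.mul_apply]
  rcases lt_trichotomy a b with h | h | h
  · rw [if_neg h.ne, if_pos h, hE.app, hsx a b h, map_zero, if_pos rfl, if_pos rfl, hμ a, hμ b]
    simp [sub_smul]
  · subst h
    rw [if_pos rfl, hμ a, map_smul, hμ a, smul_smul, pow_two]
  · rw [if_neg h.ne', if_neg h.not_gt, hsx b a h, map_zero, zero_smul]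

lemma casv_sub (Λ μ : Fin N → ℤ) : casv (fun a => (Λ a : ℂ)) - casv (fun a => (μ a : ℂ)) =
    ((∑ a, (Λ a - μ a) * (Λ a + μ a + (N - 1 - 2 * (a : ℕ)))  : ℤ) : ℂ) := by
  have h0 : ∀ ν : Fin N → ℤ, casv (fun a => (ν a : ℂ)) =
      ((∑ a, (ν a ^ 2 + ν a * (N - 1 - 2 * (a : ℕ))) : ℤ) : ℂ) := by
    intro ν
    have h1 : ∑ a, ∑ b, (if a = b then ν a ^ 2 else if a < b then ν a - ν b else 0) =
        ∑ a, (ν a ^ 2 + ν a * (N - 1 - 2 * (a : ℕ))) := by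
      have e : ∀ a b : Fin N, (if a = b then ν a ^ 2 else if a < b then ν a - ν b else 0) =
          (if a = b then ν a ^ 2 else 0) + (if a < b then ν a else 0) - (if a < b then ν b else 0) := by
        intro a b
        rcases lt_trichotomy a b with h | h | h
        · simp [h, h.ne]
        · simp [h]
        · simp [h.ne', h.not_gt]
      simp only [e, Finset.sum_sub_distrib, Finset.sum_add_distrib, Finset.sum_ite_eq, Finset.mem_univ,
        if_true]
      have e1 : ∀ a : Fin N, ∑ b, (if a < b then ν a else 0) = ν a * (N - 1 - (a : ℕ)) := by
        intro a
        rw [← Finset.sum_filter, Finset.sum_const, Finset.filter_lt_eq_Ioi, Fin.card_Ioi, nsmul_eq_mul]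
        have := a.2
        rw [mul_comm]
        congr 1
        omega
      have e2 : ∑ a : Fin N, ∑ b, (if a < b then ν b else 0) = ∑ b, ν b * (b : ℕ) := by
        rw [Finset.sum_comm]
        refine Finset.sum_congr rfl fun b _ => ?_
        rw [← Finset.sum_filter, Finset.sum_const, Finset.filter_gt_eq_Iio, Fin.card_Iio, nsmul_eq_mul,
          mul_comm]
      rw [e2]
      simp only [e1]
      rw [add_sub_assoc, ← Finset.sum_sub_distrib]
      congr 1
      exact Finset.sum_congr rfl fun a _ => by ring
    rw [← h1, casv]
    push_cast
    refine Finset.sum_congr rfl fun a _ => Finset.sum_congr rfl fun b _ => ?_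
    split_ifs <;> simp
  rw [h0, h0, ← Int.cast_sub, ← Finset.sum_sub_distrib]
  congr 1
  exact Finset.sum_congr rfl fun a _ => by ring

include hE hs hw hΛ hv0 in
lemma hw_key (Q : Submodule ℂ V) (hQ : ∀ a b, ∀ x ∈ Q, E a b x ∈ Q) (hQL : Q ≤ LowS E v)
    (hvQ : v ∉ Q) : Q = ⊥ := by
  by_contra hne
  obtain ⟨q, hqQ, hq0, ⟨μ, hμ⟩, hqs⟩ := exists_sing hE Q hne hQ
  have hqL := hQL hqQ
  -- the Casimir acts by a scalar on `LowS`
  have hC : ∀ x ∈ LowS E v, Cas E x = casv (fun a => (Λ a : ℂ)) • x := by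
    intro x hx
    induction hx using Submodule.span_induction with
    | mem y hy =>
      change Low E v y at hy
      induction hy with
      | base => exact Cas_sing hE v _ hw hs
      | step c d h w _ ih =>
        have := LinearMap.congr_fun (Cas_comm hE c d) w
        simp only [Module.End.mul_apply] at this
        rw [← this, ih, map_smul]
    | zero => simp
    | add y z _ _ h1 h2 => rw [map_add, h1, h2, smul_add]
    | smul c y _ h => rw [map_smul, h, smul_comm]
  have hcas : casv (fun a => (Λ a : ℂ)) = casv μ := by
    have h1 := hC q hqL
    rw [Cas_sing hE q μ hμ hqs, ← sub_eq_zero, ← sub_smul] at h1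
    exact (sub_eq_zero.1 ((smul_eq_zero.1 h1).resolve_right hq0)).symm
  -- the weight of `q`
  set A : Set V := {x | Low E v x ∧ x ≠ v} with hA
  have hspan : LowS E v ≤ Submodule.span ℂ {v} ⊔ Submodule.span ℂ A := by
    refine Submodule.span_le.2 fun x hx => ?_
    by_cases hxv : x = v
    · exact Submodule.mem_sup_left (Submodule.mem_span_singleton.2 ⟨1, by rw [hxv, one_smul]⟩)
    · exact Submodule.mem_sup_right (Submodule.subset_span ⟨hx, hxv⟩)
  have hAw : ∀ y ∈ A, ∃ ν : Fin N → ℤ, IsWt E (fun a => (ν a : ℂ)) y ∧ Pos (fun a => Λ a - ν a) :=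
    fun y hy => (Low_wt hE Λ hw y hy.1).resolve_left hy.2
  have hposne : ¬ Pos (fun a => Λ a - Λ a) := by
    intro h
    have := h (fun a => -(a : ℕ)) (fun a b hab => by
      have : (a : ℕ) < (b : ℕ) := hab
      simp only
      omega)
    simp at this
  by_cases hμΛ : μ = fun a => (Λ a : ℂ)
  · obtain ⟨y1, hy1, y2, hy2, hy⟩ := Submodule.mem_sup.1 (hspan hqL)
    obtain ⟨c, rfl⟩ := Submodule.mem_span_singleton.1 hy1
    have h1 : y2 = 0 := by
      refine wt_zero hE (fun a => (Λ a : ℂ)) y2 ?_ A ?_ hy2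
      · intro a
        rw [← sub_eq_of_eq_add' hy.symm, map_sub, map_smul, hμ a, hw a, hμΛ, smul_sub, smul_comm]
      · intro y hy
        obtain ⟨ν, h1, h2⟩ := hAw y hy
        refine ⟨_, fun h => hposne ?_, h1⟩
        have : ν = Λ := by
          funext a
          have := congrFun h a
          exact_mod_cast this
        rw [this] at h2
        exact h2
    rw [h1, add_zero] at hy
    have hc : c ≠ 0 := by
      rintro rfl
      rw [zero_smul] at hy
      exact hq0 hy.symm
    apply hvQ
    have := Q.smul_mem c⁻¹ hqQ
    rwa [← hy, smul_smul, inv_mul_cancel₀ hc, one_smul] at this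
  · obtain ⟨ν, hν, hpos⟩ : ∃ ν : Fin N → ℤ, μ = (fun a => (ν a : ℂ)) ∧ Pos (fun a => Λ a - ν a) := by
      by_contra hcon
      push Not at hcon
      apply hq0
      refine wt_zero hE μ q hμ {x | Low E v x} (fun y hy => ?_) hqL
      by_cases hyv : y = v
      · exact ⟨_, fun h => hμΛ h.symm, hyv ▸ hw⟩
      · obtain ⟨ν, h1, h2⟩ := hAw y ⟨hy, hyv⟩
        exact ⟨_, fun h => hcon ν h.symm h2, h1⟩
    subst hν
    have hνdom : ∀ a b, a < b → ν b ≤ ν a := by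
      intro a b hab
      obtain ⟨k, hk⟩ := sing_dom hE q hq0 _ hμ hqs a b hab
      have : ν a - ν b = (k : ℤ) := by exact_mod_cast hk
      omega
    have h1 := casv_sub Λ ν
    rw [hcas, sub_self] at h1
    have h2 : ∑ a, (Λ a - ν a) * (Λ a + ν a + (N - 1 - 2 * (a : ℕ))) = 0 := by exact_mod_cast h1.symm
    have h3 := hpos (fun a => Λ a + ν a + (N - 1 - 2 * (a : ℕ))) (by
      intro a b hab
      have := hΛ a b hab.le
      have := hνdom a b hab
      have : (a : ℕ) < (b : ℕ) := hab
      simp only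
      omega)
    exact h3.ne' h2

end HW
end GaudinModel

set_option linter.all false
set_option linter.unusedSectionVars false
set_option linter.unusedSimpArgs false
namespace GaudinModel

section HWV
variable {N : ℕ}

lemma Etot_isRep {S : Type*} [Fintype S] [DecidableEq S] :
    IsRep (fun a b : Fin N => Etot (S := S) a b) := by
  intro a b c d
  have h : ∀ s : S, ∑ r : S, (ee (R := ℂ) s a b * ee r c d - ee r c d * ee s a b) =
      (if b = c then (1 : ℂ) else 0) • ee s a d - (if d = a then (1 : ℂ) else 0) • ee s c b := by
    intro s
    rw [Finset.sum_eq_single s]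
    · rw [ee_mul_same, ee_mul_same]
      simp only [ite_smul, one_smul, zero_smul]
    · intro r _ hr
      rw [ee_comm hr.symm, sub_self]
    · simp
  have e1 : (∑ s : S, ee (R := ℂ) s a b) * (∑ r : S, ee r c d) = ∑ s : S, ∑ r : S, ee s a b * ee r c d := by
    rw [Finset.sum_mul]
    exact Finset.sum_congr rfl fun s _ => Finset.mul_sum _ _ _
  have e2 : (∑ r : S, ee (R := ℂ) r c d) * (∑ s : S, ee s a b) = ∑ s : S, ∑ r : S, ee r c d * ee s a b := by
    rw [Finset.mul_sum]
    exact Finset.sum_congr rfl fun s _ => Finset.sum_mul _ _ _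
  simp only [Etot]
  rw [e1, e2, Finset.smul_sum, Finset.smul_sum, ← Finset.sum_sub_distrib, ← Finset.sum_sub_distrib]
  refine Finset.sum_congr rfl fun s _ => ?_
  rw [← h s, Finset.sum_sub_distrib]

/-- The rows of the column `c`. -/
abbrev Rc (Λ : Fin N → ℤ) (L : ℕ) (c : Fin L) : Type := {a : Fin N // ((c : ℕ) : ℤ) < Λ a}

/-- The boxes of the Young diagram of `Λ`. -/
abbrev Site (Λ : Fin N → ℤ) (L : ℕ) : Type := Σ c : Fin L, Rc Λ L c

variable (Λ : Fin N → ℤ) (L : ℕ)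

def colM (σ : Site Λ L → Fin N) (c : Fin L) : Matrix (Rc Λ L c) (Rc Λ L c) ℂ :=
  Matrix.of fun r r' => if σ ⟨c, r⟩ = r'.1 then 1 else 0

/-- The highest weight vector: product over columns of determinants. -/
def hwv : (Site Λ L → Fin N) → ℂ := fun σ => ∏ c, (colM Λ L σ c).det

lemma hwv_ne : hwv Λ L ≠ 0 := by
  intro h
  have := congrFun h (fun s => s.2.1)
  have h1 : ∀ c, colM Λ L (fun s => s.2.1) c = 1 := by
    intro c
    ext r r'
    simp [colM, Matrix.one_apply, Subtype.ext_iff]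
  simp [hwv, h1] at this

lemma colM_update_ne (σ : Site Λ L → Fin N) (c c' : Fin L) (h : c' ≠ c) (r : Rc Λ L c) (b : Fin N) :
    colM Λ L (Function.update σ ⟨c, r⟩ b) c' = colM Λ L σ c' := by
  ext x y
  simp only [colM, Matrix.of_apply]
  rw [Function.update_of_ne]
  intro he
  exact h (Sigma.mk.inj_iff.1 he).1

lemma colM_update_self (σ : Site Λ L → Fin N) (c : Fin L) (r : Rc Λ L c) (b : Fin N) :
    colM Λ L (Function.update σ ⟨c, r⟩ b) c =
      (colM Λ L σ c).updateRow r (fun y => if b = y.1 then 1 else 0) := by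
  ext x y
  simp only [colM, Matrix.of_apply, Matrix.updateRow_apply]
  by_cases hx : x = r
  · subst hx
    simp
  · rw [Function.update_of_ne, if_neg hx]
    intro he
    exact hx (eq_of_heq (Sigma.mk.inj_iff.1 he).2)

lemma hwv_update (σ : Site Λ L → Fin N) (c : Fin L) (r : Rc Λ L c) (b : Fin N) :
    hwv Λ L (Function.update σ ⟨c, r⟩ b) =
      ((colM Λ L σ c).updateRow r (fun y => if b = y.1 then 1 else 0)).det *
        ∏ c' ∈ Finset.univ.erase c, (colM Λ L σ c').det := by
  rw [hwv, ← Finset.mul_prod_erase _ _ (Finset.mem_univ c), colM_update_self]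
  congr 1
  exact Finset.prod_congr rfl fun c' hc' => by rw [colM_update_ne _ _ _ _ _ (Finset.ne_of_mem_erase hc')]

lemma col_sum (hΛ : ∀ a b : Fin N, a ≤ b → Λ b ≤ Λ a) (σ : Site Λ L → Fin N) (c : Fin L)
    (a b : Fin N) (hab : a ≤ b) :
    ∑ r : Rc Λ L c, (if σ ⟨c, r⟩ = a then
      ((colM Λ L σ c).updateRow r (fun y => if b = y.1 then 1 else 0)).det else 0) =
      if ((c : ℕ) : ℤ) < Λ b ∧ a = b then (colM Λ L σ c).det else 0 := by
  by_cases hb : ((c : ℕ) : ℤ) < Λ b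
  · have ha : ((c : ℕ) : ℤ) < Λ a := hb.trans_le (hΛ a b hab)
    set A := colM Λ L σ c with hA
    have h1 : ∀ r : Rc Λ L c, (if σ ⟨c, r⟩ = a then
        (A.updateRow r (fun y => if b = y.1 then 1 else 0)).det else 0) =
        A.adjugate ⟨b, hb⟩ r * A r ⟨a, ha⟩ := by
      intro r
      rw [Matrix.adjugate_apply]
      have h2 : (fun y : Rc Λ L c => if b = y.1 then (1 : ℂ) else 0) = Pi.single ⟨b, hb⟩ 1 := by
        funext y
        rw [Pi.single_apply]
        refine if_congr ?_ rfl rfl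
        rw [Subtype.ext_iff]
        exact eq_comm
      rw [h2, hA, colM, Matrix.of_apply, mul_ite, mul_one, mul_zero]
    rw [Finset.sum_congr rfl fun r _ => h1 r, ← Matrix.mul_apply, Matrix.adjugate_mul,
      Matrix.smul_apply, Matrix.one_apply]
    by_cases hab' : a = b
    · subst hab'
      simp [hb]
    · rw [if_neg, if_neg]
      · simp
      · exact fun h => hab' h.2
      · intro h
        exact hab' (Subtype.ext_iff.1 h).symm
  · rw [if_neg (fun h => hb h.1)]
    refine Finset.sum_eq_zero fun r _ => ?_
    have : ((colM Λ L σ c).updateRow r (fun y => if b = y.1 then 1 else 0)).det = 0 := by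
      refine Matrix.det_eq_zero_of_row_eq_zero r fun y => ?_
      rw [Matrix.updateRow_self, if_neg]
      intro h
      exact hb (h ▸ y.2)
    rw [this, ite_self]

lemma Etot_hwv (hΛ : ∀ a b : Fin N, a ≤ b → Λ b ≤ Λ a) (σ : Site Λ L → Fin N)
    (a b : Fin N) (hab : a ≤ b) :
    Etot a b (hwv Λ L) σ = ∑ c : Fin L, if ((c : ℕ) : ℤ) < Λ b ∧ a = b then hwv Λ L σ else 0 := by
  rw [Etot_apply, Fintype.sum_sigma]
  refine Finset.sum_congr rfl fun c _ => ?_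
  have h1 : ∀ r : Rc Λ L c, ee ⟨c, r⟩ a b (hwv Λ L) σ = (if σ ⟨c, r⟩ = a then
      ((colM Λ L σ c).updateRow r (fun y => if b = y.1 then 1 else 0)).det else 0) *
      ∏ c' ∈ Finset.univ.erase c, (colM Λ L σ c').det := by
    intro r
    rw [ee_apply, hwv_update, ite_mul, zero_mul]
  rw [Finset.sum_congr rfl fun r _ => h1 r, ← Finset.sum_mul, col_sum Λ L hΛ σ c a b hab, ite_mul,
    zero_mul, Finset.mul_prod_erase _ (fun c => (colM Λ L σ c).det) (Finset.mem_univ c)]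
  rfl

lemma hwv_sing (hΛ : ∀ a b : Fin N, a ≤ b → Λ b ≤ Λ a) (a b : Fin N) (hab : a < b) :
    Etot a b (hwv Λ L) = 0 := by
  funext σ
  rw [Etot_hwv Λ L hΛ σ a b hab.le]
  exact Finset.sum_eq_zero fun c _ => if_neg fun h => hab.ne h.2

lemma hwv_wt (hΛ : ∀ a b : Fin N, a ≤ b → Λ b ≤ Λ a) (h0 : ∀ a, 0 ≤ Λ a) (hL : ∀ a, Λ a ≤ L)
    (a : Fin N) : Etot a a (hwv Λ L) = (Λ a : ℂ) • hwv Λ L := by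
  funext σ
  rw [Etot_hwv Λ L hΛ σ a a le_rfl, Pi.smul_apply, smul_eq_mul]
  simp only [and_true]
  obtain ⟨k, hk⟩ := Int.eq_ofNat_of_zero_le (h0 a)
  have hkL : k ≤ L := by have := hL a; omega
  rw [Fin.sum_univ_eq_sum_range (fun c => if (c : ℤ) < Λ a then hwv Λ L σ else 0) L, ← Finset.sum_filter]
  have : (Finset.range L).filter (fun c : ℕ => (c : ℤ) < Λ a) = Finset.range k := by
    ext c
    simp only [Finset.mem_filter, Finset.mem_range]
    omega
  rw [this, Finset.sum_const, Finset.card_range, nsmul_eq_mul, hk]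
  simp

end HWV

section Inter
variable {N : ℕ} {V : Type*} [AddCommGroup V] [Module ℂ V] [FiniteDimensional ℂ V]
  (E : Fin N → Fin N → Module.End ℂ V) (hE : IsRep E)
  (Λ : Fin N → ℤ) (hΛ : ∀ a b : Fin N, a ≤ b → Λ b ≤ Λ a)
  (v : V) (hv0 : v ≠ 0) (hs : ∀ a b, a < b → E a b v = 0) (hw : ∀ a, E a a v = (Λ a : ℂ) • v)
  (hcyc : ∀ W : Submodule ℂ V, (∀ a b : Fin N, ∀ x ∈ W, E a b x ∈ W) → v ∈ W → ∀ x, x ∈ W)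

lemma intertwine {T : Type*} [AddCommGroup T] [Module ℂ T] [FiniteDimensional ℂ T]
    (F : Fin N → Fin N → Module.End ℂ T) (hF : IsRep F) (w : T) (hw0 : w ≠ 0)
    (hsw : ∀ a b, a < b → F a b w = 0) (hww : ∀ a, F a a w = (Λ a : ℂ) • w)
    (hE : IsRep E) (hΛ : ∀ a b : Fin N, a ≤ b → Λ b ≤ Λ a) (hv0 : v ≠ 0)
    (hs : ∀ a b, a < b → E a b v = 0) (hw : ∀ a, E a a v = (Λ a : ℂ) • v)
    (hcyc : ∀ W : Submodule ℂ V, (∀ a b : Fin N, ∀ x ∈ W, E a b x ∈ W) → v ∈ W → ∀ x, x ∈ W) :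
    ∃ f : V →ₗ[ℂ] T, Function.Injective f ∧ ∀ a b x, f (E a b x) = F a b (f x) := by
  set G : Fin N → Fin N → Module.End ℂ (V × T) := fun a b => (E a b).prodMap (F a b) with hG
  have hGr : IsRep G := by
    intro a b c d
    refine LinearMap.ext fun x => Prod.ext ?_ ?_
    · have := LinearMap.congr_fun (hE a b c d) x.1
      exact this
    · have := LinearMap.congr_fun (hF a b c d) x.2
      exact this
  have hGs : ∀ a b, a < b → G a b (v, w) = 0 := by
    intro a b hab
    simp [hG, hs a b hab, hsw a b hab]
  have hGw : IsWt G (fun a => (Λ a : ℂ)) (v, w) := by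
    intro a
    simp [hG, hw a, hww a]
  have hne : ((v, w) : V × T) ≠ 0 := fun h => hv0 (congrArg Prod.fst h)
  set U := LowS G (v, w) with hU
  have hUinv : ∀ a b, ∀ x ∈ U, G a b x ∈ U := fun a b x hx => LowS_inv hGr hGs Λ hGw a b x hx
  have hvU : (v, w) ∈ U := Submodule.subset_span Low.base
  have hQ1 : U ⊓ LinearMap.ker (LinearMap.fst ℂ V T) = ⊥ := by
    refine hw_key hGr hne hGs Λ hΛ hGw _ ?_ inf_le_left ?_
    · rintro a b x ⟨h1, h2⟩
      refine ⟨hUinv a b x h1, ?_⟩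
      have h2' : x.1 = 0 := h2
      change (G a b x).1 = 0
      simp [hG, h2']
    · exact fun h => hv0 h.2
  have hQ2 : U ⊓ LinearMap.ker (LinearMap.snd ℂ V T) = ⊥ := by
    refine hw_key hGr hne hGs Λ hΛ hGw _ ?_ inf_le_left ?_
    · rintro a b x ⟨h1, h2⟩
      refine ⟨hUinv a b x h1, ?_⟩
      have h2' : x.2 = 0 := h2
      change (G a b x).2 = 0
      simp [hG, h2']
    · exact fun h => hw0 h.2
  have hsur : ∀ x : V, ∃ y ∈ U, y.1 = x := by
    intro x
    have := hcyc (U.map (LinearMap.fst ℂ V T)) ?_ ⟨(v, w), hvU, rfl⟩ x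
    · exact this
    · rintro a b _ ⟨y, hy, rfl⟩
      exact ⟨G a b y, hUinv a b y hy, rfl⟩
  set p : U →ₗ[ℂ] V := LinearMap.fst ℂ V T ∘ₗ U.subtype with hp
  have hpb : Function.Bijective p := by
    constructor
    · rw [← LinearMap.ker_eq_bot, LinearMap.ker_eq_bot']
      intro y hy
      have : (y : V × T) ∈ U ⊓ LinearMap.ker (LinearMap.fst ℂ V T) := ⟨y.2, hy⟩
      rw [hQ1] at this
      exact Subtype.ext this
    · intro x
      obtain ⟨y, hy, h⟩ := hsur x
      exact ⟨⟨y, hy⟩, h⟩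
  set e := LinearEquiv.ofBijective p hpb with he
  refine ⟨LinearMap.snd ℂ V T ∘ₗ U.subtype ∘ₗ e.symm.toLinearMap, ?_, ?_⟩
  · rw [← LinearMap.ker_eq_bot, LinearMap.ker_eq_bot']
    intro x hx
    have : ((e.symm x : U) : V × T) ∈ U ⊓ LinearMap.ker (LinearMap.snd ℂ V T) := ⟨(e.symm x).2, hx⟩
    rw [hQ2] at this
    have h0 : e.symm x = 0 := Subtype.ext this
    simpa using h0
  · intro a b x
    obtain ⟨y, rfl⟩ := e.surjective x
    have h1 : E a b (e y) = e ⟨G a b y, hUinv a b y y.2⟩ := rfl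
    rw [h1]
    simp only [LinearMap.comp_apply, LinearEquiv.coe_coe, LinearEquiv.symm_apply_apply]
    rfl

end Inter

end GaudinModel

set_option linter.all false
set_option linter.unusedSectionVars false
set_option linter.unusedSimpArgs false
namespace GaudinModel

section Tens
variable {N n : ℕ} {V : Fin n → Type*} [∀ i, AddCommGroup (V i)] [∀ i, Module ℂ (V i)]
  {S : Fin n → Type} [∀ j, Fintype (S j)] [∀ j, DecidableEq (S j)]
  (f : ∀ j, V j →ₗ[ℂ] ((S j → Fin N) → ℂ))

/-- The tensor product of the maps `f j`. -/
def tens : PiTensorProduct ℂ V →ₗ[ℂ] (((Σ j, S j) → Fin N) → ℂ) :=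
  PiTensorProduct.lift (MultilinearMap.pi fun σ =>
    (MultilinearMap.mkPiAlgebra ℂ (Fin n) ℂ).compLinearMap fun j =>
      LinearMap.proj (fun s => σ ⟨j, s⟩) ∘ₗ f j)

lemma tens_tprod (x : ∀ j, V j) (σ : (Σ j, S j) → Fin N) :
    tens f (PiTensorProduct.tprod ℂ x) σ = ∏ j, f j (x j) (fun s => σ ⟨j, s⟩) := by
  simp [tens]

lemma tens_inj (hf : ∀ j, Function.Injective (f j)) : Function.Injective (tens f) := by
  have hr : ∀ j, ∃ r : ((S j → Fin N) → ℂ) →ₗ[ℂ] V j, r ∘ₗ f j = LinearMap.id := fun j =>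
    LinearMap.exists_leftInverse_of_injective _ (LinearMap.ker_eq_bot.2 (hf j))
  choose r hr using hr
  set g : (((Σ j, S j) → Fin N) → ℂ) →ₗ[ℂ] PiTensorProduct ℂ V :=
    ∑ σ : (Σ j, S j) → Fin N, (LinearMap.proj σ).smulRight
      (PiTensorProduct.tprod ℂ fun j => r j (Pi.single (fun s => σ ⟨j, s⟩) 1)) with hg
  have key : g ∘ₗ tens f = LinearMap.id := by
    refine PiTensorProduct.ext ?_
    ext x
    simp only [LinearMap.compMultilinearMap_apply, LinearMap.comp_apply, LinearMap.id_apply]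
    rw [hg, LinearMap.sum_apply]
    simp only [LinearMap.smulRight_apply, LinearMap.proj_apply, tens_tprod]
    have h1 : ∀ j, x j = ∑ τ : S j → Fin N, (f j (x j) τ) • r j (Pi.single τ 1) := by
      intro j
      have h2 : f j (x j) = ∑ τ : S j → Fin N, (f j (x j) τ) • Pi.single τ (1 : ℂ) := by
        funext τ
        simp [Finset.sum_apply, Pi.single_apply]
      have h3 := LinearMap.congr_fun (hr j) (x j)
      rw [LinearMap.comp_apply, LinearMap.id_apply, h2, map_sum] at h3
      simp only [map_smul] at h3
      exact h3.symm
    have h4 : PiTensorProduct.tprod ℂ x = PiTensorProduct.tprod ℂ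
        (fun j => ∑ τ : S j → Fin N, (f j (x j) τ) • r j (Pi.single τ 1)) := by
      congr 1
      funext j
      exact h1 j
    rw [h4, MultilinearMap.map_sum]
    simp only [MultilinearMap.map_smul_univ]
    exact Fintype.sum_equiv (Equiv.piCurry (fun j (s : S j) => Fin N)) _ _ fun σ => rfl
  intro x y hxy
  have h1 := LinearMap.congr_fun key x
  have h2 := LinearMap.congr_fun key y
  simp only [LinearMap.comp_apply, LinearMap.id_apply] at h1 h2
  rw [← h1, ← h2, hxy]

lemma tens_ee (E : ∀ i : Fin n, Fin N → Fin N → (V i →ₗ[ℂ] V i))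
    (hf : ∀ j a b x, f j (E j a b x) = Etot a b (f j x)) (j : Fin n) (a b : Fin N)
    (y : PiTensorProduct ℂ V) :
    tens f (PiTensorProduct.map
      (Function.update (fun i : Fin n => (LinearMap.id : V i →ₗ[ℂ] V i)) j (E j a b)) y) =
    ∑ s : (Σ j, S j) with s.1 = j, ee s a b (tens f y) := by
  have : tens f ∘ₗ PiTensorProduct.map
      (Function.update (fun i : Fin n => (LinearMap.id : V i →ₗ[ℂ] V i)) j (E j a b)) =
      (∑ s : (Σ j, S j) with s.1 = j, ee s a b) ∘ₗ tens f := by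
    refine PiTensorProduct.ext ?_
    ext x σ
    simp only [LinearMap.compMultilinearMap_apply, LinearMap.comp_apply, PiTensorProduct.map_tprod,
      LinearMap.sum_apply, Finset.sum_apply, tens_tprod, ee_apply]
    rw [Finset.sum_filter, Fintype.sum_sigma, Finset.sum_eq_single j]
    · simp only [if_true]
      rw [← Finset.mul_prod_erase _ _ (Finset.mem_univ j), Function.update_self, hf, Etot_apply,
        Finset.sum_mul]
      refine Finset.sum_congr rfl fun s _ => ?_
      rw [ee_apply, ite_mul, zero_mul]
      refine if_congr Iff.rfl ?_ rfl
      rw [← Finset.mul_prod_erase _ _ (Finset.mem_univ j)]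
      congr 1
      · refine congrArg _ (funext fun s' => ?_)
        by_cases h : s' = s
        · subst h; simp
        · rw [Function.update_of_ne h, Function.update_of_ne]
          intro he
          exact h (eq_of_heq (Sigma.mk.inj_iff.1 he).2)
      · refine Finset.prod_congr rfl fun i hi => ?_
        have hij := Finset.ne_of_mem_erase hi
        rw [Function.update_of_ne hij, LinearMap.id_apply]
        refine congrArg _ (funext fun s' => ?_)
        rw [Function.update_of_ne]
        intro he
        exact hij (Sigma.mk.inj_iff.1 he).1
    · intro i _ hi
      exact Finset.sum_eq_zero fun s _ => if_neg hi
    · simp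
  have h := LinearMap.congr_fun this y
  rw [LinearMap.comp_apply] at h
  rw [h, LinearMap.comp_apply, LinearMap.sum_apply]

end Tens

end GaudinModel

set_option linter.all false
set_option linter.unusedSectionVars false
set_option linter.unusedSimpArgs false
namespace GaudinModel

section Emb
variable {N n : ℕ} (V : Fin n → Type*) [∀ i, AddCommGroup (V i)] [∀ i, Module ℂ (V i)]
    [∀ i, FiniteDimensional ℂ (V i)]
    (M : Type*) [NormedAddCommGroup M] [NormedSpace ℂ M]
    (E : ∀ i : Fin n, Fin N → Fin N → (V i →ₗ[ℂ] V i))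
    (φ : M ≃ₗ[ℂ] PiTensorProduct ℂ V)

/-- The embedding of the Gaudin module into a tensor power of the vector representation. -/
lemma exists_emb (hN : 2 ≤ N) (Λ : Fin n → Fin N → ℤ)
    (hdom : ∀ i, ∀ a b : Fin N, a ≤ b → Λ i b ≤ Λ i a)
    (hpoly : ∀ i a, 0 ≤ Λ i a) (hrel : GlRel V E) (hhw : IsHW V E Λ) :
    ∃ (S : Type) (_ : Fintype S) (_ : DecidableEq S) (π : S → Fin n)
      (ι : M →ₗ[ℂ] ((S → Fin N) → ℂ)), Function.Injective ι ∧
      ∀ j a b x, ι (EE V M E φ j a b x) = ∑ s with π s = j, ee s a b (ι x) := by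
  set L : Fin n → ℕ := fun i => (Λ i ⟨0, by omega⟩).toNat with hL
  have hf : ∀ j, ∃ f : V j →ₗ[ℂ] ((Site (Λ j) (L j) → Fin N) → ℂ), Function.Injective f ∧
      ∀ a b x, f (E j a b x) = Etot a b (f x) := by
    intro j
    obtain ⟨v, hv0, hs, hw, hcyc⟩ := hhw j
    refine intertwine (E j) (Λ j) v (fun a b => Etot a b) Etot_isRep (hwv (Λ j) (L j)) (hwv_ne _ _)
      (hwv_sing _ _ (hdom j)) (hwv_wt _ _ (hdom j) (hpoly j) ?_) (hrel j) (hdom j) hv0 hs hw hcyc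
    intro a
    have h1 := hdom j ⟨0, by omega⟩ a (Fin.mk_le_of_le_val (Nat.zero_le _))
    have h2 := hpoly j ⟨0, by omega⟩
    simp only [hL]
    omega
  choose f hfi hfe using hf
  refine ⟨Σ j, Site (Λ j) (L j), inferInstance, inferInstance, Sigma.fst,
    tens f ∘ₗ φ.toLinearMap, ?_, ?_⟩
  · exact (tens_inj f hfi).comp φ.injective
  · intro j a b x
    have := tens_ee f E hfe j a b (φ x)
    simp only [EE, LinearMap.comp_apply, LinearEquiv.coe_coe, LinearEquiv.apply_symm_apply]
    exact this

variable {S : Type*} [Fintype S] [DecidableEq S] (π : S → Fin n) (ι : M →ₗ[ℂ] ((S → Fin N) → ℂ))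

lemma emb_tot (hι : ∀ j a b x, ι (EE V M E φ j a b x) = ∑ s with π s = j, ee s a b (ι x))
    (a b : Fin N) (x : M) : ι ((∑ j, EE V M E φ j a b) x) = Etot a b (ι x) := by
  rw [LinearMap.sum_apply, map_sum, Etot, LinearMap.sum_apply]
  simp only [hι]
  exact Finset.sum_fiberwise Finset.univ π (fun s => ee s a b (ι x))

lemma emb_wt (hι : ∀ j a b x, ι (EE V M E φ j a b x) = ∑ s with π s = j, ee s a b (ι x))
    (m : Fin N → ℕ) (v : M) (hv : v ∈ Wt V M E φ (fun b => (m b : ℤ))) (b : Fin N) :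
    Etot b b (ι v) = (m b : ℂ) • ι v := by
  rw [← emb_tot V M E φ π ι hι]
  rw [Wt, Submodule.mem_iInf] at hv
  have := hv b
  rw [LinearMap.mem_ker, LinearMap.sub_apply, sub_eq_zero] at this
  rw [this]
  simp

lemma emb_sing (hι : ∀ j a b x, ι (EE V M E φ j a b x) = ∑ s with π s = j, ee s a b (ι x))
    (m : Fin N → ℤ) (v : M) (hv : v ∈ SingWt V M E φ m) (a b : Fin N) (hab : a < b) :
    Etot a b (ι v) = 0 := by
  rw [← emb_tot V M E φ π ι hι]
  have h := hv.2
  simp only [SetLike.mem_coe, Submodule.mem_iInf, LinearMap.mem_ker] at h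
  rw [h a b hab, map_zero]

end Emb

lemma sc_pre (U : Set ℂ) (h : SimplyConnectedSpace U) : U.Nonempty ∧ IsPreconnected U := by
  have h1 : ConnectedSpace U := inferInstance
  exact ⟨Set.nonempty_coe_sort.1 h1.toNonempty, (isConnected_iff_connectedSpace.2 h1).2⟩

lemma exists_nonroot (U : Set ℂ) (hU : IsOpen U) (hne : U.Nonempty) (D : Polynomial ℂ) (hD : D ≠ 0) :
    ∃ u ∈ U, D.eval u ≠ 0 := by
  obtain ⟨x, hx⟩ := hne
  have hinf : U.Infinite := infinite_of_mem_nhds x (hU.mem_nhds hx)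
  by_contra h
  push Not at h
  refine hinf ((D.roots.toFinset.finite_toSet).subset fun u hu => ?_)
  simp [hD, h u hu]

end GaudinModel

namespace GaudinModel

/-- Let `v ∈ M[m]` be a common eigenvector of all Gaudin transfer
matrices, `𝒯_k(u) v = λ_k(u) v`, and let `D_v(u,∂) = ∑ (−1)^k λ_k(u) ∂^{N−k}` be the
fundamental differential operator.  (i) If `K_1, …, K_N` are pairwise distinct, the space of
local holomorphic solutions of `D_v f = 0` is spanned over `ℂ` by `N` quasi-exponentials
`e^{K_i u} p_i(u)` with `deg p_i = m_i`.  (ii) If `K = 0` and `v ∈ sing M[m]`, it is spanned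
by `N` polynomials of degrees `m_1 + N − 1, …, m_N`. -/
theorem statement_19
    {N n : ℕ} (hN : 2 ≤ N) (hn : 1 ≤ n)
    (V : Fin n → Type*) [∀ i, AddCommGroup (V i)] [∀ i, Module ℂ (V i)]
    [∀ i, FiniteDimensional ℂ (V i)]
    (M : Type*) [NormedAddCommGroup M] [NormedSpace ℂ M] [FiniteDimensional ℂ M]
    (Λ : Fin n → Fin N → ℤ)
    (hdom : ∀ i, ∀ a b : Fin N, a ≤ b → Λ i b ≤ Λ i a)
    (hpoly : ∀ i a, 0 ≤ Λ i a)
    (hlast : ∀ i, Λ i ⟨N - 1, by omega⟩ = 0)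
    (E : ∀ i : Fin n, Fin N → Fin N → (V i →ₗ[ℂ] V i))
    (hrel : GlRel V E)
    (hhw : IsHW V E Λ)
    (φ : M ≃ₗ[ℂ] PiTensorProduct ℂ V)
    (z : Fin n → ℂ) (hz : Function.Injective z)
    (K : Fin N → ℂ)
    (m : Fin N → ℕ)
    -- `𝒯 k` are the Gaudin transfer matrices:
    (𝒯 : ℕ → ℂ → Module.End ℂ M)
    (h𝒯 : ∀ f : ℂ → M, Differentiable ℂ f → ∀ u : ℂ, GoodG z u →
      Dg V M E φ z (Matrix.diagonal K) f u =
        ∑ k ∈ Finset.range (N + 1), ((-1 : ℤ) ^ k) • 𝒯 k u (iteratedDeriv (N - k) f u))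
    -- `v` is a common eigenvector of the transfer matrices, with eigenvalues `lam k u`:
    (v : M) (hv : v ∈ Wt V M E φ (fun b => (m b : ℤ))) (hvne : v ≠ 0)
    (lam : ℕ → ℂ → ℂ)
    (heig : ∀ k ≤ N, ∀ u : ℂ, GoodG z u → 𝒯 k u v = lam k u • v) :
    -- (i) the distinct-eigenvalue case
    ((∀ i j, i ≠ j → K i ≠ K j) →
      ∃ p : Fin N → Polynomial ℂ,
        (∀ i, p i ≠ 0 ∧ (p i).natDegree = m i) ∧
        (∀ i, ∀ u : ℂ, GoodG z u →
          Dfund N lam (fun x => Complex.exp (K i * x) * (p i).eval x) u = 0) ∧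
        (∀ U : Set ℂ, IsOpen U → (∀ j, z j ∉ U) → SimplyConnectedSpace U →
          ∀ f : ℂ → ℂ, DifferentiableOn ℂ f U → (∀ u ∈ U, Dfund N lam f u = 0) →
            ∃ c : Fin N → ℂ, ∀ u ∈ U,
              f u = ∑ i, c i * (Complex.exp (K i * u) * (p i).eval u))) ∧
    -- (ii) the case `K = 0`, `v ∈ sing M[m]`
    ((∀ i, K i = 0) → v ∈ SingWt V M E φ (fun b => (m b : ℤ)) →
      ∃ p : Fin N → Polynomial ℂ,
        (∀ i, p i ≠ 0 ∧ (p i).natDegree = m i + (N - 1 - (i : ℕ))) ∧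
        (∀ i, ∀ u : ℂ, GoodG z u → Dfund N lam (fun x => (p i).eval x) u = 0) ∧
        (∀ U : Set ℂ, IsOpen U → (∀ j, z j ∉ U) → SimplyConnectedSpace U →
          ∀ f : ℂ → ℂ, DifferentiableOn ℂ f U → (∀ u ∈ U, Dfund N lam f u = 0) →
            ∃ c : Fin N → ℂ, ∀ u ∈ U, f u = ∑ i, c i * (p i).eval u)) := by
  obtain ⟨S, _, _, π, ι, hinj, hι⟩ := exists_emb V M E φ hN Λ hdom hpoly hrel hhw
  have hvι : ι v ≠ 0 := fun h => hvne (hinj (h.trans (map_zero ι).symm))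
  obtain ⟨c0, hc0⟩ := Function.ne_iff.1 hvι
  have hwt := emb_wt V M E φ π ι hι m v hv
  have hprop := link_prop V M E φ z K π ι hinj hι 𝒯 h𝒯 v lam heig
  have hzero := link_zero V M E φ z K π ι hinj hι 𝒯 h𝒯 v lam heig hvne
  have hlam := lam_zero V M E φ z K π ι hinj hι 𝒯 h𝒯 v lam heig hvne
  have hgood : ∀ U : Set ℂ, (∀ j, z j ∉ U) → ∀ u ∈ U, GoodG z u :=
    fun U hU u hu j h => hU j (h ▸ hu)
  refine ⟨fun hK => ?_, fun hK hsing => ?_⟩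
  · have hKi : Function.Injective K := fun i j h => by
      by_contra hij
      exact hK i j hij h
    have hg := fun a => alg_i (z ∘ π) K hN hKi m a (ι v) hwt c0 hc0 (fun g c => hprop (K a) g c0 c)
    choose p hp0 hpd hpD using hg
    have hD : ∀ i, ∀ u : ℂ, GoodG z u → Dfund N lam (qe (K i) (p i)) u = 0 :=
      fun i u hu => hzero (K i) (p i) (hpD i) u hu
    refine ⟨p, fun i => ⟨hp0 i, hpd i⟩, hD, ?_⟩
    intro U hU hzU hsc f hf hfD
    obtain ⟨hne, hpre⟩ := sc_pre U hsc
    obtain ⟨D, hD0, hdet⟩ := wronsk_i K hKi m p (fun i => ⟨hp0 i, hpd i⟩)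
    obtain ⟨u1, hu1, hu1D⟩ := exists_nonroot U hU hne D hD0
    exact span_lemma hN lam (fun i => qe (K i) (p i)) (fun i => qe_diff _ _) U hU hpre
      (fun i u hu => hD i u (hgood U hzU u hu)) (fun u hu => hlam u (hgood U hzU u hu)) u1 hu1
      (hdet u1 hu1D) f hf hfD
  · have hs := emb_sing V M E φ π ι hι _ v hsing
    have hK' : (fun c => K c - 0) = K := funext fun c => sub_zero _
    obtain ⟨p, hp, hpD, hpw⟩ := alg_ii (z ∘ π) K hN hK m (ι v) hwt hs c0 hc0 (fun g c => by
      have := hprop 0 g c0 c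
      rwa [hK'] at this)
    have hq : ∀ i, qe 0 (p i) = fun x => (p i).eval x := fun i => funext fun x => by simp [qe]
    have hD : ∀ i, ∀ u : ℂ, GoodG z u → Dfund N lam (fun x => (p i).eval x) u = 0 := by
      intro i u hu
      rw [← hq i]
      exact hzero 0 (p i) (by rw [hK']; exact hpD i) u hu
    refine ⟨p, hp, hD, ?_⟩
    intro U hU hzU hsc f hf hfD
    obtain ⟨⟨u1, hu1⟩, hpre⟩ := sc_pre U hsc
    have hdet := wronsk_ii p u1 (fun c hc => hpw u1 c (wz_good z π u1 (hgood U hzU u1 hu1)) hc)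
    simp only [hq] at hdet
    exact span_lemma hN lam (fun i x => (p i).eval x) (fun i => (p i).differentiable) U hU hpre
      (fun i u hu => hD i u (hgood U hzU u hu)) (fun u hu => hlam u (hgood U hzU u hu)) u1 hu1
      hdet f hf hfD

end GaudinModel
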